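/- arXiv:math/0605673 — 2 statements merged into one kernel-verified Lean document; each statement's English description precedes it below -/
import Mathlib

section
/- For any flag complex C there is a balanced complex C' with the same face vector as C. Equivalently: if G is a finite simple graph whose largest clique has exactly r vertices, then there exists a simplicial complex C' of dimension r-1 that is r-colorable and satisfies c_i(C') = c_i(G) for every i ≥ 0. -/
/-- A family of finsets of `Fin n` is a simplicial complex on the vertex set `Fin n` if it
contains the empty set, all singletons, and is closed under taking subsets. -/
def IsSimplicialComplex {n : ℕ} (C : Finset (Finset (Fin n))) : Prop :=
  ∅ ∈ C ∧ (∀ v : Fin n, {v} ∈ C) ∧ ∀ s ∈ C, ∀ t ⊆ s, t ∈ C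

/-- The `i`-th face number of a complex: the number of faces with exactly `i` vertices. -/
def faceCount {n : ℕ} (C : Finset (Finset (Fin n))) (i : ℕ) : ℕ :=
  (C.filter fun s => s.card = i).card

/-- A complex is `r`-colorable if its vertices can be colored by `r` colors so that the
coloring is injective on every face. -/
def ComplexColorable {n : ℕ} (C : Finset (Finset (Fin n))) (r : ℕ) : Prop :=
  ∃ f : Fin n → Fin r, ∀ s ∈ C, Set.InjOn f ↑s

namespace Froh
open Finset
open scoped FinsetFamily

/-- binary value of a finite set of naturals; the order it induces is the colex order -/
def val (s : Finset ℕ) : ℕ := ∑ x ∈ s, 2 ^ x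

lemma val_lt_iff {s t : Finset ℕ} : val s < val t ↔ toColex s < toColex t :=
  Finset.geomSum_lt_geomSum_iff_toColex_lt_toColex le_rfl

lemma val_inj {s t : Finset ℕ} (h : val s = val t) : s = t :=
  Finset.geomSum_injective (n := 2) le_rfl h

lemma val_insert {s : Finset ℕ} {a : ℕ} (h : a ∉ s) : val (insert a s) = 2 ^ a + val s :=
  Finset.sum_insert h

lemma val_lt_pow {s : Finset ℕ} {b : ℕ} (h : ∀ x ∈ s, x < b) : val s < 2 ^ b := by
  have h1 : toColex s < toColex {b} := Finset.Colex.toColex_lt_singleton.2 h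
  have := val_lt_iff.2 h1
  simpa [val] using this

lemma pow_le_val {s : Finset ℕ} {b : ℕ} (h : b ∈ s) : 2 ^ b ≤ val s :=
  Finset.single_le_sum (f := fun x => 2 ^ x) (fun _ _ => Nat.zero_le _) h

lemma lt_of_val_lt {s t : Finset ℕ} {b : ℕ} (h : ∀ x ∈ t, x < b) (hv : val s ≤ val t) :
    ∀ x ∈ s, x < b := by
  intro x hx
  have h1 := pow_le_val hx
  have h2 := val_lt_pow h
  exact (Nat.pow_lt_pow_iff_right (by norm_num : 1 < 2)).1 (by omega)

lemma val_lt_val_of {s t : Finset ℕ} {b : ℕ} (h : ∀ x ∈ s, x < b) (hb : ∃ y ∈ t, b ≤ y) :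
    val s < val t := by
  obtain ⟨y, hy, hby⟩ := hb
  have h1 := pow_le_val hy
  have h2 := val_lt_pow h
  have h3 : 2 ^ b ≤ 2 ^ y := Nat.pow_le_pow_right (by norm_num) hby
  omega

lemma val_image_lt {f : ℕ → ℕ} (hf : StrictMono f) {s t : Finset ℕ} :
    val (s.image f) < val (t.image f) ↔ val s < val t := by
  rw [val_lt_iff, val_lt_iff]
  exact Finset.Colex.toColex_image_lt_toColex_image hf

lemma val_mono {s t : Finset ℕ} (h : s ⊆ t) : val s ≤ val t :=
  Finset.sum_le_sum_of_subset h

/-- colored sets of size `k` -/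
def X (r k : ℕ) (s : Finset ℕ) : Prop := s.card = k ∧ ∀ x ∈ s, ∀ y ∈ s, x % r = y % r → x = y

def Y (r c k : ℕ) (s : Finset ℕ) : Prop := X r k s ∧ ∀ x ∈ s, x % r ≠ c

def IsInit (P : Finset ℕ → Prop) (A : Finset (Finset ℕ)) : Prop :=
  (∀ s ∈ A, P s) ∧ ∀ s ∈ A, ∀ t, P t → val t < val s → t ∈ A

lemma IsInit.total {P} {A B : Finset (Finset ℕ)} (hA : IsInit P A) (hB : IsInit P B) :
    A ⊆ B ∨ B ⊆ A := by
  by_contra! h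
  obtain ⟨h1, h2⟩ := h
  obtain ⟨a, ha, ha'⟩ := Finset.not_subset.1 h1
  obtain ⟨b, hb, hb'⟩ := Finset.not_subset.1 h2
  rcases lt_trichotomy (val a) (val b) with h | h | h
  · exact ha' (hB.2 b hb a (hA.1 a ha) h)
  · exact ha' (val_inj h ▸ hb)
  · exact hb' (hA.2 a ha b (hB.1 b hb) h)

lemma IsInit.subset {P} {A B : Finset (Finset ℕ)} (hA : IsInit P A) (hB : IsInit P B)
    (h : A.card ≤ B.card) : A ⊆ B := by
  rcases hA.total hB with h1 | h1
  · exact h1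
  · exact (Finset.eq_of_subset_of_card_le h1 h).symm.subset

lemma IsInit.eq {P} {A B : Finset (Finset ℕ)} (hA : IsInit P A) (hB : IsInit P B)
    (h : A.card = B.card) : A = B :=
  (hA.subset hB h.le).antisymm (hB.subset hA h.ge)

lemma IsInit.union {P} {A B : Finset (Finset ℕ)} (hA : IsInit P A) (hB : IsInit P B) :
    IsInit P (A ∪ B) := by
  rcases hA.total hB with h | h
  · rwa [Finset.union_eq_right.2 h]
  · rwa [Finset.union_eq_left.2 h]

/-- initial segments minimize the total value -/
lemma IsInit.sum_lt {P} {A B : Finset (Finset ℕ)} (hA : IsInit P A) (hB : ∀ s ∈ B, P s)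
    (h : A.card = B.card) (hne : A ≠ B) : ∑ s ∈ A, val s < ∑ s ∈ B, val s := by
  have key : ∀ a ∈ A \ B, ∀ b ∈ B \ A, val a < val b := by
    intro a ha b hb
    rw [mem_sdiff] at ha hb
    rcases lt_trichotomy (val a) (val b) with h | h | h
    · exact h
    · exact absurd (val_inj h ▸ hb.1) ha.2
    · exact absurd (hA.2 a ha.1 b (hB b hb.1) h) hb.2
  have hc : (A \ B).card = (B \ A).card := Finset.card_sdiff_comm h
  have hn : (B \ A).Nonempty := by
    rw [Finset.sdiff_nonempty]
    intro hs
    exact hne (Finset.eq_of_subset_of_card_le hs h.le).symm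
  obtain ⟨b, hb, hbm⟩ := Finset.exists_min_image (B \ A) val hn
  have hn' : (A \ B).Nonempty := by
    rw [← Finset.card_pos, hc]; exact hn.card_pos
  have h1 : ∑ s ∈ A \ B, val s < ∑ s ∈ A \ B, val b :=
    Finset.sum_lt_sum_of_nonempty hn' (fun a ha => key a ha b hb)
  have h2 : ∑ s ∈ B \ A, val b ≤ ∑ s ∈ B \ A, val s :=
    Finset.sum_le_sum fun s hs => hbm s hs
  simp only [Finset.sum_const, hc] at h1 h2
  have h3 : ∑ s ∈ A ∩ B, val s + ∑ s ∈ A \ B, val s = ∑ s ∈ A, val s := by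
    rw [← Finset.sum_union (Finset.disjoint_sdiff_inter A B).symm, Finset.union_comm,
      Finset.sdiff_union_inter]
  have h4 : ∑ s ∈ A ∩ B, val s + ∑ s ∈ B \ A, val s = ∑ s ∈ B, val s := by
    rw [Finset.inter_comm, ← Finset.sum_union (Finset.disjoint_sdiff_inter B A).symm,
      Finset.union_comm, Finset.sdiff_union_inter]
  omega

lemma IsInit.sum_le {P} {A B : Finset (Finset ℕ)} (hA : IsInit P A) (hB : ∀ s ∈ B, P s)
    (h : A.card = B.card) : ∑ s ∈ A, val s ≤ ∑ s ∈ B, val s := by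
  by_cases hne : A = B
  · rw [hne]
  · exact (hA.sum_lt hB h hne).le

def Good (r k m : ℕ) : Prop := ∃ B : Finset (Finset ℕ), (∀ s ∈ B, X r k s) ∧ B.card = m

lemma X_Ico {r k N : ℕ} (h : k ≤ r) : X r k (Finset.Ico N (N + k)) := by
  refine ⟨by simp, ?_⟩
  intro x hx y hy hxy
  simp only [Finset.mem_Ico] at hx hy
  rcases le_total x y with hle | hle
  · have h1 : r ∣ y - x := (Nat.modEq_iff_dvd' hle).1 hxy
    have := Nat.eq_zero_of_dvd_of_lt h1 (by omega)
    omega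
  · have h1 : r ∣ x - y := (Nat.modEq_iff_dvd' hle).1 hxy.symm
    have := Nat.eq_zero_of_dvd_of_lt h1 (by omega)
    omega

lemma X_le {r k : ℕ} {s : Finset ℕ} (hr : 1 ≤ r) (h : X r k s) : k ≤ r := by
  rw [← h.1]
  have : (s.image (· % r)).card = s.card :=
    Finset.card_image_of_injOn (fun x hx y hy hxy => h.2 x hx y hy hxy)
  rw [← this]
  calc _ ≤ (range r).card := Finset.card_le_card (by
        intro x hx
        obtain ⟨y, _, rfl⟩ := Finset.mem_image.1 hx
        exact Finset.mem_range.2 (Nat.mod_lt _ hr))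
    _ = r := by simp

lemma exists_notMem {r k : ℕ} (hk : 1 ≤ k) (h : k ≤ r) (A : Finset (Finset ℕ)) :
    ∃ s, X r k s ∧ s ∉ A := by
  let N := A.sup (fun s => s.sup id)
  refine ⟨Finset.Ico (N+1) (N+1+k), X_Ico h, fun hm => ?_⟩
  have h1 : (Finset.Ico (N+1) (N+1+k)).sup id ≤ N :=
    Finset.le_sup (f := fun s : Finset ℕ => s.sup id) hm
  have h2 : N + 1 ≤ (Finset.Ico (N+1) (N+1+k)).sup id :=
    Finset.le_sup (f := id) (Finset.mem_Ico.2 ⟨le_rfl, by omega⟩)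
  omega

lemma exists_init_of_good {r k m : ℕ} (h : Good r k m) : ∃ A, IsInit (X r k) A ∧ A.card = m := by
  obtain ⟨B, hB, rfl⟩ := h
  suffices ∀ m ≤ B.card, ∃ A, IsInit (X r k) A ∧ A.card = m from this _ le_rfl
  intro m
  induction m with
  | zero => intro _; exact ⟨∅, ⟨by simp, by simp⟩, rfl⟩
  | succ m ih =>
    intro hm
    obtain ⟨A, hA, hAc⟩ := ih (by omega)
    have hex : ∃ n, ∃ s, X r k s ∧ s ∉ A ∧ val s = n := by
      have : ¬ B ⊆ A := fun hs => by have := Finset.card_le_card hs; omega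
      obtain ⟨s, hs, hs'⟩ := Finset.not_subset.1 this
      exact ⟨_, s, hB s hs, hs', rfl⟩
    classical
    obtain ⟨s, hs, hsA, hv⟩ := Nat.find_spec hex
    have hmin : ∀ t, X r k t → val t < val s → t ∈ A := by
      intro t ht hlt
      by_contra hc
      rw [hv] at hlt
      exact Nat.find_min hex hlt ⟨t, ht, hc, rfl⟩
    refine ⟨insert s A, ⟨?_, ?_⟩, by rw [Finset.card_insert_of_notMem hsA, hAc]⟩
    · intro t ht
      rcases Finset.mem_insert.1 ht with rfl | ht
      · exact hs
      · exact hA.1 t ht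
    · intro t ht u hu huv
      rcases Finset.mem_insert.1 ht with rfl | ht
      · exact Finset.mem_insert_of_mem (hmin u hu huv)
      · exact Finset.mem_insert_of_mem (hA.2 t ht u hu huv)

lemma good_of_le {r k m m' : ℕ} (h : Good r k m) (hm : m' ≤ m) : Good r k m' := by
  obtain ⟨B, hB, rfl⟩ := h
  obtain ⟨C, hC, hc⟩ := Finset.exists_subset_card_eq hm
  exact ⟨C, fun s hs => hB s (hC hs), hc⟩

lemma good_zero {r k : ℕ} : Good r k 0 := ⟨∅, by simp, rfl⟩

lemma good_of {r k : ℕ} (hk : 1 ≤ k) (h : k ≤ r) (m : ℕ) : Good r k m := by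
  induction m with
  | zero => exact good_zero
  | succ m ih =>
    obtain ⟨B, hB, rfl⟩ := ih
    obtain ⟨s, hs, hs'⟩ := exists_notMem hk h B
    refine ⟨insert s B, ?_, Finset.card_insert_of_notMem hs'⟩
    intro t ht
    rcases Finset.mem_insert.1 ht with rfl | ht
    · exact hs
    · exact hB t ht

open Classical in
/-- the initial segment of size `m` -/
noncomputable def I (r k m : ℕ) : Finset (Finset ℕ) :=
  if h : ∃ A, IsInit (X r k) A ∧ A.card = m then h.choose else ∅

lemma I_init {r k m : ℕ} : IsInit (X r k) (I r k m) := by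
  unfold I
  split_ifs with h
  · exact h.choose_spec.1
  · exact ⟨by simp, by simp⟩

lemma I_card {r k m : ℕ} (h : Good r k m) : (I r k m).card = m := by
  have := exists_init_of_good h
  unfold I
  rw [dif_pos this]
  exact this.choose_spec.2

lemma I_eq {r k : ℕ} {A : Finset (Finset ℕ)} (h : IsInit (X r k) A) : I r k A.card = A :=
  I_init.eq h (I_card ⟨A, h.1, rfl⟩)

noncomputable def d (r k m : ℕ) : ℕ := (∂ (I r k m)).card

lemma d_zero {r k : ℕ} : d r k 0 = 0 := by
  have : I r k 0 = ∅ := by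
    have := I_card (r := r) (k := k) good_zero
    exact Finset.card_eq_zero.1 this
  simp [d, this]

lemma d_mono {r k m m' : ℕ} (h : Good r k m') (hm : m ≤ m') : d r k m ≤ d r k m' := by
  apply Finset.card_le_card
  apply Finset.shadow_mono
  apply I_init.subset I_init
  rw [I_card h, I_card (good_of_le h hm)]; exact hm

lemma X_erase {r k : ℕ} {s : Finset ℕ} {a : ℕ} (h : X r (k+1) s) (ha : a ∈ s) :
    X r k (s.erase a) := by
  refine ⟨by rw [Finset.card_erase_of_mem ha, h.1]; rfl, ?_⟩
  intro x hx y hy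
  exact h.2 x (Finset.mem_of_mem_erase hx) y (Finset.mem_of_mem_erase hy)

lemma X_insert {r k : ℕ} {s : Finset ℕ} {a : ℕ} (h : X r k s) (ha : ∀ x ∈ s, x % r ≠ a % r) :
    X r (k+1) (insert a s) := by
  have has : a ∉ s := fun hm => ha a hm rfl
  refine ⟨by rw [Finset.card_insert_of_notMem has, h.1], ?_⟩
  intro x hx y hy hxy
  rcases Finset.mem_insert.1 hx with rfl | hx' <;> rcases Finset.mem_insert.1 hy with rfl | hy'
  · rfl
  · exact absurd hxy.symm (ha y hy')
  · exact absurd hxy (ha x hx')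
  · exact h.2 x hx' y hy' hxy

lemma X_shadow {r k : ℕ} {A : Finset (Finset ℕ)} (h : ∀ s ∈ A, X r (k+1) s) :
    ∀ s ∈ ∂ A, X r k s := by
  intro s hs
  obtain ⟨t, ht, a, ha, rfl⟩ := Finset.mem_shadow_iff.1 hs
  exact X_erase (h t ht) ha

lemma Y_shadow {r c k : ℕ} {A : Finset (Finset ℕ)} (h : ∀ s ∈ A, Y r c (k+1) s) :
    ∀ s ∈ ∂ A, Y r c k s := by
  intro s hs
  obtain ⟨t, ht, a, ha, rfl⟩ := Finset.mem_shadow_iff.1 hs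
  exact ⟨X_erase (h t ht).1 ha, fun x hx => (h t ht).2 x (Finset.mem_of_mem_erase hx)⟩

/-- a free color gives a small extension -/
lemma exists_ext {r k : ℕ} {Q : Finset ℕ} (h : X r k Q) (hk : k < r) :
    ∃ y, y < r ∧ (∀ x ∈ Q, x % r ≠ y % r) ∧ ∀ z < y, ∃ x ∈ Q, x % r = z % r := by
  classical
  have hex : ∃ y, y < r ∧ (∀ x ∈ Q, x % r ≠ y % r) := by
    by_contra! hc
    have hsub : range r ⊆ Q.image (· % r) := by
      intro y hy
      obtain ⟨x, hx, hxy⟩ := hc y (Finset.mem_range.1 hy)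
      rw [Nat.mod_eq_of_lt (Finset.mem_range.1 hy)] at hxy
      exact Finset.mem_image.2 ⟨x, hx, hxy⟩
    have h1 := Finset.card_le_card hsub
    have h2 : (Q.image (· % r)).card ≤ Q.card := Finset.card_image_le
    rw [h.1] at h2
    simp at h1
    omega
  refine ⟨Nat.find hex, (Nat.find_spec hex).1, (Nat.find_spec hex).2, ?_⟩
  intro z hz
  have := Nat.find_min hex hz
  push Not at this
  exact this (lt_trans hz (Nat.find_spec hex).1)

/-- the shadow of an initial segment is an initial segment -/
lemma IsInit.shadow {r k : ℕ} (hk : k + 1 ≤ r) {A : Finset (Finset ℕ)}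
    (hA : IsInit (X r (k+1)) A) : IsInit (X r k) (∂ A) := by
  refine ⟨X_shadow hA.1, ?_⟩
  intro P hP Q hQ hlt
  obtain ⟨a, haP, haA⟩ := Finset.mem_shadow_iff_insert_mem.1 hP
  have hXA := hA.1 _ haA
  have hXP : X r k P := X_shadow hA.1 P hP
  obtain ⟨y, hyr, hyc, hym⟩ := exists_ext hQ hk
  have hyQ : y ∉ Q := fun h => hyc y h rfl
  have hXy := X_insert hQ hyc
  suffices val (insert y Q) ≤ val (insert a P) by
    refine Finset.mem_shadow_iff_insert_mem.2 ⟨y, hyQ, ?_⟩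
    rcases this.lt_or_eq with h | h
    · exact hA.2 _ haA _ hXy h
    · rw [val_inj h]; exact haA
  rw [val_lt_iff, Finset.Colex.lt_iff_exists_filter_lt] at hlt
  obtain ⟨x, hx, hxf⟩ := hlt
  obtain ⟨hxP, hxQ⟩ := Finset.mem_sdiff.1 hx
  have hab : ∀ z, x < z → (z ∈ Q ↔ z ∈ P) := by
    intro z hz
    have : z ∈ Q.filter (x < ·) ↔ z ∈ P.filter (x < ·) := by
      simpa using congrArg (z ∈ ·) hxf
    simpa [hz] using this
  have hax : a ≠ x := fun h => haP (h ▸ hxP)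
  -- y ≤ x
  have hyx : y ≤ x := by
    by_contra hc
    push Not at hc
    obtain ⟨q, hq, hqx⟩ := hym x hc
    rcases lt_trichotomy q x with h | h | h
    · rw [Nat.mod_eq_of_lt (by omega), Nat.mod_eq_of_lt (by omega)] at hqx
      omega
    · exact hxQ (h ▸ hq)
    · have := hXP.2 q ((hab q h).1 hq) x hxP hqx
      omega
  rcases lt_or_gt_of_ne hax with hlt | hgt
  · rcases hyx.lt_or_eq with hy | rfl
    · apply le_of_lt
      rw [val_lt_iff, Finset.Colex.lt_iff_exists_filter_lt]
      refine ⟨x, Finset.mem_sdiff.2 ⟨Finset.mem_insert_of_mem hxP, ?_⟩, ?_⟩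
      · simp only [Finset.mem_insert, not_or]; exact ⟨by omega, hxQ⟩
      · ext z
        simp only [Finset.mem_filter, Finset.mem_insert]
        constructor
        · rintro ⟨rfl | h, hz⟩
          · omega
          · exact ⟨Or.inr ((hab z hz).1 h), hz⟩
        · rintro ⟨rfl | h, hz⟩
          · omega
          · exact ⟨Or.inr ((hab z hz).2 h), hz⟩
    · -- equality case
      have hsub : insert a P ⊆ insert y Q := by
        intro z hz
        rcases lt_trichotomy z y with h | h | h
        · obtain ⟨q, hq, hqz⟩ := hym z h
          rcases lt_trichotomy q y with h' | h' | h'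
          · rw [Nat.mod_eq_of_lt (by omega), Nat.mod_eq_of_lt (by omega)] at hqz
            rw [← hqz]; exact Finset.mem_insert_of_mem hq
          · exact absurd (h' ▸ hq) hxQ
          · have := hXA.2 q (Finset.mem_insert_of_mem ((hab q h').1 hq)) z hz hqz
            omega
        · rw [h]; exact Finset.mem_insert_self _ _
        · rcases Finset.mem_insert.1 hz with rfl | hz
          · omega
          · exact Finset.mem_insert_of_mem ((hab z h).2 hz)
      rw [Finset.eq_of_subset_of_card_le hsub (by rw [hXA.1, hXy.1])]
  · apply le_of_lt
    rw [val_lt_iff, Finset.Colex.lt_iff_exists_filter_lt]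
    refine ⟨a, Finset.mem_sdiff.2 ⟨Finset.mem_insert_self _ _, ?_⟩, ?_⟩
    · simp only [Finset.mem_insert, not_or]
      exact ⟨by omega, fun h => haP ((hab a hgt).1 h)⟩
    · ext z
      simp only [Finset.mem_filter, Finset.mem_insert]
      constructor
      · rintro ⟨rfl | h, hz⟩
        · omega
        · exact ⟨Or.inr ((hab z (by omega)).1 h), hz⟩
      · rintro ⟨rfl | h, hz⟩
        · omega
        · exact ⟨Or.inr ((hab z (by omega)).2 h), hz⟩

lemma shadow_I {r k m : ℕ} (hk : k + 1 ≤ r) : ∂ (I r (k+1) m) = I r k (d r (k+1) m) :=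
  (I_eq ((I_init (r := r) (k := k+1) (m := m)).shadow hk)).symm

end Froh

namespace Froh
open Finset
open scoped FinsetFamily

def phi (R c i : ℕ) : ℕ := (R+1) * (i / R) + (if i % R < c then i % R else i % R + 1)

lemma phi_aux {R c i : ℕ} (hR : 1 ≤ R) : (if i % R < c then i % R else i % R + 1) < R + 1 := by
  have := Nat.mod_lt i hR
  split_ifs <;> omega

lemma phi_div {R c i : ℕ} (hR : 1 ≤ R) : phi R c i / (R+1) = i / R := by
  unfold phi
  rw [Nat.mul_add_div (by omega), Nat.div_eq_of_lt (phi_aux hR)]; rfl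

lemma phi_mod {R c i : ℕ} (hR : 1 ≤ R) :
    phi R c i % (R+1) = if i % R < c then i % R else i % R + 1 := by
  unfold phi
  rw [Nat.mul_add_mod, Nat.mod_eq_of_lt (phi_aux hR)]

lemma phi_mod_ne {R c i : ℕ} (hR : 1 ≤ R) : phi R c i % (R+1) ≠ c := by
  rw [phi_mod hR]; split_ifs <;> omega

lemma phi_mod_eq {R c i j : ℕ} (hR : 1 ≤ R) :
    phi R c i % (R+1) = phi R c j % (R+1) ↔ i % R = j % R := by
  rw [phi_mod hR, phi_mod hR]; split_ifs <;> omega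

lemma phi_strictMono {R c : ℕ} (hR : 1 ≤ R) : StrictMono (phi R c) := by
  intro i j hij
  have hd : i / R ≤ j / R := Nat.div_le_div_right hij.le
  rcases hd.lt_or_eq with h | h
  · apply lt_of_not_ge
    intro hc
    have := Nat.div_le_div_right (c := R+1) hc
    rw [phi_div hR, phi_div hR] at this
    omega
  · have h1 := Nat.div_add_mod i R
    have h2 := Nat.div_add_mod j R
    rw [h] at h1
    have : i % R < j % R := by omega
    unfold phi
    rw [h]
    split_ifs <;> omega

lemma phi_surj {R c v : ℕ} (hR : 1 ≤ R) (hc : c ≤ R) (hv : v % (R+1) ≠ c) :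
    ∃ i, phi R c i = v := by
  have hlt := Nat.mod_lt v (show 0 < R + 1 by omega)
  have hv' := Nat.div_add_mod v (R+1)
  rcases lt_or_gt_of_ne hv with h | h
  · refine ⟨R * (v / (R+1)) + v % (R+1), ?_⟩
    have h1 : (R * (v / (R+1)) + v % (R+1)) / R = v / (R+1) := by
      rw [Nat.mul_add_div (by omega), Nat.div_eq_of_lt (a := v % (R+1)) (by omega)]; rfl
    have h2 : (R * (v / (R+1)) + v % (R+1)) % R = v % (R+1) := by
      rw [Nat.mul_add_mod, Nat.mod_eq_of_lt (by omega)]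
    unfold phi
    rw [h1, h2, if_pos h]; exact hv'
  · refine ⟨R * (v / (R+1)) + (v % (R+1) - 1), ?_⟩
    have h1 : (R * (v / (R+1)) + (v % (R+1) - 1)) / R = v / (R+1) := by
      rw [Nat.mul_add_div (by omega), Nat.div_eq_of_lt (a := v % (R+1) - 1) (by omega)]; rfl
    have h2 : (R * (v / (R+1)) + (v % (R+1) - 1)) % R = v % (R+1) - 1 := by
      rw [Nat.mul_add_mod, Nat.mod_eq_of_lt (by omega)]
    unfold phi
    rw [h1, h2, if_neg (by omega)]; omega

lemma sub_div_eq (n R : ℕ) : n - n / (R+1) = R * (n / (R+1)) + n % (R+1) := by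
  have := Nat.div_add_mod n (R+1)
  have h : (R+1) * (n / (R+1)) = R * (n / (R+1)) + n / (R+1) := by ring
  omega

lemma phi_lt {R c i n : ℕ} (hR : 1 ≤ R) (h : phi R c i < n) : i < n - n / (R+1) := by
  rw [sub_div_eq]
  have hd : i / R ≤ n / (R+1) := by
    rw [← phi_div (c := c) hR]; exact Nat.div_le_div_right h.le
  have h1 := Nat.div_add_mod i R
  have h2 := Nat.div_add_mod n (R+1)
  have h3 := Nat.mod_lt i hR
  rcases hd.lt_or_eq with hd | hd
  · have : R * (i / R + 1) ≤ R * (n / (R+1)) := Nat.mul_le_mul_left _ hd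
    rw [Nat.mul_add] at this
    omega
  · unfold phi at h
    rw [hd] at h h1
    split_ifs at h <;> omega

lemma phi_lt' {R i n : ℕ} (hR : 1 ≤ R) (h : i < n - n / (R+1)) : phi R (n % (R+1)) i < n := by
  rw [sub_div_eq] at h
  have h1 := Nat.div_add_mod i R
  have h2 := Nat.div_add_mod n (R+1)
  have h3 := Nat.mod_lt i hR
  have h4 := Nat.mod_lt n (show 0 < R + 1 by omega)
  have hd : i / R ≤ n / (R+1) := by
    by_contra hc
    have : R * (n / (R+1) + 1) ≤ R * (i / R) := Nat.mul_le_mul_left _ (by omega)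
    rw [Nat.mul_add] at this
    omega
  rcases hd.lt_or_eq with hd | hd
  · have : (R+1) * (i / R + 1) ≤ (R+1) * (n / (R+1)) := Nat.mul_le_mul_left _ hd
    rw [Nat.mul_add] at this
    have := phi_aux (c := n % (R+1)) (i := i) hR
    unfold phi
    omega
  · unfold phi
    rw [hd] at h1 ⊢
    rw [if_pos (by omega)]
    omega

lemma Y_image {R c k : ℕ} (hR : 1 ≤ R) {s : Finset ℕ} (h : X R k s) :
    Y (R+1) c k (s.image (phi R c)) := by
  have hinj := (phi_strictMono (c := c) hR).injective
  refine ⟨⟨by rw [Finset.card_image_of_injective _ hinj, h.1], ?_⟩, ?_⟩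
  · intro x hx y hy hxy
    obtain ⟨i, hi, rfl⟩ := Finset.mem_image.1 hx
    obtain ⟨j, hj, rfl⟩ := Finset.mem_image.1 hy
    rw [phi_mod_eq hR] at hxy
    rw [h.2 i hi j hj hxy]
  · intro x hx
    obtain ⟨i, hi, rfl⟩ := Finset.mem_image.1 hx
    exact phi_mod_ne hR

lemma Y_preimage {R c k : ℕ} (hR : 1 ≤ R) (hc : c ≤ R) {s : Finset ℕ} (h : Y (R+1) c k s) :
    ∃ t, X R k t ∧ t.image (phi R c) = s := by
  have hinj := (phi_strictMono (c := c) hR).injective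
  refine ⟨s.preimage (phi R c) hinj.injOn, ?_, ?_⟩
  · have himg : (s.preimage (phi R c) hinj.injOn).image (phi R c) = s := by
      ext x
      simp only [Finset.mem_image, Finset.mem_preimage]
      constructor
      · rintro ⟨a, ha, rfl⟩; exact ha
      · intro hx
        obtain ⟨i, rfl⟩ := phi_surj hR hc (h.2 x hx)
        exact ⟨i, hx, rfl⟩
    refine ⟨?_, ?_⟩
    · rw [← Finset.card_image_of_injective _ hinj, himg, h.1.1]
    · intro x hx y hy hxy
      rw [Finset.mem_preimage] at hx hy
      exact hinj (h.1.2 _ hx _ hy ((phi_mod_eq hR).2 hxy))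
  · ext x
    simp only [Finset.mem_image, Finset.mem_preimage]
    constructor
    · rintro ⟨a, ha, rfl⟩; exact ha
    · intro hx
      obtain ⟨i, rfl⟩ := phi_surj hR hc (h.2 x hx)
      exact ⟨i, hx, rfl⟩

/-- image of a family under a map of vertices -/
def im (f : ℕ → ℕ) (A : Finset (Finset ℕ)) : Finset (Finset ℕ) := A.image (fun s => s.image f)

lemma im_card {f : ℕ → ℕ} (hf : Function.Injective f) (A : Finset (Finset ℕ)) :
    (im f A).card = A.card :=
  Finset.card_image_of_injective _ (Finset.image_injective hf)

lemma shadow_im {f : ℕ → ℕ} (hf : Function.Injective f) (A : Finset (Finset ℕ)) :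
    ∂ (im f A) = im f (∂ A) := by
  ext t
  simp only [im, Finset.mem_shadow_iff, Finset.mem_image]
  constructor
  · rintro ⟨_, ⟨s, hs, rfl⟩, a, ha, rfl⟩
    obtain ⟨b, hb, rfl⟩ := Finset.mem_image.1 ha
    exact ⟨s.erase b, ⟨s, hs, b, hb, rfl⟩, Finset.image_erase hf s b⟩
  · rintro ⟨_, ⟨s, hs, b, hb, rfl⟩, rfl⟩
    exact ⟨s.image f, ⟨s, hs, rfl⟩, f b, Finset.mem_image_of_mem _ hb,
      (Finset.image_erase hf s b).symm⟩

lemma im_exists {R c k : ℕ} (hR : 1 ≤ R) (hc : c ≤ R) {A : Finset (Finset ℕ)}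
    (h : ∀ s ∈ A, Y (R+1) c k s) : ∃ B, (∀ s ∈ B, X R k s) ∧ im (phi R c) B = A := by
  have hinj := (phi_strictMono (c := c) hR).injective
  refine ⟨A.preimage (fun s => s.image (phi R c)) (Finset.image_injective hinj).injOn, ?_, ?_⟩
  · intro s hs
    rw [Finset.mem_preimage] at hs
    obtain ⟨t, ht, hts⟩ := Y_preimage hR hc (h _ hs)
    rwa [← Finset.image_injective hinj hts]
  · ext s
    simp only [im, Finset.mem_image, Finset.mem_preimage]
    constructor
    · rintro ⟨a, ha, rfl⟩; exact ha
    · intro hs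
      obtain ⟨t, ht, rfl⟩ := Y_preimage hR hc (h _ hs)
      exact ⟨t, hs, rfl⟩

lemma good_Y {R c k : ℕ} (hR : 1 ≤ R) (hc : c ≤ R) {A : Finset (Finset ℕ)}
    (h : ∀ s ∈ A, Y (R+1) c k s) : Good R k A.card := by
  obtain ⟨B, hB, rfl⟩ := im_exists hR hc h
  exact ⟨B, hB, (im_card (phi_strictMono hR).injective B).symm⟩

def KK (r : ℕ) : Prop := ∀ (k : ℕ) (A : Finset (Finset ℕ)), (∀ s ∈ A, X r k s) →
  d r k A.card ≤ (∂ A).card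

lemma KK.Y {R : ℕ} (hK : KK R) {c k : ℕ} (hR : 1 ≤ R) (hc : c ≤ R) {A : Finset (Finset ℕ)}
    (h : ∀ s ∈ A, Y (R+1) c k s) : d R k A.card ≤ (∂ A).card := by
  have hinj := (phi_strictMono (c := c) hR).injective
  obtain ⟨B, hB, rfl⟩ := im_exists hR hc h
  rw [shadow_im hinj, im_card hinj, im_card hinj]
  exact hK k B hB

noncomputable def J (R c k m : ℕ) : Finset (Finset ℕ) := im (phi R c) (I R k m)

lemma im_init {R c k : ℕ} (hR : 1 ≤ R) (hc : c ≤ R) {A : Finset (Finset ℕ)}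
    (h : IsInit (X R k) A) : IsInit (Froh.Y (R+1) c k) (im (phi R c) A) := by
  constructor
  · intro s hs
    obtain ⟨t, ht, rfl⟩ := Finset.mem_image.1 hs
    exact Y_image hR (h.1 t ht)
  · intro s hs t ht hlt
    obtain ⟨s', hs', rfl⟩ := Finset.mem_image.1 hs
    obtain ⟨t', ht', rfl⟩ := Y_preimage hR hc ht
    rw [val_image_lt (phi_strictMono hR)] at hlt
    exact Finset.mem_image_of_mem _ (h.2 s' hs' t' ht' hlt)

lemma J_init {R c k m : ℕ} (hR : 1 ≤ R) (hc : c ≤ R) : IsInit (Y (R+1) c k) (J R c k m) :=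
  im_init hR hc I_init

lemma J_card {R c k m : ℕ} (hR : 1 ≤ R) (h : Good R k m) : (J R c k m).card = m := by
  rw [J, im_card (phi_strictMono hR).injective, I_card h]

lemma J_shadow_card {R c k m : ℕ} (hR : 1 ≤ R) : (∂ (J R c k m)).card = d R k m := by
  have hinj := (phi_strictMono (c := c) hR).injective
  rw [J, shadow_im hinj, im_card hinj]; rfl

lemma J_shadow_init {R c k m : ℕ} (hR : 1 ≤ R) (hc : c ≤ R) :
    IsInit (Y (R+1) c k) (∂ (J R c (k+1) m)) := by
  have hinj := (phi_strictMono (c := c) hR).injective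
  rw [J, shadow_im hinj]
  apply im_init hR hc
  by_cases hk : k + 1 ≤ R
  · exact I_init.shadow hk
  · have : I R (k+1) m = ∅ := by
      by_contra hne
      obtain ⟨s, hs⟩ := Finset.nonempty_iff_ne_empty.2 hne
      exact hk (X_le hR (I_init.1 s hs))
    rw [this]
    exact ⟨by simp, by simp⟩

/-! ### cones -/

def cone (S : Finset ℕ) (J0 : Finset (Finset ℕ)) (F : ℕ → Finset (Finset ℕ)) :
    Finset (Finset ℕ) := J0 ∪ S.biUnion (fun v => (F v).image (insert v))

structure ConeData (r c k : ℕ) (S : Finset ℕ) (J0 : Finset (Finset ℕ))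
    (F : ℕ → Finset (Finset ℕ)) : Prop where
  hS : ∀ v ∈ S, v % r = c
  h0 : ∀ s ∈ J0, Y r c (k+1) s
  hF : ∀ v ∈ S, ∀ s ∈ F v, Y r c k s

variable {r c k : ℕ} {S : Finset ℕ} {J0 : Finset (Finset ℕ)} {F : ℕ → Finset (Finset ℕ)}

lemma ConeData.notMem (h : ConeData r c k S J0 F) {v} (hv : v ∈ S) {s} (hs : s ∈ F v) {w}
    (hw : w ∈ S) : w ∉ s := fun hm => (h.hF v hv s hs).2 w hm (h.hS w hw)

lemma ConeData.X (h : ConeData r c k S J0 F) : ∀ s ∈ cone S J0 F, X r (k+1) s := by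
  intro s hs
  rcases Finset.mem_union.1 hs with hs | hs
  · exact (h.h0 s hs).1
  · obtain ⟨v, hv, hs⟩ := Finset.mem_biUnion.1 hs
    obtain ⟨t, ht, rfl⟩ := Finset.mem_image.1 hs
    refine X_insert (h.hF v hv t ht).1 ?_
    rw [h.hS v hv]
    exact (h.hF v hv t ht).2

lemma ConeData.injOn (h : ConeData r c k S J0 F) {v} (hv : v ∈ S) :
    Set.InjOn (insert v : Finset ℕ → Finset ℕ) (F v) := by
  intro s hs t ht hst
  have h1 := h.notMem hv hs hv
  have h2 := h.notMem hv ht hv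
  rw [← Finset.erase_insert h1, ← Finset.erase_insert h2, hst]

lemma ConeData.sum (h : ConeData r c k S J0 F) (g : Finset ℕ → ℕ) :
    ∑ s ∈ cone S J0 F, g s = ∑ s ∈ J0, g s + ∑ v ∈ S, ∑ s ∈ F v, g (insert v s) := by
  have hd : Disjoint J0 (S.biUnion (fun v => (F v).image (insert v))) := by
    rw [Finset.disjoint_left]
    intro s hs hs'
    obtain ⟨v, hv, hs'⟩ := Finset.mem_biUnion.1 hs'
    obtain ⟨t, ht, rfl⟩ := Finset.mem_image.1 hs'
    exact (h.h0 _ hs).2 v (Finset.mem_insert_self _ _) (h.hS v hv)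
  rw [cone, Finset.sum_union hd, Finset.sum_biUnion]
  · congr 1
    apply Finset.sum_congr rfl
    intro v hv
    rw [Finset.sum_image (h.injOn hv)]
  · intro v hv w hw hne
    rw [Function.onFun, Finset.disjoint_left]
    intro s hs hs'
    obtain ⟨t, ht, rfl⟩ := Finset.mem_image.1 hs
    obtain ⟨u, hu, heq⟩ := Finset.mem_image.1 hs'
    have : v ∈ insert w u := heq ▸ Finset.mem_insert_self _ _
    rcases Finset.mem_insert.1 this with h1 | h1
    · exact hne h1
    · exact h.notMem hw hu hv h1

lemma ConeData.card (h : ConeData r c k S J0 F) :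
    (cone S J0 F).card = J0.card + ∑ v ∈ S, (F v).card := by
  have := h.sum (fun _ => 1)
  simpa using this

lemma ConeData.sum_val (h : ConeData r c k S J0 F) :
    ∑ s ∈ cone S J0 F, val s =
      ∑ s ∈ J0, val s + ∑ v ∈ S, ((F v).card * 2 ^ v + ∑ s ∈ F v, val s) := by
  rw [h.sum]
  congr 1
  apply Finset.sum_congr rfl
  intro v hv
  rw [Finset.sum_congr rfl (fun s hs => val_insert (h.notMem hv hs hv)), Finset.sum_add_distrib]
  simp

lemma ConeData.shadow_le (h : ConeData r c k S J0 F) {K : Finset (Finset ℕ)}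
    (hK0 : ∂ J0 ⊆ K) (hKF : ∀ v ∈ S, F v ⊆ K) :
    (∂ (cone S J0 F)).card ≤ K.card + ∑ v ∈ S, (∂ (F v)).card := by
  have hsub : ∂ (cone S J0 F) ⊆ K ∪ S.biUnion (fun v => (∂ (F v)).image (insert v)) := by
    intro t ht
    obtain ⟨s, hs, a, ha, rfl⟩ := Finset.mem_shadow_iff.1 ht
    rcases Finset.mem_union.1 hs with hs | hs
    · exact Finset.mem_union_left _ (hK0 (Finset.erase_mem_shadow hs ha))
    · obtain ⟨v, hv, hs⟩ := Finset.mem_biUnion.1 hs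
      obtain ⟨u, hu, rfl⟩ := Finset.mem_image.1 hs
      have hvu := h.notMem hv hu hv
      rcases Finset.mem_insert.1 ha with rfl | ha
      · rw [Finset.erase_insert hvu]
        exact Finset.mem_union_left _ (hKF _ hv hu)
      · have : a ≠ v := fun e => hvu (e ▸ ha)
        rw [Finset.erase_insert_of_ne this.symm]
        refine Finset.mem_union_right _ (Finset.mem_biUnion.2 ⟨v, hv, ?_⟩)
        exact Finset.mem_image_of_mem _ (Finset.erase_mem_shadow hu ha)
  calc _ ≤ _ := Finset.card_le_card hsub
    _ ≤ _ := Finset.card_union_le _ _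
    _ ≤ _ := by
      gcongr
      refine Finset.card_biUnion_le.trans ?_
      exact Finset.sum_le_sum fun v _ => Finset.card_image_le

/-- link of a vertex -/
def lk (A : Finset (Finset ℕ)) (v : ℕ) : Finset (Finset ℕ) :=
  (A.filter (v ∈ ·)).image (fun s => s.erase v)

lemma mem_lk {A : Finset (Finset ℕ)} {v : ℕ} {t : Finset ℕ} :
    t ∈ lk A v ↔ v ∉ t ∧ insert v t ∈ A := by
  simp only [lk, Finset.mem_image, Finset.mem_filter]
  constructor
  · rintro ⟨s, ⟨hs, hv⟩, rfl⟩
    exact ⟨by simp, by rwa [Finset.insert_erase hv]⟩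
  · rintro ⟨hv, ht⟩
    exact ⟨_, ⟨ht, by simp⟩, Finset.erase_insert hv⟩

lemma lk_Y {A : Finset (Finset ℕ)} (hA : ∀ s ∈ A, X r (k+1) s) (v : ℕ) :
    ∀ s ∈ lk A v, Y r (v % r) k s := by
  intro s hs
  obtain ⟨hv, hm⟩ := mem_lk.1 hs
  have := X_erase (hA _ hm) (Finset.mem_insert_self v s)
  rw [Finset.erase_insert hv] at this
  refine ⟨this, ?_⟩
  intro x hx hxv
  have := (hA _ hm).2 x (Finset.mem_insert_of_mem hx) v (Finset.mem_insert_self _ _) hxv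
  exact hv (this ▸ hx)

def supp (r c : ℕ) (A : Finset (Finset ℕ)) : Finset ℕ := (A.biUnion id).filter (· % r = c)

def miss (r c : ℕ) (A : Finset (Finset ℕ)) : Finset (Finset ℕ) :=
  A.filter (fun s => ∀ x ∈ s, x % r ≠ c)

lemma coneData_of {A : Finset (Finset ℕ)} (hA : ∀ s ∈ A, X r (k+1) s) (c : ℕ) :
    ConeData r c k (supp r c A) (miss r c A) (lk A) := by
  refine ⟨?_, ?_, ?_⟩
  · intro v hv; exact (Finset.mem_filter.1 hv).2
  · intro s hs
    obtain ⟨h1, h2⟩ := Finset.mem_filter.1 hs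
    exact ⟨hA s h1, h2⟩
  · intro v hv s hs
    have := lk_Y hA v s hs
    rwa [(Finset.mem_filter.1 hv).2] at this

lemma cone_eq (r c : ℕ) (A : Finset (Finset ℕ)) : cone (supp r c A) (miss r c A) (lk A) = A := by
  ext s
  simp only [cone, Finset.mem_union, Finset.mem_biUnion, Finset.mem_image]
  constructor
  · rintro (h | ⟨v, hv, t, ht, rfl⟩)
    · exact (Finset.mem_filter.1 h).1
    · exact (mem_lk.1 ht).2
  · intro hs
    by_cases h : ∀ x ∈ s, x % r ≠ c
    · exact Or.inl (Finset.mem_filter.2 ⟨hs, h⟩)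
    · push Not at h
      obtain ⟨v, hv, hvc⟩ := h
      refine Or.inr ⟨v, Finset.mem_filter.2 ⟨Finset.mem_biUnion.2 ⟨s, hs, hv⟩, hvc⟩, s.erase v, ?_, ?_⟩
      · rw [mem_lk]
        exact ⟨by simp, by rwa [Finset.insert_erase hv]⟩
      · exact Finset.insert_erase hv

lemma shadow_ge {A : Finset (Finset ℕ)} (hA : ∀ s ∈ A, X r (k+2) s) (c : ℕ) :
    (miss r c (∂ A)).card + ∑ v ∈ supp r c A, (∂ (lk A v)).card ≤ (∂ A).card := by
  have hc := coneData_of hA c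
  have h2 : ConeData r c k (supp r c A) (miss r c (∂ A)) (fun v => ∂ (lk A v)) := by
    refine ⟨hc.hS, ?_, ?_⟩
    · intro s hs
      obtain ⟨h1, h2⟩ := Finset.mem_filter.1 hs
      exact ⟨X_shadow hA s h1, h2⟩
    · intro v hv
      exact Y_shadow (hc.hF v hv)
  rw [← h2.card]
  apply Finset.card_le_card
  intro s hs
  rcases Finset.mem_union.1 hs with hs | hs
  · exact (Finset.mem_filter.1 hs).1
  · obtain ⟨v, hv, hs⟩ := Finset.mem_biUnion.1 hs
    obtain ⟨t, ht, rfl⟩ := Finset.mem_image.1 hs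
    obtain ⟨u, hu, a, ha, rfl⟩ := Finset.mem_shadow_iff.1 ht
    obtain ⟨h3, h4⟩ := mem_lk.1 hu
    have hne : v ≠ a := fun e => h3 (e ▸ ha)
    rw [← Finset.erase_insert_of_ne hne]
    exact Finset.erase_mem_shadow h4 (Finset.mem_insert_of_mem ha)

end Froh

namespace Froh
open Finset
open scoped FinsetFamily

open Classical in
noncomputable def full (r k n : ℕ) : Finset (Finset ℕ) :=
  (Finset.powersetCard k (Finset.range n)).filter (X r k)

noncomputable def T (r k n : ℕ) : ℕ := (full r k n).card

lemma mem_full {r k n : ℕ} {s : Finset ℕ} : s ∈ full r k n ↔ X r k s ∧ ∀ x ∈ s, x < n := by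
  simp only [full, Finset.mem_filter, Finset.mem_powersetCard]
  constructor
  · rintro ⟨⟨h1, _⟩, h3⟩
    exact ⟨h3, fun x hx => Finset.mem_range.1 (h1 hx)⟩
  · rintro ⟨h1, h2⟩
    exact ⟨⟨fun x hx => Finset.mem_range.2 (h2 x hx), h1.1⟩, h1⟩

lemma full_init {r k n : ℕ} : IsInit (X r k) (full r k n) := by
  refine ⟨fun s hs => (mem_full.1 hs).1, fun s hs t ht hlt => mem_full.2 ⟨ht, ?_⟩⟩
  exact lt_of_val_lt (mem_full.1 hs).2 hlt.le

lemma I_T {r k n : ℕ} : I r k (T r k n) = full r k n := I_eq full_init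

lemma full_mono {r k n m : ℕ} (h : n ≤ m) : full r k n ⊆ full r k m := by
  intro s hs
  rw [mem_full] at hs ⊢
  exact ⟨hs.1, fun x hx => (hs.2 x hx).trans_le h⟩

lemma T_mono {r k n m : ℕ} (h : n ≤ m) : T r k n ≤ T r k m := Finset.card_le_card (full_mono h)

lemma T_of_lt {r k n : ℕ} (h : n < k) : T r k n = 0 := by
  rw [T, Finset.card_eq_zero, Finset.eq_empty_iff_forall_notMem]
  intro s hs
  rw [mem_full] at hs
  have h1 : s ⊆ Finset.range n := fun x hx => Finset.mem_range.2 (hs.2 x hx)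
  have := Finset.card_le_card h1
  rw [hs.1.1, Finset.card_range] at this
  omega

lemma T_self_le {r k : ℕ} : T r k k ≤ 1 := by
  rw [T, Finset.card_le_one]
  intro s hs t ht
  rw [mem_full] at hs ht
  have h1 : s ⊆ Finset.range k := fun x hx => Finset.mem_range.2 (hs.2 x hx)
  have h2 : t ⊆ Finset.range k := fun x hx => Finset.mem_range.2 (ht.2 x hx)
  rw [Finset.eq_of_subset_of_card_le h1 (by rw [hs.1.1, Finset.card_range]),
    Finset.eq_of_subset_of_card_le h2 (by rw [ht.1.1, Finset.card_range])]

lemma shadow_union (A B : Finset (Finset ℕ)) : ∂ (A ∪ B) = ∂ A ∪ ∂ B := by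
  ext t
  simp only [Finset.mem_shadow_iff, Finset.mem_union]
  constructor
  · rintro ⟨s, h | h, a, ha, rfl⟩
    · exact Or.inl ⟨s, h, a, ha, rfl⟩
    · exact Or.inr ⟨s, h, a, ha, rfl⟩
  · rintro (⟨s, h, a, ha, rfl⟩ | ⟨s, h, a, ha, rfl⟩)
    · exact ⟨s, Or.inl h, a, ha, rfl⟩
    · exact ⟨s, Or.inr h, a, ha, rfl⟩

lemma shadow_singleton_card (s : Finset ℕ) : (∂ {s}).card = s.card := by
  have : ∂ {s} = s.image (fun a => s.erase a) := by
    ext t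
    simp [Finset.mem_shadow_iff]
  rw [this, Finset.card_image_of_injOn]
  intro a ha b hb hab
  by_contra hne
  have : a ∈ s.erase b := Finset.mem_erase.2 ⟨hne, ha⟩
  rw [← show s.erase a = s.erase b from hab] at this
  simp at this

lemma d_one {r k : ℕ} (h : k ≤ r) : d r k 1 = k := by
  have hg : Good r k 1 := ⟨{Finset.Ico 0 (0+k)}, by simpa using X_Ico (N := 0) h, rfl⟩
  obtain ⟨s, hs⟩ := Finset.card_eq_one.1 (I_card hg)
  have h1 : X r k s := (I_init (m := 1)).1 s (by rw [hs]; simp)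
  rw [d, hs, shadow_singleton_card, h1.1]

/-- number of new sets when adding the vertex `n` -/
noncomputable def tt (R k n : ℕ) : ℕ := T R k (n - n / (R+1))

lemma tt_mono {R k n m : ℕ} (h : n ≤ m) : tt R k n ≤ tt R k m := by
  apply T_mono
  induction m, h using Nat.le_induction with
  | base => rfl
  | succ m _ ih =>
    have : (m+1) / (R+1) ≤ m / (R+1) + 1 := by
      rw [Nat.succ_div]; split_ifs <;> omega
    have := Nat.div_le_self m (R+1)
    omega

noncomputable def seg (R k n q : ℕ) : Finset (Finset ℕ) :=
  full (R+1) (k+1) n ∪ (J R (n % (R+1)) k q).image (insert n)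

lemma mod_le' (n R : ℕ) : n % (R+1) ≤ R := Nat.lt_succ_iff.1 (Nat.mod_lt _ (by omega))

lemma J_lt {R k n q : ℕ} (hR : 1 ≤ R) (hg : Good R k q) (hq : q ≤ tt R k n) :
    ∀ s ∈ J R (n % (R+1)) k q, ∀ x ∈ s, x < n := by
  intro s hs x hx
  obtain ⟨t, ht, rfl⟩ := Finset.mem_image.1 hs
  obtain ⟨i, hi, rfl⟩ := Finset.mem_image.1 hx
  have : I R k q ⊆ full R k (n - n / (R+1)) :=
    I_init.subset full_init (by rw [I_card hg]; exact hq)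
  exact phi_lt' hR ((mem_full.1 (this ht)).2 i hi)

lemma seg_init {R k n q : ℕ} (hR : 1 ≤ R) (hg : Good R k q) (hq : q ≤ tt R k n) :
    IsInit (X (R+1) (k+1)) (seg R k n q) := by
  have hc := mod_le' n R
  have hJ := J_init (k := k) (m := q) hR hc
  have hlt := J_lt hR hg hq
  constructor
  · intro s hs
    rcases Finset.mem_union.1 hs with hs | hs
    · exact (mem_full.1 hs).1
    · obtain ⟨t, ht, rfl⟩ := Finset.mem_image.1 hs
      exact X_insert (hJ.1 t ht).1 (hJ.1 t ht).2
  · intro s hs t ht hv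
    rcases Finset.mem_union.1 hs with hs | hs
    · exact Finset.mem_union_left _ (full_init.2 s hs t ht hv)
    · obtain ⟨u, hu, rfl⟩ := Finset.mem_image.1 hs
      have h1 : ∀ x ∈ t, x < n + 1 := by
        refine lt_of_val_lt ?_ hv.le
        intro x hx
        rcases Finset.mem_insert.1 hx with rfl | hx
        · omega
        · have := hlt u hu x hx; omega
      by_cases hn : n ∈ t
      · have hY : Y (R+1) (n % (R+1)) k (t.erase n) := by
          apply lk_Y (A := {t}) (by simpa using ht) n
          rw [mem_lk]; simp [Finset.insert_erase hn]
        have hnu : n ∉ u := fun h => lt_irrefl _ (hlt u hu n h)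
        refine Finset.mem_union_right _ (Finset.mem_image.2 ⟨t.erase n, ?_, Finset.insert_erase hn⟩)
        refine hJ.2 u hu _ hY ?_
        rw [← Finset.insert_erase hn, val_insert hnu, val_insert (by simp)] at hv
        omega
      · refine Finset.mem_union_left _ (mem_full.2 ⟨ht, fun x hx => ?_⟩)
        have := h1 x hx
        have : x ≠ n := fun e => hn (e ▸ hx)
        omega

lemma seg_card {R k n q : ℕ} (hR : 1 ≤ R) (hg : Good R k q) (hq : q ≤ tt R k n) :
    (seg R k n q).card = T (R+1) (k+1) n + q := by
  have hlt := J_lt hR hg hq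
  rw [seg, Finset.card_union_of_disjoint, Finset.card_image_of_injOn, J_card hR hg]
  · rfl
  · intro s hs t ht hst
    have h1 : n ∉ s := fun h => lt_irrefl _ (hlt s hs n h)
    have h2 : n ∉ t := fun h => lt_irrefl _ (hlt t ht n h)
    rw [← Finset.erase_insert h1, ← Finset.erase_insert h2, hst]
  · rw [Finset.disjoint_left]
    intro s hs hs'
    obtain ⟨u, hu, rfl⟩ := Finset.mem_image.1 hs'
    exact lt_irrefl _ ((mem_full.1 hs).2 n (Finset.mem_insert_self _ _))

lemma good_tt {R k n : ℕ} : Good R k (tt R k n) :=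
  ⟨full R k (n - n/(R+1)), full_init.1, rfl⟩

lemma T_succ {R k n : ℕ} (hR : 1 ≤ R) :
    T (R+1) (k+1) (n+1) = T (R+1) (k+1) n + tt R k n := by
  have hc := mod_le' n R
  rw [← seg_card hR good_tt le_rfl, T]
  congr 1
  ext s
  constructor
  · intro hs
    obtain ⟨hX, hs⟩ := mem_full.1 hs
    by_cases hn : n ∈ s
    · have hY : Y (R+1) (n % (R+1)) k (s.erase n) := by
        apply lk_Y (A := {s}) (by simpa using hX) n
        rw [mem_lk]; simp [Finset.insert_erase hn]
      obtain ⟨t, ht, hts⟩ := Y_preimage hR hc hY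
      refine Finset.mem_union_right _ (Finset.mem_image.2 ⟨s.erase n, ?_, Finset.insert_erase hn⟩)
      rw [J, tt, I_T, im, Finset.mem_image]
      refine ⟨t, mem_full.2 ⟨ht, ?_⟩, hts⟩
      intro x hx
      apply phi_lt (c := n % (R+1)) hR
      have : phi R (n % (R+1)) x ∈ s.erase n := hts ▸ Finset.mem_image_of_mem _ hx
      have h1 := hs _ (Finset.mem_of_mem_erase this)
      have h2 := Finset.ne_of_mem_erase this
      omega
    · refine Finset.mem_union_left _ (mem_full.2 ⟨hX, fun x hx => ?_⟩)
      have := hs x hx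
      have : x ≠ n := fun e => hn (e ▸ hx)
      omega
  · intro hs
    rw [mem_full]
    refine ⟨(seg_init hR good_tt le_rfl).1 s hs, ?_⟩
    intro x hx
    rcases Finset.mem_union.1 hs with hs | hs
    · have := (mem_full.1 hs).2 x hx; omega
    · obtain ⟨u, hu, rfl⟩ := Finset.mem_image.1 hs
      rcases Finset.mem_insert.1 hx with rfl | hx
      · omega
      · have := J_lt hR good_tt le_rfl u hu x hx; omega

lemma full_subset_shadow {r k n : ℕ} (hk : k < r) (hn : k + 1 ≤ n) :
    full r k n ⊆ ∂ (full r (k+1) n) := by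
  intro Q hQ
  obtain ⟨hX, hQn⟩ := mem_full.1 hQ
  obtain ⟨y, hyr, hyc, hym⟩ := exists_ext hX hk
  have hyn : y < n := by
    by_contra hc
    have : Finset.range n ⊆ Q := by
      intro z hz
      rw [Finset.mem_range] at hz
      obtain ⟨x, hx, hxz⟩ := hym z (by omega)
      have := hQn x hx
      rw [Nat.mod_eq_of_lt (by omega), Nat.mod_eq_of_lt (by omega)] at hxz
      exact hxz ▸ hx
    have := Finset.card_le_card this
    rw [hX.1, Finset.card_range] at this
    omega
  refine Finset.mem_shadow_iff_insert_mem.2 ⟨y, fun h => hyc y h rfl, mem_full.2 ⟨X_insert hX hyc, ?_⟩⟩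
  intro x hx
  rcases Finset.mem_insert.1 hx with rfl | hx
  · exact hyn
  · exact hQn x hx

lemma F1 {R k n q : ℕ} (hk : 1 ≤ k) (hkR : k ≤ R) (hn : k + 1 ≤ n) (hq : q ≤ tt R k n) :
    d (R+1) (k+1) (T (R+1) (k+1) n + q) = T (R+1) k n + d R k q := by
  have hR : 1 ≤ R := by omega
  have hg := good_of hk hkR q
  have hlt := J_lt hR hg hq
  have hc := mod_le' n R
  have hJ := J_init (k := k) (m := q) hR hc
  rw [← seg_card hR hg hq, d, I_eq (seg_init hR hg hq)]
  have hsh : ∂ (seg R k n q) = full (R+1) k n ∪ (∂ (J R (n % (R+1)) k q)).image (insert n) := by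
    apply Finset.Subset.antisymm
    · intro s hs
      obtain ⟨t, ht, a, ha, rfl⟩ := Finset.mem_shadow_iff.1 hs
      rcases Finset.mem_union.1 ht with ht | ht
      · obtain ⟨h1, h2⟩ := mem_full.1 ht
        exact Finset.mem_union_left _ (mem_full.2 ⟨X_erase h1 ha,
          fun x hx => h2 x (Finset.mem_of_mem_erase hx)⟩)
      · obtain ⟨u, hu, rfl⟩ := Finset.mem_image.1 ht
        have hnu : n ∉ u := fun h => lt_irrefl _ (hlt u hu n h)
        rcases Finset.mem_insert.1 ha with rfl | ha
        · rw [Finset.erase_insert hnu]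
          exact Finset.mem_union_left _ (mem_full.2 ⟨(hJ.1 u hu).1, hlt u hu⟩)
        · have : n ≠ a := fun e => hnu (e ▸ ha)
          rw [Finset.erase_insert_of_ne this]
          exact Finset.mem_union_right _ (Finset.mem_image_of_mem _ (Finset.erase_mem_shadow hu ha))
    · apply Finset.union_subset
      · exact (full_subset_shadow (by omega) hn).trans (Finset.shadow_mono Finset.subset_union_left)
      · intro s hs
        obtain ⟨t, ht, rfl⟩ := Finset.mem_image.1 hs
        obtain ⟨u, hu, a, ha, rfl⟩ := Finset.mem_shadow_iff.1 ht
        have hnu : n ∉ u := fun h => lt_irrefl _ (hlt u hu n h)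
        have : n ≠ a := fun e => hnu (e ▸ ha)
        rw [← Finset.erase_insert_of_ne this]
        exact Finset.erase_mem_shadow (Finset.mem_union_right _ (Finset.mem_image_of_mem _ hu))
          (Finset.mem_insert_of_mem ha)
  have hlt2 : ∀ s ∈ ∂ (J R (n % (R+1)) k q), n ∉ s := by
    intro s hs h
    obtain ⟨u, hu, a, ha, rfl⟩ := Finset.mem_shadow_iff.1 hs
    exact lt_irrefl _ (hlt u hu n (Finset.mem_of_mem_erase h))
  rw [hsh, Finset.card_union_of_disjoint, Finset.card_image_of_injOn, J_shadow_card hR]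
  · rfl
  · intro s hs t ht hst
    rw [← Finset.erase_insert (hlt2 s hs), ← Finset.erase_insert (hlt2 t ht), hst]
  · rw [Finset.disjoint_left]
    intro s hs hs'
    obtain ⟨u, hu, rfl⟩ := Finset.mem_image.1 hs'
    exact lt_irrefl _ ((mem_full.1 hs).2 n (Finset.mem_insert_self _ _))

lemma subadd {r : ℕ} (hK : KK r) {k : ℕ} (hk : 1 ≤ k) (hkr : k ≤ r) (x y : ℕ) :
    d r k (x + y) ≤ d r k x + d r k y := by
  let N := (I r k x).sup (fun s => s.sup id)
  have hN : ∀ s ∈ I r k x, ∀ a ∈ s, a ≤ N := fun s hs a ha =>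
    (Finset.le_sup (f := id) ha).trans (Finset.le_sup (f := fun s : Finset ℕ => s.sup id) hs)
  let f : ℕ → ℕ := fun a => a + r * (N+1)
  have hf : Function.Injective f := fun a b h => by simpa [f] using h
  have hNr : N < r * (N+1) := by nlinarith
  have hfX : ∀ s ∈ im f (I r k y), X r k s := by
    intro s hs
    obtain ⟨t, ht, rfl⟩ := Finset.mem_image.1 hs
    have hX := I_init.1 t ht
    refine ⟨by rw [Finset.card_image_of_injective _ hf, hX.1], ?_⟩
    intro a ha b hb hab
    obtain ⟨a', ha', rfl⟩ := Finset.mem_image.1 ha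
    obtain ⟨b', hb', rfl⟩ := Finset.mem_image.1 hb
    simp only [f, Nat.add_mul_mod_self_left] at hab
    rw [hX.2 a' ha' b' hb' hab]
  have hdisj : Disjoint (I r k x) (im f (I r k y)) := by
    rw [Finset.disjoint_left]
    intro s hs hs'
    obtain ⟨t, ht, rfl⟩ := Finset.mem_image.1 hs'
    have hX := I_init.1 t ht
    have : t.Nonempty := by rw [← Finset.card_pos, hX.1]; omega
    obtain ⟨a, ha⟩ := this
    have := hN _ hs (f a) (Finset.mem_image_of_mem _ ha)
    simp only [f] at this
    omega
  have h := hK k (I r k x ∪ im f (I r k y)) (by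
    intro s hs
    rcases Finset.mem_union.1 hs with hs | hs
    · exact I_init.1 s hs
    · exact hfX s hs)
  rw [Finset.card_union_of_disjoint hdisj, im_card hf, I_card (good_of hk hkr x),
    I_card (good_of hk hkr y), shadow_union] at h
  refine h.trans ((Finset.card_union_le _ _).trans ?_)
  rw [shadow_im hf, im_card hf]
  rfl

def SL (r : ℕ) : Prop := ∀ k n x y z, 1 ≤ k → k ≤ r → x + T r k n = y + z → x ≤ y → x ≤ z →
  y ≤ T r k n → z ≤ T r k n → d r k (T r k n) + d r k x ≤ d r k y + d r k z

lemma d_k_one_le {r m : ℕ} : d r 1 m ≤ 1 := by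
  have : ∂ (I r 1 m) ⊆ {∅} := by
    intro s hs
    have := X_shadow (k := 0) I_init.1 s hs
    simpa using Finset.card_eq_zero.1 this.1
  have h := Finset.card_le_card this
  simpa [d] using h

lemma d_k_one_pos {r m : ℕ} (hr : 1 ≤ r) (h : 1 ≤ m) : d r 1 m = 1 := by
  apply le_antisymm d_k_one_le
  calc 1 = d r 1 1 := (d_one hr).symm
    _ ≤ d r 1 m := d_mono (good_of le_rfl hr m) h

lemma SL_one {r n x y z : ℕ} (hr : 1 ≤ r) (h : x + T r 1 n = y + z) (h1 : x ≤ y) (h2 : x ≤ z) :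
    d r 1 (T r 1 n) + d r 1 x ≤ d r 1 y + d r 1 z := by
  generalize T r 1 n = w at *
  rcases Nat.eq_zero_or_pos x with rfl | hx
  · rcases Nat.eq_zero_or_pos y with rfl | hy
    · have : w = z := by omega
      subst this; omega
    · rw [d_k_one_pos hr hy, d_zero]
      have := @d_k_one_le r w
      omega
  · rw [d_k_one_pos hr (show 1 ≤ y by omega), d_k_one_pos hr (show 1 ≤ z by omega)]
    have := @d_k_one_le r w
    have := @d_k_one_le r x
    omega

lemma exists_block {r k z n : ℕ} (hz : 1 ≤ z) (h : z ≤ T r (k+1) (n+1)) :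
    ∃ i ≤ n, T r (k+1) i < z ∧ z ≤ T r (k+1) (i+1) := by
  classical
  have hex : ∃ i, z ≤ T r (k+1) (i+1) := ⟨n, h⟩
  refine ⟨Nat.find hex, Nat.find_min' hex h, ?_, Nat.find_spec hex⟩
  rcases Nat.eq_zero_or_pos (Nat.find hex) with h0 | h0
  · rw [h0, T_of_lt (by omega)]; omega
  · have := Nat.find_min hex (show Nat.find hex - 1 < Nat.find hex by omega)
    rw [show Nat.find hex - 1 + 1 = Nat.find hex by omega] at this
    omega

lemma claimA {R k n : ℕ} (hK : KK R) (hS : SL R) (hk : 1 ≤ k) (hkR : k ≤ R) (z : ℕ) :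
    ∀ x l, z = x + l → l ≤ tt R k n → z ≤ T (R+1) (k+1) (n+1) →
    d R k (tt R k n) + d (R+1) (k+1) x ≤ d R k (tt R k n - l) + d (R+1) (k+1) z := by
  have hR : 1 ≤ R := by omega
  induction z using Nat.strong_induction_on with
  | _ z ih =>
  intro x l hz hl hzw
  rcases Nat.eq_zero_or_pos l with rfl | hl0
  · simp at hz; subst hz; simp
  obtain ⟨i, hin, hi1, hi2⟩ := exists_block (by omega) hzw
  rcases lt_trichotomy i k with h | h | h
  · rw [T_of_lt (by omega)] at hi2; omega
  · have h1 := @T_self_le (R+1) (k+1)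
    subst h
    have hz1 : z = 1 := by omega
    have hx0 : x = 0 := by omega
    have hl1 : l = 1 := by omega
    subst hz1 hx0 hl1
    rw [d_zero, d_one (by omega)]
    have h2 := subadd hK hk hkR (tt R i n - 1) 1
    rw [show tt R i n - 1 + 1 = tt R i n by omega, d_one hkR] at h2
    omega
  · rw [T_succ hR] at hi2
    have hti := tt_mono (R := R) (k := k) hin
    obtain ⟨z', rfl⟩ := Nat.exists_eq_add_of_lt hi1
    rw [add_assoc] at *
    set z' := z' + 1
    rw [F1 hk hkR (by omega) (by omega)]
    by_cases hx : T (R+1) (k+1) i ≤ x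
    · obtain ⟨x', rfl⟩ := Nat.exists_eq_add_of_le hx
      rw [F1 hk hkR (by omega) (by omega)]
      have := hS k (n - n / (R+1)) x' (tt R k n - l) z' hk hkR
        (by change x' + tt R k n = _; omega) (by omega) (by omega)
        (by change _ ≤ tt R k n; omega) (by change _ ≤ tt R k n; omega)
      change d R k (tt R k n) + _ ≤ _ at this
      omega
    · have h1 := ih (T (R+1) (k+1) i) (by omega) x (l - z') (by omega) (by omega) (by omega)
      have h2 := F1 (q := 0) hk hkR (show k + 1 ≤ i by omega) (Nat.zero_le _)
      rw [d_zero] at h2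
      simp only [add_zero] at h2
      have h3 := subadd hK hk hkR (tt R k n - l) z'
      rw [show tt R k n - l + z' = tt R k n - (l - z') by omega] at h3
      omega

lemma SL_succ_aux {R k : ℕ} (hK : KK R) (hS : SL R) (hk : 1 ≤ k) (hkR : k ≤ R) (n : ℕ) :
    ∀ x y z, x + T (R+1) (k+1) n = y + z → x ≤ z → z ≤ y → y ≤ T (R+1) (k+1) n →
    d (R+1) (k+1) (T (R+1) (k+1) n) + d (R+1) (k+1) x ≤ d (R+1) (k+1) y + d (R+1) (k+1) z := by
  have hR : 1 ≤ R := by omega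
  induction n with
  | zero =>
    intro x y z h1 h2 h3 h4
    rw [T_of_lt (by omega)] at *
    have : y = 0 := by omega
    have : z = 0 := by omega
    have : x = 0 := by omega
    subst_vars; simp
  | succ n ih =>
    intro x y z h1 h2 h3 h4
    rcases h4.lt_or_eq with h4 | h4
    swap
    · have : z = x := by omega
      subst this; rw [h4]
    rcases lt_or_ge n (k+1) with hn | hn
    · have := T_mono (r := R+1) (k := k+1) (show n + 1 ≤ k + 1 by omega)
      have := @T_self_le (R+1) (k+1)
      have : y = 0 := by omega
      have : z = 0 := by omega
      omega
    have hTs := T_succ (k := k) (n := n) hR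
    have hw := F1 (q := tt R k n) hk hkR hn le_rfl
    have hw0 := F1 (q := 0) hk hkR hn (Nat.zero_le _)
    rw [← hTs] at hw
    simp only [d_zero, add_zero] at hw0
    by_cases hy : T (R+1) (k+1) n ≤ y
    · have hA := claimA (n := n) hK hS hk hkR z x (z - x) (by omega) (by omega) (by omega)
      have hy' := F1 (q := tt R k n - (z - x)) hk hkR hn (by omega)
      rw [show T (R+1) (k+1) n + (tt R k n - (z - x)) = y by omega] at hy'
      omega
    · have hA := claimA (n := n) hK hS hk hkR z (z - tt R k n) (tt R k n) (by omega) le_rfl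
        (by omega)
      rw [Nat.sub_self, d_zero] at hA
      have hB := ih x y (z - tt R k n) (by omega) (by omega) (by omega) (by omega)
      omega

lemma SL_succ {R : ℕ} (hK : KK R) (hS : SL R) : SL (R+1) := by
  intro k n x y z hk hkR h hxy hxz hy hz
  rcases Nat.lt_or_ge 1 k with hk1 | hk1
  · obtain ⟨k, rfl⟩ : ∃ j, k = j + 1 := ⟨k - 1, by omega⟩
    rcases le_total z y with hzy | hzy
    · exact SL_succ_aux hK hS (by omega) (by omega) n x y z h hxz hzy hy
    · have := SL_succ_aux hK hS (by omega) (by omega) n x z y (by omega) hxy hzy hz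
      omega
  · have : k = 1 := by omega
    subst this
    exact SL_one (by omega) h hxy hxz

lemma SL_base : SL 1 := by
  intro k n x y z hk hkR h hxy hxz hy hz
  have : k = 1 := by omega
  subst this
  exact SL_one (by omega) h hxy hxz

/-- the numeric inequality for removal of one vertex -/
lemma removal {R k n M u : ℕ} (hK : KK R) (hS : SL R) (hk : 1 ≤ k) (hkR : k ≤ R)
    (hn : k + 1 ≤ n) (h1 : T (R+1) (k+1) n < M) (h2 : M ≤ T (R+1) (k+1) (n+1)) (hu : u ≤ M)
    (h : u ≤ M - T (R+1) (k+1) n ∨ u ≤ tt R k (n-1)) :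
    d (R+1) (k+1) M ≤ d (R+1) (k+1) (M - u) + d R k u := by
  have hR : 1 ≤ R := by omega
  rw [T_succ hR] at h2
  obtain ⟨q, rfl⟩ := Nat.exists_eq_add_of_lt h1
  rw [add_assoc] at *
  set q := q + 1 with hq
  rw [F1 hk hkR hn (by omega)]
  by_cases huq : u ≤ q
  · rw [show T (R+1) (k+1) n + q - u = T (R+1) (k+1) n + (q - u) by omega,
      F1 hk hkR hn (by omega)]
    have := subadd hK hk hkR (q - u) u
    rw [show q - u + u = q by omega] at this
    omega
  · have hu' : u ≤ tt R k (n-1) := by omega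
    have hTs := T_succ (k := k) (n := n - 1) hR
    rw [show n - 1 + 1 = n by omega] at hTs
    have hn1 : k + 1 ≤ n - 1 := by
      by_contra hc
      have hnk : n = k + 1 := by omega
      have := @T_self_le (R+1) (k+1)
      subst hnk
      omega
    have e1 := F1 (q := tt R k (n-1)) hk hkR hn1 le_rfl
    rw [← hTs] at e1
    have e2 := F1 (q := 0) hk hkR hn (Nat.zero_le _)
    simp only [d_zero, add_zero] at e2
    have e3 := F1 (q := tt R k (n-1) + q - u) hk hkR hn1 (by omega)
    rw [show T (R+1) (k+1) (n-1) + (tt R k (n-1) + q - u) = T (R+1) (k+1) n + q - u by omega] at e3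
    have := hS k (n - 1 - (n-1) / (R+1)) q (tt R k (n-1) + q - u) u hk hkR
      (by change q + tt R k (n-1) = _; omega) (by omega) (by omega)
      (by change _ ≤ tt R k (n-1); omega) hu'
    change d R k (tt R k (n-1)) + _ ≤ _ at this
    omega

end Froh

namespace Froh
open Finset
open scoped FinsetFamily

lemma compress {R k : ℕ} (hK : KK R) (hk : 1 ≤ k) (hR : 1 ≤ R) {A : Finset (Finset ℕ)}
    (hA : ∀ s ∈ A, X (R+1) (k+1) s) {c : ℕ} (hc : c ≤ R)
    (hmin : ∀ A' : Finset (Finset ℕ), (∀ s ∈ A', X (R+1) (k+1) s) → A'.card = A.card →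
      (∂ A').card ≤ (∂ A).card → ∑ s ∈ A, val s ≤ ∑ s ∈ A', val s) :
    ∀ v ∈ supp (R+1) c A, IsInit (Y (R+1) c k) (lk A v) := by
  obtain ⟨k, rfl⟩ : ∃ j, k = j + 1 := ⟨k - 1, by omega⟩
  have hcd := coneData_of hA c
  have hg0 := good_Y hR hc hcd.h0
  have hgF := fun v hv => good_Y hR hc (hcd.hF v hv)
  set m := (miss (R+1) c (∂ A)).card with hm
  have hmY : ∀ s ∈ miss (R+1) c (∂ A), Y (R+1) c (k+1) s := by
    intro s hs
    obtain ⟨h1, h2⟩ := Finset.mem_filter.1 hs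
    exact ⟨X_shadow hA s h1, h2⟩
  have hgm := good_Y hR hc hmY
  let J0 := J R c (k+2) (miss (R+1) c A).card
  let F : ℕ → Finset (Finset ℕ) := fun v => J R c (k+1) (lk A v).card
  have hcd' : ConeData (R+1) c (k+1) (supp (R+1) c A) J0 F :=
    ⟨hcd.hS, (J_init hR hc).1, fun v _ => (J_init hR hc).1⟩
  have h0c : J0.card = (miss (R+1) c A).card := J_card hR hg0
  have hFc : ∀ v ∈ supp (R+1) c A, (F v).card = (lk A v).card := fun v hv => J_card hR (hgF v hv)
  have hcard : (cone (supp (R+1) c A) J0 F).card = A.card := by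
    conv_rhs => rw [← cone_eq (R+1) c A]
    rw [hcd'.card, hcd.card, h0c, Finset.sum_congr rfl hFc]
  have hsh : (∂ (cone (supp (R+1) c A) J0 F)).card ≤ (∂ A).card := by
    refine le_trans (hcd'.shadow_le (K := J R c (k+1) m) ?_ ?_) (le_trans ?_ (shadow_ge hA c))
    · apply (J_shadow_init hR hc).subset (J_init hR hc)
      rw [J_card hR hgm, J_shadow_card hR]
      refine (hK.Y hR hc hcd.h0).trans (Finset.card_le_card ?_)
      intro s hs
      refine Finset.mem_filter.2 ⟨Finset.shadow_mono (Finset.filter_subset _ _) hs, ?_⟩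
      exact (Y_shadow hcd.h0 s hs).2
    · intro v hv
      apply (J_init hR hc).subset (J_init hR hc)
      rw [J_card hR hgm, J_card hR (hgF v hv)]
      apply Finset.card_le_card
      intro s hs
      refine Finset.mem_filter.2 ⟨?_, (hcd.hF v hv s hs).2⟩
      obtain ⟨h1, h2⟩ := mem_lk.1 hs
      exact Finset.mem_shadow_iff_insert_mem.2 ⟨v, h1, h2⟩
    · rw [J_card hR hgm]
      refine Nat.add_le_add_left (Finset.sum_le_sum fun v hv => ?_) _
      rw [J_shadow_card hR]
      exact hK.Y hR hc (hcd.hF v hv)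
  have hval := hmin _ hcd'.X hcard hsh
  have hA2 := hcd.sum_val
  rw [cone_eq] at hA2
  rw [hA2, hcd'.sum_val] at hval
  have h0le : ∑ s ∈ J0, val s ≤ ∑ s ∈ miss (R+1) c A, val s :=
    (J_init hR hc).sum_le hcd.h0 h0c
  intro v hv
  by_contra hni
  have hne : F v ≠ lk A v := fun h => hni (h ▸ J_init hR hc)
  have hlt : ∑ v ∈ supp (R+1) c A, ((F v).card * 2 ^ v + ∑ s ∈ F v, val s) <
      ∑ v ∈ supp (R+1) c A, ((lk A v).card * 2 ^ v + ∑ s ∈ lk A v, val s) := by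
    apply Finset.sum_lt_sum
    · intro w hw
      rw [hFc w hw]
      exact Nat.add_le_add_left ((J_init hR hc).sum_le (hcd.hF w hw) (hFc w hw)) _
    · refine ⟨v, hv, ?_⟩
      rw [hFc v hv]
      exact Nat.add_lt_add_left ((J_init hR hc).sum_lt (hcd.hF v hv) (hFc v hv) hne) _
  omega

/-- exchange property of a compressed family -/
def Exch (r k : ℕ) (A : Finset (Finset ℕ)) : Prop :=
  ∀ B ∈ A, ∀ C, X r k C → val C < val B → ∀ v ∈ B, v ∈ C → C ∈ A

lemma compress_exch {R k : ℕ} (hK : KK R) (hk : 1 ≤ k) (hR : 1 ≤ R) {A : Finset (Finset ℕ)}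
    (hA : ∀ s ∈ A, X (R+1) (k+1) s)
    (hmin : ∀ A' : Finset (Finset ℕ), (∀ s ∈ A', X (R+1) (k+1) s) → A'.card = A.card →
      (∂ A').card ≤ (∂ A).card → ∑ s ∈ A, val s ≤ ∑ s ∈ A', val s) :
    Exch (R+1) (k+1) A := by
  intro B hB C hC hlt v hvB hvC
  have h := compress hK hk hR hA (mod_le' v R) hmin v
    (Finset.mem_filter.2 ⟨Finset.mem_biUnion.2 ⟨B, hB, hvB⟩, rfl⟩)
  have h1 : B.erase v ∈ lk A v := mem_lk.2 ⟨by simp, by rwa [Finset.insert_erase hvB]⟩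
  have h2 : Y (R+1) (v % (R+1)) k (C.erase v) := by
    refine ⟨X_erase hC hvC, ?_⟩
    intro x hx hxv
    exact (Finset.mem_erase.1 hx).1 (hC.2 x (Finset.mem_of_mem_erase hx) v hvC hxv)
  have e1 := val_insert (Finset.notMem_erase v B)
  have e2 := val_insert (Finset.notMem_erase v C)
  rw [Finset.insert_erase hvB] at e1
  rw [Finset.insert_erase hvC] at e2
  have := (mem_lk.1 (h.2 _ h1 _ h2 (by omega))).2
  rwa [Finset.insert_erase hvC] at this

lemma val_le_Ico {k n : ℕ} {C : Finset ℕ} (hC : C.card = k) (hn : ∀ x ∈ C, x < n) :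
    val C ≤ val (Finset.Ico (n - k) n) := by
  by_contra! hlt
  rw [val_lt_iff, Finset.Colex.toColex_lt_toColex_iff_exists_forall_lt] at hlt
  obtain ⟨a, ha, haE, hall⟩ := hlt
  have hkn : k ≤ n := by
    have h1 : C ⊆ Finset.range n := fun x hx => Finset.mem_range.2 (hn x hx)
    have := Finset.card_le_card h1
    rw [hC, Finset.card_range] at this
    exact this
  have han := hn a ha
  simp only [Finset.mem_Ico, not_and, not_lt] at haE
  have hsub : Finset.Ico (n - k) n ⊆ C.erase a := by
    intro b hb
    have hb' := Finset.mem_Ico.1 hb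
    by_contra hbC
    have hbne : b ≠ a := by
      rintro rfl
      have := haE hb'.1
      omega
    have hbC' : b ∉ C := fun h => hbC (Finset.mem_erase.2 ⟨hbne, h⟩)
    have := hall b hb hbC'
    have := haE (by omega)
    omega
  have := Finset.card_le_card hsub
  rw [Finset.card_erase_of_mem ha, hC, Nat.card_Ico] at this
  have : 0 < k := by rw [← hC]; exact Finset.card_pos.2 ⟨a, ha⟩
  omega

/-- If the last set of `full n` is in `A`, so is everything. -/
lemma full_sub {r k n : ℕ} (hk : 1 ≤ k) (hkr : k + 1 ≤ r) {A : Finset (Finset ℕ)}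
    (hE : Exch r (k+1) A) (hn : k + 1 ≤ n) (h : Finset.Ico (n - (k+1)) n ∈ A) :
    full r (k+1) n ⊆ A := by
  have key : ∀ C ∈ full r (k+1) n, n - 1 ∈ C → C ∈ A := by
    intro C hC hx
    obtain ⟨hCX, hCn⟩ := mem_full.1 hC
    rcases (val_le_Ico hCX.1 hCn).lt_or_eq with hlt | heq
    · exact hE _ h C hCX hlt (n-1) (Finset.mem_Ico.2 (by omega)) hx
    · rw [val_inj heq]; exact h
  intro C hC
  by_cases hx : n - 1 ∈ C
  · exact key C hC hx
  obtain ⟨hCX, hCn⟩ := mem_full.1 hC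
  have hy : ∃ y ∈ C, ∀ z ∈ C.erase y, z % r ≠ (n-1) % r := by
    by_cases hy : ∃ y ∈ C, y % r = (n-1) % r
    · obtain ⟨y, hyC, hyc⟩ := hy
      refine ⟨y, hyC, fun z hz hzc => ?_⟩
      exact (Finset.mem_erase.1 hz).1
        (hCX.2 z (Finset.mem_of_mem_erase hz) y hyC (hzc.trans hyc.symm))
    · push Not at hy
      have : C.Nonempty := by rw [← Finset.card_pos, hCX.1]; omega
      obtain ⟨y, hyC⟩ := this
      exact ⟨y, hyC, fun z hz => hy z (Finset.mem_of_mem_erase hz)⟩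
  obtain ⟨y, hyC, hyz⟩ := hy
  have hC'X : X r (k+1) (insert (n-1) (C.erase y)) := X_insert (X_erase hCX hyC) hyz
  have hC'A := key (insert (n-1) (C.erase y)) (mem_full.2 ⟨hC'X, by
    intro x hx
    rcases Finset.mem_insert.1 hx with rfl | hx
    · omega
    · exact hCn x (Finset.mem_of_mem_erase hx)⟩) (Finset.mem_insert_self _ _)
  have hne : (C.erase y).Nonempty := by
    rw [← Finset.card_pos, Finset.card_erase_of_mem hyC, hCX.1]; omega
  obtain ⟨z, hz⟩ := hne
  have e1 := val_insert (Finset.notMem_erase y C)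
  rw [Finset.insert_erase hyC] at e1
  have e2 := val_insert (s := C.erase y) (a := n-1) (fun h => hx (Finset.mem_of_mem_erase h))
  have hyn := hCn y hyC
  have hyne : y ≠ n - 1 := fun e => hx (e ▸ hyC)
  have hp : 2 ^ y < 2 ^ (n-1) := Nat.pow_lt_pow_right (by omega) (by omega)
  exact hE _ hC'A C hCX (by omega) z (Finset.mem_insert_of_mem hz) (Finset.mem_of_mem_erase hz)

/-- If the last set of `full n` is not in `A`, links of bigger vertices are small. -/
lemma link_small {r k n b : ℕ} (hk : 1 ≤ k) (hkr : k + 1 ≤ r) {A : Finset (Finset ℕ)}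
    (hA : ∀ s ∈ A, X r (k+1) s)
    (hE : Exch r (k+1) A) (hn : k + 1 ≤ n) (hb : n ≤ b) (h : Finset.Ico (n - (k+1)) n ∉ A) :
    ∀ s ∈ lk A b, ∀ x ∈ s, x + 2 < n := by
  set E := Finset.Ico (n - (k+1)) n with hEdef
  have hEX : X r (k+1) E := by
    have := X_Ico (N := n - (k+1)) hkr
    rwa [Nat.sub_add_cancel hn] at this
  have hElt : ∀ B : Finset ℕ, b ∈ B → val E < val B := fun B hB =>
    val_lt_val_of (b := n) (fun x hx => (Finset.mem_Ico.1 hx).2) ⟨b, hB, hb⟩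
  have hdis : ∀ B ∈ A, b ∈ B → ∀ x ∈ B, x ∉ E := fun B hB hbB x hx hxE =>
    h (hE B hB E hEX (hElt B hbB) x hx hxE)
  have hQ : ∃ y ∈ E, ∀ z ∈ E.erase y, z % r ≠ b % r := by
    by_cases hy : ∃ y ∈ E, y % r = b % r
    · obtain ⟨y, hyC, hyc⟩ := hy
      refine ⟨y, hyC, fun z hz hzc => ?_⟩
      exact (Finset.mem_erase.1 hz).1
        (hEX.2 z (Finset.mem_of_mem_erase hz) y hyC (hzc.trans hyc.symm))
    · push Not at hy
      have : E.Nonempty := by rw [← Finset.card_pos, hEX.1]; omega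
      obtain ⟨y, hyC⟩ := this
      exact ⟨y, hyC, fun z hz => hy z (Finset.mem_of_mem_erase hz)⟩
  obtain ⟨y, hyE, hyz⟩ := hQ
  have hCX : X r (k+1) (insert b (E.erase y)) := X_insert (X_erase hEX hyE) hyz
  have hne : (E.erase y).Nonempty := by
    rw [← Finset.card_pos, Finset.card_erase_of_mem hyE, hEX.1]; omega
  obtain ⟨z, hz⟩ := hne
  have hCA : insert b (E.erase y) ∉ A := fun hCA =>
    hdis _ hCA (Finset.mem_insert_self _ _) z (Finset.mem_insert_of_mem hz)
      (Finset.mem_of_mem_erase hz)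
  intro s hs x hx
  obtain ⟨hbs, hB⟩ := mem_lk.1 hs
  have hlt : val (insert b s) < val (insert b (E.erase y)) := by
    by_contra! hle
    rcases hle.lt_or_eq with hlt | heq
    · exact hCA (hE _ hB _ hCX hlt b (Finset.mem_insert_self _ _) (Finset.mem_insert_self _ _))
    · exact hCA (by rw [val_inj heq]; exact hB)
  have hbE : b ∉ E.erase y := fun hm => by
    have := (Finset.mem_Ico.1 (Finset.mem_of_mem_erase hm)).2
    omega
  rw [val_insert hbs, val_insert hbE] at hlt
  have hxn : x < n := lt_of_val_lt (t := E.erase y)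
    (fun w hw => (Finset.mem_Ico.1 (Finset.mem_of_mem_erase hw)).2) (by omega) x hx
  have hxE := hdis _ hB (Finset.mem_insert_self _ _) x (Finset.mem_insert_of_mem hx)
  rw [hEdef, Finset.mem_Ico] at hxE
  omega

lemma shadow_split (A : Finset (Finset ℕ)) (b : ℕ) :
    (∂ (A.filter (b ∉ ·))).card + (∂ (lk A b)).card ≤ (∂ A).card := by
  have hinj : Set.InjOn (insert b : Finset ℕ → Finset ℕ) (∂ (lk A b)) := by
    have hnb : ∀ s ∈ ∂ (lk A b), b ∉ s := by
      intro s hs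
      obtain ⟨t, ht, a, ha, rfl⟩ := Finset.mem_shadow_iff.1 hs
      exact fun h => (mem_lk.1 ht).1 (Finset.mem_of_mem_erase h)
    intro s hs t ht hst
    rw [← Finset.erase_insert (hnb s hs), ← Finset.erase_insert (hnb t ht)]
    exact congrArg (fun u => Finset.erase u b) hst
  rw [← Finset.card_image_of_injOn hinj, ← Finset.card_union_of_disjoint]
  · apply Finset.card_le_card
    intro s hs
    rcases Finset.mem_union.1 hs with hs | hs
    · exact Finset.shadow_mono (Finset.filter_subset _ _) hs
    · obtain ⟨t, ht, rfl⟩ := Finset.mem_image.1 hs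
      obtain ⟨u, hu, a, ha, rfl⟩ := Finset.mem_shadow_iff.1 ht
      obtain ⟨h3, h4⟩ := mem_lk.1 hu
      have hne : b ≠ a := fun e => h3 (e ▸ ha)
      rw [← Finset.erase_insert_of_ne hne]
      exact Finset.erase_mem_shadow h4 (Finset.mem_insert_of_mem ha)
  · rw [Finset.disjoint_left]
    intro s hs hs'
    obtain ⟨t, ht, rfl⟩ := Finset.mem_image.1 hs'
    obtain ⟨u, hu, a, ha, he⟩ := Finset.mem_shadow_iff.1 hs
    have h1 := (Finset.mem_filter.1 hu).2
    have : b ∈ u.erase a := by rw [he]; exact Finset.mem_insert_self _ _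
    exact h1 (Finset.mem_of_mem_erase this)

lemma card_split (A : Finset (Finset ℕ)) (b : ℕ) :
    (A.filter (b ∉ ·)).card + (lk A b).card = A.card := by
  have : (lk A b).card = (A.filter (b ∈ ·)).card := by
    apply Finset.card_image_of_injOn
    intro s hs t ht hst
    have h1 := (Finset.mem_filter.1 hs).2
    have h2 := (Finset.mem_filter.1 ht).2
    rw [← Finset.insert_erase h1, ← Finset.insert_erase h2]
    exact congrArg (insert b) hst
  rw [this, add_comm]
  exact Finset.card_filter_add_card_filter_not (s := A) (fun s => b ∈ s)

lemma KK_step {R k : ℕ} (hK : KK R) (hS : SL R) (hk : 1 ≤ k) (hkR : k ≤ R) (M : ℕ) :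
    ∀ A : Finset (Finset ℕ), A.card = M → (∀ s ∈ A, X (R+1) (k+1) s) →
    d (R+1) (k+1) M ≤ (∂ A).card := by
  have hR : 1 ≤ R := by omega
  induction M using Nat.strong_induction_on with
  | _ M ih =>
  intro A0 hA0 hX0
  rcases Nat.lt_or_ge M 2 with hM | hM
  · interval_cases M
    · rw [d_zero]; omega
    · obtain ⟨s, rfl⟩ := Finset.card_eq_one.1 hA0
      rw [d_one (by omega), shadow_singleton_card, (hX0 s (by simp)).1]
  -- choose a minimal family
  obtain ⟨A, ⟨hAM, hA, hAs⟩, hmin⟩ : ∃ A : Finset (Finset ℕ), (A.card = M ∧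
      (∀ s ∈ A, X (R+1) (k+1) s) ∧ (∂ A).card ≤ (∂ A0).card) ∧
      ∀ A' : Finset (Finset ℕ), (A'.card = M ∧
      (∀ s ∈ A', X (R+1) (k+1) s) ∧ (∂ A').card ≤ (∂ A0).card) →
        ∑ s ∈ A, val s ≤ ∑ s ∈ A', val s := by
    have hex : ∃ N, ∃ A : Finset (Finset ℕ), (A.card = M ∧
      (∀ s ∈ A, X (R+1) (k+1) s) ∧ (∂ A).card ≤ (∂ A0).card) ∧ ∑ s ∈ A, val s = N :=
      ⟨_, A0, ⟨hA0, hX0, le_rfl⟩, rfl⟩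
    classical
    obtain ⟨A, h1, h2⟩ := Nat.find_spec hex
    refine ⟨A, h1, fun A' h' => ?_⟩
    rw [h2]
    exact Nat.find_min' hex ⟨A', h', rfl⟩
  refine le_trans ?_ hAs
  have hE : Exch (R+1) (k+1) A := compress_exch hK hk hR hA
    (fun A' h1 h2 h3 => hmin A' ⟨h2.trans hAM, h1, h3.trans hAs⟩)
  -- the biggest vertex
  have hAne : A.Nonempty := by rw [← Finset.card_pos]; omega
  have hVne : (A.biUnion id).Nonempty := by
    obtain ⟨s, hs⟩ := hAne
    have : s.Nonempty := by rw [← Finset.card_pos, (hA s hs).1]; omega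
    obtain ⟨x, hx⟩ := this
    exact ⟨x, Finset.mem_biUnion.2 ⟨s, hs, hx⟩⟩
  obtain ⟨b, hbV, hbmax⟩ : ∃ b ∈ A.biUnion id, ∀ x ∈ A.biUnion id, x ≤ b :=
    ⟨_, Finset.max'_mem _ hVne, fun x hx => Finset.le_max' _ x hx⟩
  have hAfull : A ⊆ full (R+1) (k+1) (b+1) := fun s hs => mem_full.2 ⟨hA s hs, fun x hx =>
    Nat.lt_succ_of_le (hbmax x (Finset.mem_biUnion.2 ⟨s, hs, hx⟩))⟩
  obtain ⟨B0, hB0, hbB0⟩ := Finset.mem_biUnion.1 hbV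
  simp only [id] at hbB0
  have hsplit := card_split A b
  have hupos : 1 ≤ (lk A b).card := Finset.card_pos.2
    ⟨B0.erase b, mem_lk.2 ⟨by simp, by rwa [Finset.insert_erase hbB0]⟩⟩
  have hlkY := lk_Y hA b
  have hge : d (R+1) (k+1) (M - (lk A b).card) + d R k (lk A b).card ≤ (∂ A).card := by
    refine le_trans (Nat.add_le_add ?_ (hK.Y hR (mod_le' b R) hlkY)) (shadow_split A b)
    exact ih _ (by omega) _ (by omega) (fun s hs => hA s (Finset.mem_filter.1 hs).1)
  refine le_trans ?_ hge
  have hTk : ∀ n, T (R+1) (k+1) n < M → M ≤ T (R+1) (k+1) (n+1) → k + 1 ≤ n := by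
    intro n _ h2
    by_contra! hlt
    have := T_mono (r := R+1) (k := k+1) (show n + 1 ≤ k + 1 by omega)
    have := T_self_le (r := R+1) (k := k+1)
    omega
  have hM1 : M ≤ T (R+1) (k+1) (b+1) := by rw [← hAM]; exact Finset.card_le_card hAfull
  by_cases hfb : full (R+1) (k+1) b ⊆ A
  · have heq : A.filter (b ∉ ·) = full (R+1) (k+1) b := by
      ext s
      rw [Finset.mem_filter]
      constructor
      · rintro ⟨hs, hbs⟩
        have := mem_full.1 (hAfull hs)
        refine mem_full.2 ⟨this.1, fun x hx => ?_⟩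
        have h1 := this.2 x hx
        have : x ≠ b := fun e => hbs (e ▸ hx)
        omega
      · intro hs
        exact ⟨hfb hs, fun h => lt_irrefl _ ((mem_full.1 hs).2 b h)⟩
    have hT : (A.filter (b ∉ ·)).card = T (R+1) (k+1) b := by rw [heq]; rfl
    have hlt : T (R+1) (k+1) b < M := by omega
    exact removal hK hS hk hkR (hTk b hlt hM1) hlt hM1 (by omega) (Or.inl (by omega))
  · obtain ⟨n, hnb, hn1, hn2⟩ := exists_block (by omega : 1 ≤ M) hM1
    have hkn := hTk n hn1 hn2
    refine removal hK hS hk hkR hkn hn1 hn2 (by omega) (Or.inr ?_)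
    have hEA : Finset.Ico (min b (n+1) - (k+1)) (min b (n+1)) ∉ A := by
      intro hmem
      have hsub := full_sub hk (by omega) hE (by omega) hmem
      rcases hnb.lt_or_eq with hlt | heq
      · rw [min_eq_right (by omega)] at hsub
        have := Finset.eq_of_subset_of_card_le hsub (by rw [hAM]; exact hn2)
        rw [← this] at hB0
        have := (mem_full.1 hB0).2 b hbB0
        omega
      · rw [min_eq_left (by omega)] at hsub
        exact hfb hsub
    have hsm := link_small hk (by omega) hA hE (by omega) (min_le_left b (n+1)) hEA
    obtain ⟨B, hB, hBe⟩ := im_exists hR (mod_le' b R) hlkY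
    rw [← hBe, im_card (phi_strictMono hR).injective]
    unfold tt T
    apply Finset.card_le_card
    intro s hs
    refine mem_full.2 ⟨hB s hs, fun i hi => ?_⟩
    apply phi_lt (c := b % (R+1)) hR
    have h1 : s.image (phi R (b % (R+1))) ∈ lk A b := by
      rw [← hBe]; exact Finset.mem_image_of_mem _ hs
    have := hsm _ h1 _ (Finset.mem_image_of_mem _ hi)
    omega

lemma d_k_zero {r m : ℕ} : d r 0 m = 0 := by
  rw [d, Finset.card_eq_zero, Finset.eq_empty_iff_forall_notMem]
  intro s hs
  obtain ⟨t, ht, a, ha, _⟩ := Finset.mem_shadow_iff.1 hs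
  have := (I_init.1 t ht).1
  rw [Finset.card_eq_zero.1 this] at ha
  simp at ha

lemma KK_of {r : ℕ} (hr : 1 ≤ r) (h : ∀ k, 1 ≤ k → k + 1 ≤ r → ∀ A : Finset (Finset ℕ),
    (∀ s ∈ A, X r (k+1) s) → d r (k+1) A.card ≤ (∂ A).card) : KK r := by
  intro k A hA
  rcases A.eq_empty_or_nonempty with rfl | ⟨s, hs⟩
  · rw [Finset.card_empty, d_zero]; omega
  have hkr := X_le hr (hA s hs)
  rcases k with _ | _ | k
  · rw [d_k_zero]; omega
  · refine d_k_one_le.trans (Finset.card_pos.2 ?_)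
    obtain ⟨a, ha⟩ := Finset.card_eq_one.1 (hA s hs).1
    exact ⟨s.erase a, Finset.erase_mem_shadow hs (by rw [ha]; simp)⟩
  · exact h (k+1) (by omega) hkr A hA

lemma KK_SL (R : ℕ) : KK (R+1) ∧ SL (R+1) := by
  induction R with
  | zero => exact ⟨KK_of le_rfl (fun k h1 h2 => by omega), SL_base⟩
  | succ R ih =>
    refine ⟨KK_of (by omega) ?_, SL_succ ih.1 ih.2⟩
    intro k h1 h2 A hA
    exact KK_step ih.1 ih.2 h1 (by omega) _ A rfl hA

lemma KK_all {r : ℕ} (hr : 1 ≤ r) : KK r := by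
  obtain ⟨R, rfl⟩ : ∃ j, r = j + 1 := ⟨r - 1, by omega⟩
  exact (KK_SL R).1

end Froh

namespace Froh
open Finset
open scoped FinsetFamily

section graph

variable {V : Type*} [Fintype V] [DecidableEq V] (G : SimpleGraph V) [DecidableRel G.Adj]

/-- number of `k`-cliques inside `W` -/
def cc (k : ℕ) (W : Finset V) : ℕ := ((G.cliqueFinset k).filter (· ⊆ W)).card

lemma cc_mono {k : ℕ} {W W' : Finset V} (h : W ⊆ W') : cc G k W ≤ cc G k W' := by
  apply Finset.card_le_card
  intro s hs
  rw [Finset.mem_filter] at hs ⊢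
  exact ⟨hs.1, hs.2.trans h⟩

lemma cc_zero (W : Finset V) : cc G 0 W = 1 := by
  rw [cc, Finset.card_eq_one]
  refine ⟨∅, ?_⟩
  ext s
  simp only [Finset.mem_filter, SimpleGraph.mem_cliqueFinset_iff, Finset.mem_singleton]
  constructor
  · rintro ⟨h, _⟩
    exact Finset.card_eq_zero.1 h.card_eq
  · rintro rfl
    exact ⟨⟨by simp, rfl⟩, by simp⟩

lemma cc_insert {k : ℕ} {W : Finset V} {v : V} (hv : v ∉ W) :
    cc G (k+1) (insert v W) = cc G (k+1) W + cc G k (W.filter (G.Adj v)) := by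
  have heq : (G.cliqueFinset (k+1)).filter (· ⊆ insert v W) =
      (G.cliqueFinset (k+1)).filter (· ⊆ W) ∪
      ((G.cliqueFinset k).filter (· ⊆ W.filter (G.Adj v))).image (insert v) := by
    ext s
    simp only [Finset.mem_filter, SimpleGraph.mem_cliqueFinset_iff, Finset.mem_union,
      Finset.mem_image]
    constructor
    · rintro ⟨h1, h2⟩
      by_cases hvs : v ∈ s
      · right
        refine ⟨s.erase v, ⟨h1.erase_of_mem hvs, ?_⟩, Finset.insert_erase hvs⟩
        intro x hx
        obtain ⟨hxv, hxs⟩ := Finset.mem_erase.1 hx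
        refine Finset.mem_filter.2 ⟨Finset.mem_of_mem_insert_of_ne (h2 hxs) hxv, ?_⟩
        exact h1.isClique hvs hxs hxv.symm
      · left
        refine ⟨h1, fun x hx => ?_⟩
        exact Finset.mem_of_mem_insert_of_ne (h2 hx) (fun e => hvs (e ▸ hx))
    · rintro (⟨h1, h2⟩ | ⟨t, ⟨h1, h2⟩, rfl⟩)
      · exact ⟨h1, h2.trans (Finset.subset_insert _ _)⟩
      · refine ⟨h1.insert (fun b hb => (Finset.mem_filter.1 (h2 hb)).2), ?_⟩
        exact Finset.insert_subset_insert _ (h2.trans (Finset.filter_subset _ _))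
  rw [cc, heq, Finset.card_union_of_disjoint, Finset.card_image_of_injOn]
  · rfl
  · intro s hs t ht hst
    have hs' : v ∉ s := fun h => hv (Finset.mem_filter.1 ((Finset.mem_filter.1 hs).2 h)).1
    have ht' : v ∉ t := fun h => hv (Finset.mem_filter.1 ((Finset.mem_filter.1 ht).2 h)).1
    rw [← Finset.erase_insert hs', ← Finset.erase_insert ht']
    exact congrArg (fun u => Finset.erase u v) hst
  · rw [Finset.disjoint_left]
    intro s hs hs'
    obtain ⟨t, _, rfl⟩ := Finset.mem_image.1 hs'
    exact hv ((Finset.mem_filter.1 hs).2 (Finset.mem_insert_self _ _))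

lemma cc_nbr {k : ℕ} {W : Finset V} {v : V} (hv : v ∈ W) :
    cc G k (W.filter (G.Adj v)) ≤ cc G (k+1) W := by
  have h1 : v ∉ W.filter (G.Adj v) := by simp
  have h2 := cc_insert G (k := k) h1
  have h3 : (W.filter (G.Adj v)).filter (G.Adj v) = W.filter (G.Adj v) := by
    ext x; simp
  rw [h3] at h2
  have h4 : cc G (k+1) (insert v (W.filter (G.Adj v))) ≤ cc G (k+1) W :=
    cc_mono G (Finset.insert_subset hv (Finset.filter_subset _ _))
  omega

lemma cc_eq_zero_of_le {j i : ℕ} {W : Finset V} (h : cc G j W = 0) (hij : j ≤ i) :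
    cc G i W = 0 := by
  induction i, hij using Nat.le_induction with
  | base => exact h
  | succ i _ ih =>
    rw [cc, Finset.card_eq_zero, Finset.eq_empty_iff_forall_notMem] at ih ⊢
    intro s hs
    simp only [Finset.mem_filter, SimpleGraph.mem_cliqueFinset_iff] at hs ih
    have : s.Nonempty := by rw [← Finset.card_pos, hs.1.card_eq]; omega
    obtain ⟨x, hx⟩ := this
    exact ih (s.erase x) ⟨hs.1.erase_of_mem hx, (Finset.erase_subset _ _).trans hs.2⟩

lemma decomp (L S : Finset V) (hd : Disjoint L S) :
    ∃ F : V → Finset V, (∀ v ∈ S, F v ⊆ (L ∪ S).filter (G.Adj v)) ∧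
      ∀ k, cc G (k+1) (L ∪ S) = cc G (k+1) L + ∑ v ∈ S, cc G k (F v) := by
  induction S using Finset.induction_on with
  | empty => exact ⟨fun _ => ∅, by simp, by simp⟩
  | insert v S hv ih =>
    rw [Finset.disjoint_insert_right] at hd
    obtain ⟨F, h1, h2⟩ := ih hd.2
    have hvn : v ∉ L ∪ S := by simp [hd.1, hv]
    have hu : L ∪ insert v S = insert v (L ∪ S) := Finset.union_insert _ _ _
    refine ⟨Function.update F v ((L ∪ S).filter (G.Adj v)), ?_, ?_⟩
    · intro w hw
      rw [hu]
      by_cases hwv : w = v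
      · subst hwv
        rw [Function.update_self]
        exact Finset.filter_subset_filter _ (Finset.subset_insert _ _)
      · rw [Function.update_of_ne hwv]
        exact (h1 w (Finset.mem_of_mem_insert_of_ne hw hwv)).trans
          (Finset.filter_subset_filter _ (Finset.subset_insert _ _))
    · intro k
      rw [hu, cc_insert G hvn, h2, Finset.sum_insert hv, Function.update_self]
      have : ∑ w ∈ S, cc G k (Function.update F v ((L ∪ S).filter (G.Adj v)) w) =
          ∑ w ∈ S, cc G k (F w) := by
        apply Finset.sum_congr rfl
        intro w hw
        have hwv : w ≠ v := fun e => hv (e ▸ hw)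
        rw [Function.update_of_ne hwv]
      rw [this]
      omega

lemma GK (R : ℕ) : ∀ W : Finset V, cc G (R+2) W = 0 →
    ∀ k, d (R+1) (k+1) (cc G (k+1) W) ≤ cc G k W := by
  induction R with
  | zero =>
    intro W hW k
    rcases k with _ | k
    · rw [cc_zero]; exact d_k_one_le
    · rw [cc_eq_zero_of_le G hW (by omega), d_zero]; omega
  | succ R' ih =>
    intro W hW k
    rcases k with _ | k
    · rw [cc_zero]; exact d_k_one_le
    rcases Nat.eq_zero_or_pos (cc G (k+2) W) with h0 | hpos
    · rw [h0, d_zero]; omega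
    set R := R' + 1 with hRdef
    have hR : 1 ≤ R := by omega
    have hkR : k + 1 ≤ R := by
      by_contra! hlt
      have := cc_eq_zero_of_le G hW (show R + 2 ≤ k + 2 by omega)
      omega
    have hWne : W.Nonempty := by
      obtain ⟨s, hs⟩ := Finset.card_pos.1 hpos
      simp only [Finset.mem_filter, SimpleGraph.mem_cliqueFinset_iff] at hs
      have : s.Nonempty := by rw [← Finset.card_pos, hs.1.card_eq]; omega
      obtain ⟨x, hx⟩ := this
      exact ⟨x, hs.2 hx⟩
    obtain ⟨v0, hv0, hmax⟩ := Finset.exists_max_image W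
      (fun v => cc G (k+1) (W.filter (G.Adj v))) hWne
    set L := W.filter (G.Adj v0) with hL
    have hLW : L ⊆ W := Finset.filter_subset _ _
    obtain ⟨F, hF1, hF2⟩ := decomp G L (W \ L) Finset.disjoint_sdiff
    rw [Finset.union_sdiff_of_subset hLW] at hF1 hF2
    have hnb : ∀ v ∈ W, cc G (R+1) (W.filter (G.Adj v)) = 0 := fun v hv => by
      have := cc_nbr G (k := R+1) hv
      have h2 : cc G (R+1+1) W = 0 := hW
      omega
    have hL0 : cc G (R+1) L = 0 := hnb v0 hv0
    have hFL : ∀ v ∈ W \ L, cc G (k+1) (F v) ≤ cc G (k+1) L := fun v hv =>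
      (cc_mono G (hF1 v hv)).trans (hmax v (Finset.mem_sdiff.1 hv).1)
    have hF0 : ∀ v ∈ W \ L, cc G (R+1) (F v) = 0 := fun v hv => by
      have h1 := hnb v (Finset.mem_sdiff.1 hv).1
      have := cc_mono G (k := R+1) (hF1 v hv)
      omega
    let g : V → ℕ := fun v => (R+1) * (Fintype.equivFin V v).val + R
    have hg : Function.Injective g := by
      intro a b hab
      have h1 : (R+1) * (Fintype.equivFin V a).val = (R+1) * (Fintype.equivFin V b).val :=
        Nat.add_right_cancel hab
      have h2 := Nat.eq_of_mul_eq_mul_left (by omega) h1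
      exact (Fintype.equivFin V).injective (Fin.ext h2)
    let F' : ℕ → Finset (Finset ℕ) :=
      Function.extend g (fun v => J R R (k+1) (cc G (k+1) (F v))) (fun _ => ∅)
    have hF' : ∀ v, F' (g v) = J R R (k+1) (cc G (k+1) (F v)) := fun v => hg.extend_apply _ _ v
    have hcd : ConeData (R+1) R (k+1) ((W \ L).image g) (J R R (k+2) (cc G (k+2) L)) F' := by
      refine ⟨?_, (J_init hR le_rfl).1, ?_⟩
      · intro v hv
        obtain ⟨w, _, rfl⟩ := Finset.mem_image.1 hv
        simp only [g]
        rw [Nat.mul_add_mod, Nat.mod_eq_of_lt (by omega)]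
      · intro v hv
        obtain ⟨w, _, rfl⟩ := Finset.mem_image.1 hv
        rw [hF']
        exact (J_init hR le_rfl).1
    have hgood : ∀ m, Good R (k+1) m := good_of (by omega) hkR
    have hgood2 : Good R (k+2) (cc G (k+2) L) := by
      rcases Nat.lt_or_ge R (k+2) with h | h
      · rw [cc_eq_zero_of_le G hL0 (by omega)]; exact good_zero
      · exact good_of (by omega) h _
    have hcard : (cone ((W \ L).image g) (J R R (k+2) (cc G (k+2) L)) F').card =
        cc G (k+2) W := by
      rw [hcd.card, J_card hR hgood2, Finset.sum_image hg.injOn, hF2 (k+1)]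
      congr 1
      apply Finset.sum_congr rfl
      intro v _
      rw [hF', J_card hR (hgood _)]
    have hsh := hcd.shadow_le (K := J R R (k+1) (cc G (k+1) L)) (by
        apply (J_shadow_init hR le_rfl).subset (J_init hR le_rfl)
        rw [J_shadow_card hR, J_card hR (hgood _)]
        exact ih L hL0 (k+1)) (by
        intro v hv
        obtain ⟨w, hw, rfl⟩ := Finset.mem_image.1 hv
        rw [hF']
        apply (J_init hR le_rfl).subset (J_init hR le_rfl)
        rw [J_card hR (hgood _), J_card hR (hgood _)]
        exact hFL w hw)
    have hKK := KK_all (show 1 ≤ R + 1 by omega) (k+2) _ hcd.X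
    rw [hcard] at hKK
    refine hKK.trans (hsh.trans ?_)
    rw [J_card hR (hgood _), Finset.sum_image hg.injOn, hF2 k]
    refine Nat.add_le_add_left (Finset.sum_le_sum fun v hv => ?_) _
    rw [hF', J_shadow_card hR]
    exact ih (F v) (hF0 v hv) k

lemma cc_univ (k : ℕ) : cc G k Finset.univ = (G.cliqueFinset k).card := by
  rw [cc, Finset.filter_true_of_mem]
  intro s _
  exact Finset.subset_univ s

end graph

end Froh

namespace Froh
open Finset
open scoped FinsetFamily

lemma mem_I_one {r n x : ℕ} : {x} ∈ I r 1 n ↔ x < n := by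
  have hX : ∀ y, X r 1 {y} := fun y => ⟨by simp, by simp⟩
  have hfull : full r 1 n = (Finset.range n).image (fun y => ({y} : Finset ℕ)) := by
    ext s
    rw [mem_full]
    simp only [Finset.mem_image, Finset.mem_range]
    constructor
    · rintro ⟨h1, h2⟩
      obtain ⟨y, rfl⟩ := Finset.card_eq_one.1 h1.1
      exact ⟨y, h2 y (by simp), rfl⟩
    · rintro ⟨y, hy, rfl⟩
      exact ⟨hX y, by simpa using hy⟩
  have hT : T r 1 n = n := by
    rw [T, hfull, Finset.card_image_of_injective _ Finset.singleton_injective, Finset.card_range]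
  have := I_T (r := r) (k := 1) (n := n)
  rw [hT] at this
  rw [this, mem_full]
  constructor
  · rintro ⟨_, h⟩
    exact h x (by simp)
  · intro h
    exact ⟨hX x, by simpa using h⟩

lemma assemble {r : ℕ} (hr : 1 ≤ r) (f : ℕ → ℕ) (f0 : f 0 = 1)
    (hf : ∀ k, d r (k+1) (f (k+1)) ≤ f k) (hz : ∀ k, r < k → f k = 0) (hpos : 1 ≤ f r) :
    ∃ (n : ℕ) (C : Finset (Finset (Fin n))),
      IsSimplicialComplex C ∧ ComplexColorable C r ∧
        (∀ s ∈ C, s.card ≤ r) ∧ (∃ s ∈ C, s.card = r) ∧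
        ∀ i : ℕ, faceCount C i = f i := by
  classical
  have hgood : ∀ k, Good r k (f k) := by
    intro k
    rcases Nat.eq_zero_or_pos k with rfl | hk
    · rw [f0]; exact ⟨{∅}, by simp [X], rfl⟩
    rcases Nat.lt_or_ge r k with h | h
    · rw [hz k h]; exact good_zero
    · exact good_of hk h _
  have hcl1 : ∀ k, ∀ s ∈ I r (k+1) (f (k+1)), ∀ a ∈ s, s.erase a ∈ I r k (f k) := by
    intro k s hs a ha
    have hk := X_le hr (I_init.1 s hs)
    have h1 : s.erase a ∈ I r k (d r (k+1) (f (k+1))) := by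
      rw [← shadow_I hk]; exact Finset.erase_mem_shadow hs ha
    have hsub : I r k (d r (k+1) (f (k+1))) ⊆ I r k (f k) := by
      apply I_init.subset I_init
      rw [I_card (hgood k), I_card (good_of_le (hgood k) (hf k))]
      exact hf k
    exact hsub h1
  have hcl : ∀ k, ∀ s : Finset ℕ, s.card = k → s ∈ I r s.card (f s.card) → ∀ t ⊆ s,
      t ∈ I r t.card (f t.card) := by
    intro k
    induction k with
    | zero =>
      intro s hs hm t ht
      have h1 := Finset.card_eq_zero.1 hs
      subst h1
      rw [Finset.subset_empty.1 ht]; exact hm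
    | succ k ih =>
      intro s hs hm t ht
      by_cases hts : t = s
      · rw [hts]; exact hm
      obtain ⟨a, has, hat⟩ := Finset.exists_of_ssubset (lt_of_le_of_ne ht hts)
      have hc : (s.erase a).card = k := by rw [Finset.card_erase_of_mem has, hs]; rfl
      apply ih (s.erase a) hc
      · rw [hc]; rw [hs] at hm; exact hcl1 k s hm a has
      · exact Finset.subset_erase.2 ⟨ht, hat⟩
  let n := f 1
  have hlt : ∀ s : Finset ℕ, s ∈ I r s.card (f s.card) → ∀ x ∈ s, x < n := by
    intro s hs x hx
    have := hcl _ s rfl hs {x} (by simpa using hx)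
    rw [Finset.card_singleton] at this
    exact mem_I_one.1 this
  let C : Finset (Finset (Fin n)) := Finset.univ.filter
    (fun s => s.image Fin.val ∈ I r s.card (f s.card))
  have hinj : Function.Injective (fun s : Finset (Fin n) => s.image Fin.val) :=
    Finset.image_injective Fin.val_injective
  have hcard : ∀ s : Finset (Fin n), (s.image Fin.val).card = s.card := fun s =>
    Finset.card_image_of_injective _ Fin.val_injective
  have hmem : ∀ s : Finset (Fin n), s ∈ C ↔ s.image Fin.val ∈ I r s.card (f s.card) := by
    intro s; simp [C]
  have hX : ∀ s ∈ C, X r s.card (s.image Fin.val) := fun s hs => I_init.1 _ ((hmem s).1 hs)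
  have hcount : ∀ i, faceCount C i = f i := by
    intro i
    rw [faceCount, ← Finset.card_image_of_injective _ hinj]
    conv_rhs => rw [← I_card (hgood i)]
    congr 1
    ext t
    simp only [Finset.mem_image (f := fun s : Finset (Fin n) => s.image Fin.val),
      Finset.mem_filter]
    constructor
    · rintro ⟨s, ⟨hs, rfl⟩, rfl⟩
      exact (hmem s).1 hs
    · intro ht
      have htc : t.card = i := (I_init.1 t ht).1
      subst htc
      have h1 := hlt t ht
      have himg : (Finset.univ.filter (fun x : Fin n => x.val ∈ t)).image Fin.val = t := by
        ext x
        simp only [Finset.mem_image, Finset.mem_filter, Finset.mem_univ, true_and]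
        constructor
        · rintro ⟨y, hy, rfl⟩; exact hy
        · intro hx; exact ⟨⟨x, h1 x hx⟩, hx, rfl⟩
      have hc : (Finset.univ.filter (fun x : Fin n => x.val ∈ t)).card = t.card := by
        rw [← hcard, himg]
      exact ⟨_, ⟨(hmem _).2 (by rw [hc, himg]; exact ht), hc⟩, himg⟩
  refine ⟨n, C, ⟨?_, ?_, ?_⟩, ?_, ?_, ?_, hcount⟩
  · rw [hmem]
    obtain ⟨s, hs⟩ := Finset.card_pos.1 (show 0 < (I r 0 (f 0)).card by
      rw [I_card (hgood 0), f0]; omega)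
    have := (I_init.1 s hs).1
    rw [Finset.card_eq_zero] at this
    subst this
    simpa using hs
  · intro v
    rw [hmem, Finset.image_singleton, Finset.card_singleton]
    exact mem_I_one.2 v.2
  · intro s hs t ht
    rw [hmem] at hs ⊢
    have := hcl _ (s.image Fin.val) rfl (by rw [hcard]; exact hs) (t.image Fin.val)
      (Finset.image_subset_image ht)
    rwa [hcard] at this
  · refine ⟨fun x => ⟨x.val % r, Nat.mod_lt _ hr⟩, ?_⟩
    intro s hs x hx y hy hxy
    have h1 : x.val % r = y.val % r := congrArg Fin.val hxy
    exact Fin.ext ((hX s hs).2 x.val (Finset.mem_image_of_mem _ hx) y.val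
      (Finset.mem_image_of_mem _ hy) h1)
  · intro s hs
    exact X_le hr (hX s hs)
  · have := hcount r
    rw [faceCount] at this
    obtain ⟨s, hs⟩ := Finset.card_pos.1 (show 0 < (C.filter fun s => s.card = r).card by omega)
    exact ⟨s, (Finset.mem_filter.1 hs).1, (Finset.mem_filter.1 hs).2⟩

end Froh

/-- For any flag complex there is a balanced complex with the same face vector:
if `G` is a finite simple graph whose largest clique has exactly `r` vertices, then there is
a simplicial complex `C'` of dimension `r - 1` (i.e. whose largest face has exactly `r`
vertices) that is `r`-colorable and has `c_i(C') = c_i(G)` for all `i ≥ 0`. -/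
theorem exists_balanced_complex_same_face_vector
    {V : Type*} [Fintype V] [DecidableEq V] (G : SimpleGraph V) [DecidableRel G.Adj]
    (r : ℕ) (hG : G.CliqueFree (r + 1)) (hr : ∃ s : Finset V, G.IsNClique r s) :
    ∃ (n : ℕ) (C : Finset (Finset (Fin n))),
      IsSimplicialComplex C ∧ ComplexColorable C r ∧
        (∀ s ∈ C, s.card ≤ r) ∧ (∃ s ∈ C, s.card = r) ∧
        ∀ i : ℕ, faceCount C i = (G.cliqueFinset i).card := by
  have hz1 : Froh.cc G (r+1) Finset.univ = 0 := by
    rw [Froh.cc_univ, Finset.card_eq_zero, Finset.eq_empty_iff_forall_notMem]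
    intro s hs
    exact hG s (SimpleGraph.mem_cliqueFinset_iff.1 hs)
  have hz : ∀ k, r < k → (G.cliqueFinset k).card = 0 := by
    intro k hk
    rw [← Froh.cc_univ]
    exact Froh.cc_eq_zero_of_le G hz1 hk
  have h0 : (G.cliqueFinset 0).card = 1 := by rw [← Froh.cc_univ, Froh.cc_zero]
  rcases Nat.eq_zero_or_pos r with rfl | hr1
  · refine ⟨0, {∅}, ⟨by simp, fun v => v.elim0, ?_⟩, ⟨fun v => v.elim0, ?_⟩, ?_, ?_, ?_⟩
    · intro s hs t ht
      rw [Finset.mem_singleton] at hs ⊢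
      subst hs
      exact Finset.subset_empty.1 ht
    · intro s _ x
      exact x.elim0
    · intro s hs
      rw [Finset.mem_singleton.1 hs]; simp
    · exact ⟨∅, by simp, rfl⟩
    · intro i
      rcases Nat.eq_zero_or_pos i with rfl | hi
      · rw [h0]; rfl
      · rw [hz i hi, faceCount, Finset.card_eq_zero, Finset.eq_empty_iff_forall_notMem]
        intro s hs
        obtain ⟨h1, h2⟩ := Finset.mem_filter.1 hs
        rw [Finset.mem_singleton.1 h1, Finset.card_empty] at h2
        omega
  · obtain ⟨R, rfl⟩ : ∃ j, r = j + 1 := ⟨r - 1, by omega⟩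
    refine Froh.assemble hr1 (fun k => (G.cliqueFinset k).card) h0 ?_ hz ?_
    · intro k
      have := Froh.GK G R Finset.univ hz1 k
      rwa [Froh.cc_univ, Froh.cc_univ] at this
    · obtain ⟨s, hs⟩ := hr
      exact Finset.card_pos.2 ⟨s, SimpleGraph.mem_cliqueFinset_iff.2 hs⟩
end

section
/- If G is a finite simple graph with no clique on r+1 vertices and k is a nonnegative integer, then there is some r-colorable simplicial complex C with c_k(C) = c_k(G) and c_{k+1}(C) = c_{k+1}(G). -/
namespace FFK

/-- Binary code of a finite set of naturals; it realises the colexicographic order. -/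
def code (S : Finset ℕ) : ℕ := ∑ x ∈ S, 2 ^ x

/-- Rainbow `k`-sets using colors in `T`, the color of `x` being `x % r`. -/
def PS (r : ℕ) (T : Finset ℕ) (k : ℕ) (S : Finset ℕ) : Prop :=
  S.card = k ∧ (∀ x ∈ S, x % r ∈ T) ∧ ∀ x ∈ S, ∀ y ∈ S, x % r = y % r → x = y

/-- Colex-initial families of rainbow `k`-sets. -/
def Init (r : ℕ) (T : Finset ℕ) (k : ℕ) (I : Finset (Finset ℕ)) : Prop :=
  (∀ S ∈ I, PS r T k S) ∧ ∀ B ∈ I, ∀ A, PS r T k A → code A < code B → A ∈ I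

theorem code_insert {x : ℕ} {S : Finset ℕ} (h : x ∉ S) : code (insert x S) = 2 ^ x + code S := by
  unfold code; rw [Finset.sum_insert h]

theorem code_erase {x : ℕ} {S : Finset ℕ} (h : x ∈ S) : 2 ^ x + code (S.erase x) = code S := by
  unfold code; rw [Finset.add_sum_erase S (fun x => 2 ^ x) h]

theorem code_lt_iff {A B : Finset ℕ} :
    code A < code B ↔ ∃ a ∈ B, a ∉ A ∧ ∀ b ∈ A, b ∉ B → b < a := by
  unfold code
  rw [Finset.geomSum_lt_geomSum_iff_toColex_lt_toColex le_rfl,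
    Finset.Colex.toColex_lt_toColex_iff_exists_forall_lt]

theorem code_lt {A B : Finset ℕ} {m : ℕ} (hm : m ∈ B) (h : ∀ a ∈ A, a < m) : code A < code B :=
  code_lt_iff.2 ⟨m, hm, fun hA => lt_irrefl _ (h m hA), fun b hb _ => h b hb⟩

theorem code_inj {A B : Finset ℕ} (h : code A = code B) : A = B :=
  Finset.geomSum_injective (n := 2) le_rfl h

theorem code_swap {S : Finset ℕ} {b y : ℕ} (hb : b ∈ S) (hy : y ∉ S) (h : y < b) :
    code (insert y (S.erase b)) < code S := by
  rw [code_insert (by simp [hy]), ← code_erase hb]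
  have := Nat.pow_lt_pow_right (a := 2) (by norm_num) h
  omega

theorem code_swap' {S : Finset ℕ} {b y : ℕ} (hb : b ∈ S) (hy : y ∉ S) (h : b < y) :
    code S < code (insert y (S.erase b)) := by
  rw [code_insert (by simp [hy]), ← code_erase hb]
  have := Nat.pow_lt_pow_right (a := 2) (by norm_num) h
  omega

theorem Init.subset_or {r : ℕ} {T : Finset ℕ} {k : ℕ} {I J : Finset (Finset ℕ)}
    (hI : Init r T k I) (hJ : Init r T k J) : I ⊆ J ∨ J ⊆ I := by
  by_contra! h
  obtain ⟨h1, h2⟩ := h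
  obtain ⟨A, hA, hA'⟩ := Finset.not_subset.1 h1
  obtain ⟨B, hB, hB'⟩ := Finset.not_subset.1 h2
  rcases lt_trichotomy (code A) (code B) with h | h | h
  · exact hA' (hJ.2 B hB A (hI.1 A hA) h)
  · rw [code_inj h] at hA; exact hB' hA
  · exact hB' (hI.2 A hA B (hJ.1 B hB) h)

theorem Init.subset_of_card {r : ℕ} {T : Finset ℕ} {k : ℕ} {I J : Finset (Finset ℕ)}
    (hI : Init r T k I) (hJ : Init r T k J) (h : I.card ≤ J.card) : I ⊆ J := by
  rcases hI.subset_or hJ with h' | h'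
  · exact h'
  · rw [Finset.eq_of_subset_of_card_le h' h]

theorem PS.erase {r : ℕ} {T : Finset ℕ} {k : ℕ} {S : Finset ℕ} (h : PS r T (k + 1) S) {x : ℕ}
    (hx : x ∈ S) : PS r T k (S.erase x) := by
  refine ⟨by rw [Finset.card_erase_of_mem hx, h.1]; rfl, fun y hy => h.2.1 y (Finset.mem_of_mem_erase hy),
    fun y hy z hz => h.2.2 y (Finset.mem_of_mem_erase hy) z (Finset.mem_of_mem_erase hz)⟩

theorem PS.insert {r : ℕ} {T : Finset ℕ} {k : ℕ} {S : Finset ℕ} (h : PS r T k S) {x : ℕ}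
    (hxT : x % r ∈ T) (hx : ∀ y ∈ S, y % r ≠ x % r) : PS r T (k + 1) (insert x S) := by
  have hxS : x ∉ S := fun h => hx x h rfl
  refine ⟨by rw [Finset.card_insert_of_notMem hxS, h.1], ?_, ?_⟩
  · intro y hy
    rcases Finset.mem_insert.1 hy with rfl | hy
    · exact hxT
    · exact h.2.1 y hy
  · intro y hy z hz e
    rcases Finset.mem_insert.1 hy with hy' | hy' <;> rcases Finset.mem_insert.1 hz with hz' | hz'
    · rw [hy', hz']
    · subst hy'; exact absurd e.symm (hx z hz')
    · subst hz'; exact absurd e (hx y hy')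
    · exact h.2.2 y hy' z hz' e

theorem PS.swap {r : ℕ} {T : Finset ℕ} {k : ℕ} {S : Finset ℕ} (h : PS r T k S) {x b : ℕ}
    (hb : b ∈ S) (hxT : x % r ∈ T) (hx : ∀ y ∈ S, y ≠ b → y % r ≠ x % r) :
    PS r T k (Insert.insert x (S.erase b)) := by
  obtain ⟨j, rfl⟩ : ∃ j, k = j + 1 := ⟨k - 1, by
    have := Finset.card_pos.2 ⟨b, hb⟩; have := h.1; omega⟩
  exact (h.erase hb).insert hxT (fun y hy => hx y (Finset.mem_of_mem_erase hy) (Finset.ne_of_mem_erase hy))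

theorem PS.card_le {r : ℕ} {T : Finset ℕ} {k : ℕ} {S : Finset ℕ} (h : PS r T k S) :
    k ≤ T.card := by
  rw [← h.1, ← Finset.card_image_of_injOn (f := fun x => x % r) (s := S) (fun x hx y hy e => h.2.2 x hx y hy e)]
  apply Finset.card_le_card
  intro c hc
  obtain ⟨x, hx, rfl⟩ := Finset.mem_image.1 hc
  exact h.2.1 x hx

/-- If `k < |T|` some color is missing. -/
theorem PS.exists_missing {r : ℕ} {T : Finset ℕ} {k : ℕ} {S : Finset ℕ} (h : PS r T k S)
    (hk : k < T.card) : ∃ c ∈ T, ∀ x ∈ S, x % r ≠ c := by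
  by_contra! hc
  have : T ⊆ S.image (fun x => x % r) := fun c hcT => by
    obtain ⟨x, hx, e⟩ := hc c hcT
    exact Finset.mem_image.2 ⟨x, hx, e⟩
  have := (Finset.card_le_card this).trans Finset.card_image_le
  have := h.1
  omega

theorem PS.exists_of_full {r : ℕ} {T : Finset ℕ} {k : ℕ} {S : Finset ℕ} (h : PS r T k S)
    (hk : k = T.card) {c : ℕ} (hc : c ∈ T) : ∃ x ∈ S, x % r = c := by
  have h1 : S.image (fun x => x % r) = T := by
    apply Finset.eq_of_subset_of_card_le
    · intro c hc
      obtain ⟨x, hx, rfl⟩ := Finset.mem_image.1 hc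
      exact h.2.1 x hx
    · rw [Finset.card_image_of_injOn (f := fun x => x % r) (s := S) (fun x hx y hy e => h.2.2 x hx y hy e), h.1, hk]
  rw [← h1] at hc
  obtain ⟨x, hx, e⟩ := Finset.mem_image.1 hc
  exact ⟨x, hx, e⟩

theorem PS_shadow {r : ℕ} {T : Finset ℕ} {k : ℕ} {I : Finset (Finset ℕ)}
    (h : ∀ S ∈ I, PS r T (k + 1) S) : ∀ S ∈ I.shadow, PS r T k S := by
  intro S hS
  obtain ⟨B, hB, b, hb, rfl⟩ := Finset.mem_shadow_iff.1 hS
  exact (h B hB).erase hb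

theorem shadow_zero {r : ℕ} {T : Finset ℕ} {I : Finset (Finset ℕ)}
    (h : ∀ S ∈ I, PS r T 0 S) : I.shadow = ∅ := by
  apply Finset.eq_empty_of_forall_notMem
  intro S hS
  obtain ⟨B, hB, b, hb, rfl⟩ := Finset.mem_shadow_iff.1 hS
  have := Finset.card_eq_zero.1 (h B hB).1
  simp [this] at hb

theorem Init_zero {r : ℕ} {T : Finset ℕ} {I : Finset (Finset ℕ)}
    (h : ∀ S ∈ I, PS r T 0 S) : Init r T 0 I := by
  refine ⟨h, fun B hB A hA hAB => ?_⟩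
  rw [Finset.card_eq_zero.1 (h B hB).1, Finset.card_eq_zero.1 hA.1] at hAB
  exact absurd hAB (lt_irrefl _)

/-- The shadow of an initial family is initial. -/
theorem Init.shadow {r : ℕ} {T : Finset ℕ} (hT : ∀ c ∈ T, c < r) {k : ℕ} {I : Finset (Finset ℕ)}
    (hI : Init r T (k + 1) I) : Init r T k I.shadow := by
  refine ⟨PS_shadow hI.1, ?_⟩
  intro S hS S' hS' hlt
  obtain ⟨B, hB, b, hb, rfl⟩ := Finset.mem_shadow_iff.1 hS
  have hPB := hI.1 B hB
  have hk : k < T.card := hPB.card_le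
  obtain ⟨y, ⟨hyT, hyS⟩, hmin⟩ : ∃ y, (y ∈ T ∧ ∀ x ∈ S', x % r ≠ y) ∧
      ∀ c, (c ∈ T ∧ ∀ x ∈ S', x % r ≠ c) → y ≤ c := by
    have hex : ∃ y, (y ∈ T ∧ ∀ x ∈ S', x % r ≠ y) := hS'.exists_missing hk
    classical
    exact ⟨Nat.find hex, Nat.find_spec hex, fun c hc => Nat.find_min' hex hc⟩
  have hyr := hT y hyT
  have hymod : y % r = y := Nat.mod_eq_of_lt hyr
  have hyS' : y ∉ S' := fun h => hyS y h hymod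
  have hlow : ∀ c ∈ T, c < y → ∃ x ∈ S', x % r = c := by
    intro c hc hcy
    by_contra! h
    exact absurd (hmin c ⟨hc, h⟩) (by omega)
  have hP' : PS r T (k + 1) (Insert.insert y S') :=
    hS'.insert (by rwa [hymod]) (fun x hx => by rw [hymod]; exact hyS x hx)
  have key : code (Insert.insert y S') ≤ code B := by
    rw [code_insert hyS', ← code_erase hb]
    by_cases hyb : y ≤ b
    · have := Nat.pow_le_pow_right (n := 2) (by norm_num) hyb
      omega
    push Not at hyb
    by_cases hw : ∃ w ∈ B.erase b, w ∉ S' ∧ (∀ u ∈ S', u ∉ B.erase b → u < w) ∧ y < w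
    · obtain ⟨w, hw1, hw2, hw3, hw4⟩ := hw
      have : code (Insert.insert y S') < code (B.erase b) := by
        refine code_lt_iff.2 ⟨w, hw1, ?_, ?_⟩
        · simp only [Finset.mem_insert, not_or]; exact ⟨by omega, hw2⟩
        · intro u hu hu'
          rcases Finset.mem_insert.1 hu with rfl | hu
          · exact hw4
          · exact hw3 u hu hu'
      rw [code_insert hyS'] at this
      have := Nat.two_pow_pos b
      omega
    · push Not at hw
      obtain ⟨w, hw1, hw2, hw3⟩ := code_lt_iff.1 hlt
      have hwy := hw w hw1 hw2 hw3
      have hmem : ∀ x ∈ B, x < y → x ∈ S' ∨ ∃ u ∈ S', u ∉ B ∧ u ≥ r := by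
        intro x hx hxy
        have hxm : x % r = x := Nat.mod_eq_of_lt (by omega)
        obtain ⟨u, hu, e⟩ := hlow x (by have := hPB.2.1 x hx; rwa [hxm] at this) hxy
        by_cases hux : u = x
        · left; rwa [← hux]
        · right
          refine ⟨u, hu, fun huB => hux (hPB.2.2 u huB x hx (by rw [e, hxm])), ?_⟩
          by_contra! hur
          rw [Nat.mod_eq_of_lt hur] at e
          exact hux e
      have hno : ∀ u ∈ S', u ∉ B → u < r := by
        intro u hu huB
        have := hw3 u hu (fun h => huB (Finset.mem_of_mem_erase h))
        omega
      have hmem' : ∀ x ∈ B, x < y → x ∈ S' := by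
        intro x hx hxy
        rcases hmem x hx hxy with h | ⟨u, hu, h1, h2⟩
        · exact h
        · have := hno u hu h1; omega
      have hwy' : w = y := by
        rcases hwy.lt_or_eq with h | h
        · exact absurd (hmem' w (Finset.mem_of_mem_erase hw1) h) hw2
        · exact h
      have hsub : B ⊆ Insert.insert y S' := by
        intro x hx
        rcases lt_trichotomy x y with h | h | h
        · exact Finset.mem_insert_of_mem (hmem' x hx h)
        · simp [h]
        · apply Finset.mem_insert_of_mem
          by_contra hxS
          have := hw x (Finset.mem_erase.2 ⟨by omega, hx⟩) hxS (fun u hu hu' => by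
            have := hw3 u hu hu'; omega)
          omega
      have := Finset.eq_of_subset_of_card_le hsub (by rw [hP'.1, hPB.1])
      rw [code_erase hb, ← code_insert hyS', this]
  have : Insert.insert y S' ∈ I := by
    rcases key.lt_or_eq with h | h
    · exact hI.2 B hB _ hP' h
    · rw [code_inj h]; exact hB
  exact Finset.mem_shadow_iff_insert_mem.2 ⟨y, hyS', this⟩

/-- Total weight. -/
def wt (F : Finset (Finset ℕ)) : ℕ := ∑ S ∈ F, code S

theorem wt_init {r : ℕ} {T : Finset ℕ} {k : ℕ} {I F : Finset (Finset ℕ)} (hI : Init r T k I)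
    (hF : ∀ S ∈ F, PS r T k S) (hc : I.card = F.card) : wt I ≤ wt F ∧ (wt I = wt F → I = F) := by
  by_cases hsub : F ⊆ I
  · have := Finset.eq_of_subset_of_card_le hsub hc.le
    subst this
    exact ⟨le_rfl, fun _ => rfl⟩
  suffices wt I < wt F from ⟨this.le, fun h => absurd h this.ne⟩
  unfold wt
  rw [← Finset.sum_sdiff_lt_sum_sdiff]
  have hne : (F \ I).Nonempty := Finset.sdiff_nonempty.2 hsub
  obtain ⟨S0, hS0, hmin⟩ := Finset.exists_min_image (F \ I) code hne
  have hcard : (I \ F).card = (F \ I).card := by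
    have h1 := Finset.card_sdiff_add_card_inter I F
    have h2 := Finset.card_sdiff_add_card_inter F I
    rw [Finset.inter_comm] at h2
    omega
  have hS0' := Finset.mem_sdiff.1 hS0
  have h1 : ∑ S ∈ I \ F, code S < ∑ S ∈ I \ F, code S0 := by
    apply Finset.sum_lt_sum_of_nonempty
    · rw [← Finset.card_pos, hcard, Finset.card_pos]; exact hne
    · intro S hS
      have hS' := Finset.mem_sdiff.1 hS
      by_contra! h
      rcases h.lt_or_eq with h | h
      · exact hS0'.2 (hI.2 S hS'.1 S0 (hF S0 hS0'.1) h)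
      · exact hS0'.2 (code_inj h ▸ hS'.1)
  have h2 : ∑ S ∈ F \ I, code S0 ≤ ∑ S ∈ F \ I, code S := Finset.sum_le_sum hmin
  simp only [Finset.sum_const, hcard] at h1 h2
  omega

/-- Assemble a family from a base and links over vertices in `X`. -/
def asm (X : Finset ℕ) (J0 : Finset (Finset ℕ)) (J : ℕ → Finset (Finset ℕ)) :
    Finset (Finset ℕ) :=
  J0 ∪ X.biUnion fun x => (J x).image (insert x)

theorem mem_asm {X : Finset ℕ} {J0 : Finset (Finset ℕ)} {J : ℕ → Finset (Finset ℕ)}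
    {S : Finset ℕ} : S ∈ asm X J0 J ↔ S ∈ J0 ∨ ∃ x ∈ X, ∃ L ∈ J x, insert x L = S := by
  simp [asm]

/-- Sum over an assembled family. -/
theorem sum_asm {r c : ℕ} {X : Finset ℕ} {J0 : Finset (Finset ℕ)} {J : ℕ → Finset (Finset ℕ)}
    (hX : ∀ x ∈ X, x % r = c) (h0 : ∀ S ∈ J0, ∀ y ∈ S, y % r ≠ c)
    (h1 : ∀ x ∈ X, ∀ S ∈ J x, ∀ y ∈ S, y % r ≠ c) (f : Finset ℕ → ℕ) :
    ∑ S ∈ asm X J0 J, f S = ∑ S ∈ J0, f S + ∑ x ∈ X, ∑ S ∈ J x, f (insert x S) := by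
  unfold asm
  rw [Finset.sum_union, Finset.sum_biUnion]
  · congr 1
    apply Finset.sum_congr rfl
    intro x hx
    rw [Finset.sum_image]
    intro A hA B hB e
    have hxA : x ∉ A := fun h => h1 x hx A hA x h (hX x hx)
    have hxB : x ∉ B := fun h => h1 x hx B hB x h (hX x hx)
    have e' : insert x A = insert x B := e
    rw [← Finset.erase_insert hxA, e', Finset.erase_insert hxB]
  · intro x hx y hy hxy
    rw [Function.onFun, Finset.disjoint_left]
    intro S hS hS'
    obtain ⟨A, hA, rfl⟩ := Finset.mem_image.1 hS
    obtain ⟨B, hB, e⟩ := Finset.mem_image.1 hS'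
    have : x ∈ insert y B := by rw [e]; simp
    rcases Finset.mem_insert.1 this with h | h
    · exact hxy h
    · exact h1 y hy B hB x h (hX x hx)
  · rw [Finset.disjoint_left]
    intro S hS hS'
    obtain ⟨x, hx, hS'⟩ := Finset.mem_biUnion.1 hS'
    obtain ⟨A, hA, rfl⟩ := Finset.mem_image.1 hS'
    exact h0 _ hS x (by simp) (hX x hx)

theorem card_asm {r c : ℕ} {X : Finset ℕ} {J0 : Finset (Finset ℕ)} {J : ℕ → Finset (Finset ℕ)}
    (hX : ∀ x ∈ X, x % r = c) (h0 : ∀ S ∈ J0, ∀ y ∈ S, y % r ≠ c)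
    (h1 : ∀ x ∈ X, ∀ S ∈ J x, ∀ y ∈ S, y % r ≠ c) :
    (asm X J0 J).card = J0.card + ∑ x ∈ X, (J x).card := by
  simpa using sum_asm hX h0 h1 (fun _ => 1)

theorem wt_asm {r c : ℕ} {X : Finset ℕ} {J0 : Finset (Finset ℕ)} {J : ℕ → Finset (Finset ℕ)}
    (hX : ∀ x ∈ X, x % r = c) (h0 : ∀ S ∈ J0, ∀ y ∈ S, y % r ≠ c)
    (h1 : ∀ x ∈ X, ∀ S ∈ J x, ∀ y ∈ S, y % r ≠ c) :
    wt (asm X J0 J) = wt J0 + ∑ x ∈ X, ((J x).card * 2 ^ x + wt (J x)) := by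
  unfold wt
  rw [sum_asm hX h0 h1]
  congr 1
  apply Finset.sum_congr rfl
  intro x hx
  rw [← smul_eq_mul, ← Finset.sum_const, ← Finset.sum_add_distrib]
  apply Finset.sum_congr rfl
  intro S hS
  exact code_insert (fun h => h1 x hx S hS x h (hX x hx))

theorem PS.mono {r : ℕ} {T T' : Finset ℕ} (h : T' ⊆ T) {k : ℕ} {S : Finset ℕ} (hS : PS r T' k S) :
    PS r T k S := ⟨hS.1, fun x hx => h (hS.2.1 x hx), hS.2.2⟩

theorem PS.ne_color {r : ℕ} {T : Finset ℕ} {c k : ℕ} {S : Finset ℕ} (hS : PS r (T.erase c) k S) :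
    ∀ y ∈ S, y % r ≠ c := fun y hy => Finset.ne_of_mem_erase (hS.2.1 y hy)

theorem PS_asm {r c : ℕ} {T : Finset ℕ} (hc : c ∈ T) {k : ℕ}
    {X : Finset ℕ} {J0 : Finset (Finset ℕ)} {J : ℕ → Finset (Finset ℕ)}
    (hX : ∀ x ∈ X, x % r = c) (h0 : ∀ S ∈ J0, PS r (T.erase c) (k + 1) S)
    (h1 : ∀ x ∈ X, ∀ S ∈ J x, PS r (T.erase c) k S) :
    ∀ S ∈ asm X J0 J, PS r T (k + 1) S := by
  intro S hS
  rcases mem_asm.1 hS with h | ⟨x, hx, L, hL, rfl⟩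
  · exact (h0 S h).mono (Finset.erase_subset _ _)
  · refine ((h1 x hx L hL).mono (Finset.erase_subset _ _)).insert (by rwa [hX x hx]) ?_
    rw [hX x hx]
    exact (h1 x hx L hL).ne_color

/-- The shadow of an assembly of initial families. -/
theorem shadow_asm {r c : ℕ} {T : Finset ℕ} (hT : ∀ c ∈ T, c < r) {k : ℕ}
    {X : Finset ℕ} {J0 : Finset (Finset ℕ)} {J : ℕ → Finset (Finset ℕ)}
    (hX : ∀ x ∈ X, x % r = c) (h0 : Init r (T.erase c) (k + 1) J0)
    (h1 : ∀ x ∈ X, Init r (T.erase c) k (J x)) {N : ℕ} (hN0 : J0.shadow.card ≤ N)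
    (hN : ∀ x ∈ X, (J x).card ≤ N) :
    (asm X J0 J).shadow.card ≤ N + ∑ x ∈ X, (J x).shadow.card := by
  have hT' : ∀ d ∈ T.erase c, d < r := fun d hd => hT d (Finset.mem_of_mem_erase hd)
  -- a largest initial family
  obtain ⟨M, hM0, hM1, hMN⟩ : ∃ M : Finset (Finset ℕ), J0.shadow ⊆ M ∧ (∀ x ∈ X, J x ⊆ M) ∧
      M.card ≤ N := by
    by_cases hex : ∃ x ∈ X, J0.shadow.card ≤ (J x).card
    · obtain ⟨x0, hx0, hle⟩ := hex
      obtain ⟨x1, hx1, hmax⟩ := Finset.exists_max_image X (fun x => (J x).card) ⟨x0, hx0⟩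
      refine ⟨J x1, (h0.shadow hT').subset_of_card (h1 x1 hx1) (hle.trans (hmax x0 hx0)), ?_, hN x1 hx1⟩
      intro x hx
      exact (h1 x hx).subset_of_card (h1 x1 hx1) (hmax x hx)
    · push Not at hex
      exact ⟨J0.shadow, subset_rfl, fun x hx => (h1 x hx).subset_of_card (h0.shadow hT') (hex x hx).le, hN0⟩
  have hsub : (asm X J0 J).shadow ⊆ M ∪ X.biUnion fun x => ((J x).shadow).image (insert x) := by
    intro S hS
    obtain ⟨B, hB, b, hb, rfl⟩ := Finset.mem_shadow_iff.1 hS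
    rcases mem_asm.1 hB with h | ⟨x, hx, L, hL, rfl⟩
    · exact Finset.mem_union_left _ (hM0 (Finset.erase_mem_shadow h hb))
    · by_cases hbx : b = x
      · subst hbx
        apply Finset.mem_union_left
        have hbL : b ∉ L := fun h => ((h1 b hx).1 L hL).ne_color b h (hX b hx)
        rw [Finset.erase_insert hbL]; exact hM1 b hx hL
      · apply Finset.mem_union_right
        have hbL : b ∈ L := by
          rcases Finset.mem_insert.1 hb with h | h
          · exact absurd h hbx
          · exact h
        refine Finset.mem_biUnion.2 ⟨x, hx, Finset.mem_image.2 ⟨L.erase b, Finset.erase_mem_shadow hL hbL, ?_⟩⟩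
        rw [Finset.erase_insert_of_ne (Ne.symm hbx)]
  refine (Finset.card_le_card hsub).trans ((Finset.card_union_le _ _).trans ?_)
  refine Nat.add_le_add hMN (Finset.card_biUnion_le.trans ?_)
  exact Finset.sum_le_sum fun x _ => Finset.card_image_le

/-- Families of minimal weight among those of given size and at most given shadow. -/
def IsMin (r : ℕ) (T : Finset ℕ) (k : ℕ) (F : Finset (Finset ℕ)) : Prop :=
  (∀ S ∈ F, PS r T k S) ∧ ∀ F' : Finset (Finset ℕ), (∀ S ∈ F', PS r T k S) → F'.card = F.card →
    F'.shadow.card ≤ F.shadow.card → wt F ≤ wt F'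

def KK (r : ℕ) (T : Finset ℕ) : Prop :=
  ∀ k, ∀ F : Finset (Finset ℕ), (∀ S ∈ F, PS r T k S) →
    ∃ I, Init r T k I ∧ I.card = F.card ∧ I.shadow.card ≤ F.shadow.card

theorem IsMin.sections {r : ℕ} {T : Finset ℕ} (hT : ∀ c ∈ T, c < r) {k : ℕ}
    {F : Finset (Finset ℕ)} (hF : IsMin r T (k + 1) F) {c : ℕ} (hc : c ∈ T)
    (hKK : KK r (T.erase c)) :
    Init r (T.erase c) (k + 1) (F.filter fun S => ∀ y ∈ S, y % r ≠ c) ∧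
    ∀ x, x % r = c → (∃ S ∈ F, x ∈ S) →
      Init r (T.erase c) k ((F.filter fun S => x ∈ S).image fun S => S.erase x) := by
  classical
  set F0 := F.filter fun S => ∀ y ∈ S, y % r ≠ c with hF0
  set L : ℕ → Finset (Finset ℕ) := fun x => (F.filter fun S => x ∈ S).image fun S => S.erase x with hL
  set X : Finset ℕ := (F.biUnion id).filter fun x => x % r = c with hXdef
  have hX : ∀ x ∈ X, x % r = c := fun x hx => (Finset.mem_filter.1 hx).2
  have hP0 : ∀ S ∈ F0, PS r (T.erase c) (k + 1) S := by
    intro S hS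
    obtain ⟨hS, hSc⟩ := Finset.mem_filter.1 hS
    have := hF.1 S hS
    exact ⟨this.1, fun x hx => Finset.mem_erase.2 ⟨hSc x hx, this.2.1 x hx⟩, this.2.2⟩
  have hPL : ∀ x, x % r = c → ∀ S ∈ L x, PS r (T.erase c) k S := by
    intro x hx S hS
    obtain ⟨B, hB, rfl⟩ := Finset.mem_image.1 hS
    obtain ⟨hB, hxB⟩ := Finset.mem_filter.1 hB
    have h2 := (hF.1 B hB)
    have := h2.erase hxB
    refine ⟨this.1, fun y hy => Finset.mem_erase.2 ⟨?_, this.2.1 y hy⟩, this.2.2⟩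
    intro hyc
    exact Finset.ne_of_mem_erase hy (h2.2.2 y (Finset.mem_of_mem_erase hy) x hxB (by rw [hyc, hx]))
  have hFasm : F = asm X F0 L := by
    ext S
    rw [mem_asm]
    constructor
    · intro hS
      by_cases h : ∀ y ∈ S, y % r ≠ c
      · exact Or.inl (Finset.mem_filter.2 ⟨hS, h⟩)
      · push Not at h
        obtain ⟨y, hy, hyc⟩ := h
        refine Or.inr ⟨y, Finset.mem_filter.2 ⟨Finset.mem_biUnion.2 ⟨S, hS, hy⟩, hyc⟩, S.erase y, ?_, Finset.insert_erase hy⟩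
        exact Finset.mem_image.2 ⟨S, Finset.mem_filter.2 ⟨hS, hy⟩, rfl⟩
    · rintro (h | ⟨x, hx, A, hA, rfl⟩)
      · exact (Finset.mem_filter.1 h).1
      · obtain ⟨B, hB, rfl⟩ := Finset.mem_image.1 hA
        obtain ⟨hB, hxB⟩ := Finset.mem_filter.1 hB
        rwa [Finset.insert_erase hxB]
  obtain ⟨J0, hJ0, hJ0c, hJ0s⟩ := hKK (k + 1) F0 hP0
  have hJex : ∀ x, ∃ I, x % r = c → Init r (T.erase c) k I ∧ I.card = (L x).card ∧
      I.shadow.card ≤ (L x).shadow.card := by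
    intro x
    by_cases hx : x % r = c
    · obtain ⟨I, hI⟩ := hKK k (L x) (hPL x hx)
      exact ⟨I, fun _ => hI⟩
    · exact ⟨∅, fun h => absurd h hx⟩
  choose J hJ using hJex
  have a0 : ∀ S ∈ F0, ∀ y ∈ S, y % r ≠ c := fun S hS => (hP0 S hS).ne_color
  have a1 : ∀ x ∈ X, ∀ S ∈ L x, ∀ y ∈ S, y % r ≠ c := fun x hx S hS => (hPL x (hX x hx) S hS).ne_color
  have b0 : ∀ S ∈ J0, ∀ y ∈ S, y % r ≠ c := fun S hS => (hJ0.1 S hS).ne_color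
  have b1 : ∀ x ∈ X, ∀ S ∈ J x, ∀ y ∈ S, y % r ≠ c :=
    fun x hx S hS => ((hJ x (hX x hx)).1.1 S hS).ne_color
  set N0 := F0.shadow ∪ X.biUnion L with hN0
  have hshF : N0.card + ∑ x ∈ X, (L x).shadow.card ≤ F.shadow.card := by
    rw [← card_asm (r := r) (c := c) (X := X) (J0 := N0) (J := fun x => (L x).shadow) hX]
    · apply Finset.card_le_card
      intro S hS
      rcases mem_asm.1 hS with h | ⟨x, hx, A, hA, rfl⟩
      · rcases Finset.mem_union.1 h with h | h
        · exact Finset.shadow_mono (Finset.filter_subset _ _) h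
        · obtain ⟨x, hx, h⟩ := Finset.mem_biUnion.1 h
          obtain ⟨B, hB, rfl⟩ := Finset.mem_image.1 h
          obtain ⟨hB, hxB⟩ := Finset.mem_filter.1 hB
          exact Finset.erase_mem_shadow hB hxB
      · obtain ⟨B, hB, b, hb, rfl⟩ := Finset.mem_shadow_iff.1 hA
        have hxB : x ∉ B := fun h => a1 x hx B hB x h (hX x hx)
        have hmem : insert x B ∈ F := by
          rw [hFasm]; exact mem_asm.2 (Or.inr ⟨x, hx, B, hB, rfl⟩)
        have hne : x ≠ b := fun h => hxB (h ▸ hb)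
        rw [← Finset.erase_insert_of_ne hne]
        exact Finset.erase_mem_shadow hmem (Finset.mem_insert_of_mem hb)
    · intro S hS y hy
      rcases Finset.mem_union.1 hS with h | h
      · exact (PS_shadow hP0 S h).ne_color y hy
      · obtain ⟨x, hx, h⟩ := Finset.mem_biUnion.1 h
        exact a1 x hx S h y hy
    · intro x hx S hS y hy
      obtain ⟨B, hB, b, hb, rfl⟩ := Finset.mem_shadow_iff.1 hS
      exact a1 x hx B hB y (Finset.mem_of_mem_erase hy)
  have hsh' : (asm X J0 J).shadow.card ≤ N0.card + ∑ x ∈ X, (J x).shadow.card := by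
    apply shadow_asm hT hX hJ0 (fun x hx => (hJ x (hX x hx)).1)
    · exact hJ0s.trans (Finset.card_le_card Finset.subset_union_left)
    · intro x hx
      rw [(hJ x (hX x hx)).2.1]
      exact Finset.card_le_card ((Finset.subset_biUnion_of_mem L hx).trans Finset.subset_union_right)
  have hsum : ∑ x ∈ X, (J x).shadow.card ≤ ∑ x ∈ X, (L x).shadow.card :=
    Finset.sum_le_sum fun x hx => (hJ x (hX x hx)).2.2
  have hmin := hF.2 (asm X J0 J) (PS_asm hc hX hJ0.1 (fun x hx => (hJ x (hX x hx)).1.1)) (by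
    rw [card_asm hX b0 b1]
    conv_rhs => rw [hFasm]
    rw [card_asm hX a0 a1, hJ0c]
    congr 1
    exact Finset.sum_congr rfl fun x hx => (hJ x (hX x hx)).2.1) (by omega)
  rw [wt_asm hX b0 b1] at hmin
  conv_lhs at hmin => rw [hFasm]
  rw [wt_asm hX a0 a1] at hmin
  have w0 := wt_init hJ0 hP0 hJ0c
  have w1 : ∀ x ∈ X, (J x).card * 2 ^ x + wt (J x) ≤ (L x).card * 2 ^ x + wt (L x) := by
    intro x hx
    rw [(hJ x (hX x hx)).2.1]
    have := (wt_init (hJ x (hX x hx)).1 (hPL x (hX x hx)) (hJ x (hX x hx)).2.1).1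
    omega
  have w2 := Finset.sum_le_sum w1
  refine ⟨?_, ?_⟩
  · rw [← w0.2 (by have := w0.1; omega)]; exact hJ0
  · intro x hx hex
    obtain ⟨S, hS, hxS⟩ := hex
    have hxX : x ∈ X := Finset.mem_filter.2 ⟨Finset.mem_biUnion.2 ⟨S, hS, hxS⟩, hx⟩
    have heq := (Finset.sum_eq_sum_iff_of_le w1).1 (by have := w0.1; omega) x hxX
    rw [(hJ x hx).2.1] at heq
    have := (wt_init (hJ x hx).1 (hPL x hx) (hJ x hx).2.1).2 (by omega)
    change Init r (T.erase c) k (L x)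
    rw [← this]
    exact (hJ x hx).1

/-- Two sets are similar if they share a vertex or both miss a common color. -/
def Sim (r : ℕ) (T : Finset ℕ) (A B : Finset ℕ) : Prop :=
  (∃ x ∈ A, x ∈ B) ∨ ∃ c ∈ T, (∀ x ∈ A, x % r ≠ c) ∧ ∀ x ∈ B, x % r ≠ c

theorem IsMin.comp {r : ℕ} {T : Finset ℕ} (hT : ∀ c ∈ T, c < r) {k : ℕ}
    {F : Finset (Finset ℕ)} (hF : IsMin r T (k + 1) F)
    (hKK : ∀ c ∈ T, KK r (T.erase c)) {A B : Finset ℕ} (hA : PS r T (k + 1) A) (hB : B ∈ F)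
    (hs : Sim r T A B) (hlt : code A < code B) : A ∈ F := by
  rcases hs with ⟨x, hxA, hxB⟩ | ⟨c, hc, hcA, hcB⟩
  · have hc := hA.2.1 x hxA
    have h := (hF.sections hT hc (hKK _ hc)).2 x rfl ⟨B, hB, hxB⟩
    have hBm : B.erase x ∈ (F.filter fun S => x ∈ S).image fun S => S.erase x :=
      Finset.mem_image.2 ⟨B, Finset.mem_filter.2 ⟨hB, hxB⟩, rfl⟩
    have hAP := hA.erase hxA
    have := h.2 _ hBm (A.erase x) ⟨hAP.1, fun y hy => Finset.mem_erase.2 ⟨fun e =>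
      Finset.ne_of_mem_erase hy (hA.2.2 y (Finset.mem_of_mem_erase hy) x hxA e), hAP.2.1 y hy⟩, hAP.2.2⟩ (by
        have h1 := code_erase hxA
        have h2 := code_erase hxB
        omega)
    obtain ⟨S, hS, e⟩ := Finset.mem_image.1 this
    obtain ⟨hS, hxS⟩ := Finset.mem_filter.1 hS
    have e' : S.erase x = A.erase x := e
    rwa [← Finset.insert_erase hxA, ← e', Finset.insert_erase hxS]
  · have h := (hF.sections hT hc (hKK _ hc)).1
    have := h.2 B (Finset.mem_filter.2 ⟨hB, hcB⟩) A ⟨hA.1, fun x hx =>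
      Finset.mem_erase.2 ⟨hcA x hx, hA.2.1 x hx⟩, hA.2.2⟩ hlt
    exact (Finset.mem_filter.1 this).1

theorem IsMin.no_swap {r : ℕ} {T : Finset ℕ} {k : ℕ} {F : Finset (Finset ℕ)}
    (hF : IsMin r T k F) {A B : Finset ℕ} (hA : PS r T k A) (hAF : A ∉ F) (hB : B ∈ F)
    (hlt : code A < code B) : F.shadow.card < (insert A (F.erase B)).shadow.card := by
  by_contra! h
  have hA' : A ∉ F.erase B := fun h => hAF (Finset.mem_of_mem_erase h)
  have := hF.2 (insert A (F.erase B)) (by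
    intro S hS
    rcases Finset.mem_insert.1 hS with rfl | hS
    · exact hA
    · exact hF.1 S (Finset.mem_of_mem_erase hS)) (by
    rw [Finset.card_insert_of_notMem hA', Finset.card_erase_add_one hB]) h
  unfold wt at this
  rw [Finset.sum_insert hA', ← Finset.add_sum_erase F code hB] at this
  omega

/-- Vertices of `S` that are smallest possible for `S` without them. -/
def Good (r : ℕ) (T : Finset ℕ) (S : Finset ℕ) (a : ℕ) : Prop :=
  a ∈ S ∧ a < r ∧ ∀ c ∈ T, (∀ x ∈ S, x % r ≠ c) → a < c

theorem PS_fill {r : ℕ} {T : Finset ℕ} (hT : ∀ c ∈ T, c < r) {k : ℕ} {M : Finset ℕ}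
    (hM : PS r T k M) : PS r T T.card (M ∪ T.filter fun c => ∀ x ∈ M, x % r ≠ c) := by
  have hinj : ∀ x ∈ M ∪ T.filter (fun c => ∀ x ∈ M, x % r ≠ c), ∀ y ∈ M ∪ T.filter (fun c => ∀ x ∈ M, x % r ≠ c),
      x % r = y % r → x = y := by
    intro x hx y hy e
    rcases Finset.mem_union.1 hx with hx | hx <;> rcases Finset.mem_union.1 hy with hy | hy
    · exact hM.2.2 x hx y hy e
    · obtain ⟨hy, hy'⟩ := Finset.mem_filter.1 hy
      rw [Nat.mod_eq_of_lt (hT y hy)] at e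
      exact absurd e (hy' x hx)
    · obtain ⟨hx, hx'⟩ := Finset.mem_filter.1 hx
      rw [Nat.mod_eq_of_lt (hT x hx)] at e
      exact absurd e.symm (hx' y hy)
    · rwa [Nat.mod_eq_of_lt (hT x (Finset.mem_filter.1 hx).1),
        Nat.mod_eq_of_lt (hT y (Finset.mem_filter.1 hy).1)] at e
  have hcol : ∀ x ∈ M ∪ T.filter (fun c => ∀ x ∈ M, x % r ≠ c), x % r ∈ T := by
    intro x hx
    rcases Finset.mem_union.1 hx with hx | hx
    · exact hM.2.1 x hx
    · have hx := (Finset.mem_filter.1 hx).1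
      rwa [Nat.mod_eq_of_lt (hT x hx)]
  refine ⟨?_, hcol, hinj⟩
  rw [← Finset.card_image_of_injOn (f := fun x => x % r) (fun x hx y hy e => hinj x hx y hy e)]
  congr 1
  ext c
  constructor
  · intro hc
    obtain ⟨x, hx, rfl⟩ := Finset.mem_image.1 hc
    exact hcol x hx
  · intro hc
    by_cases h : ∀ x ∈ M, x % r ≠ c
    · exact Finset.mem_image.2 ⟨c, Finset.mem_union_right _ (Finset.mem_filter.2 ⟨hc, h⟩),
        Nat.mod_eq_of_lt (hT c hc)⟩
    · push Not at h
      obtain ⟨x, hx, e⟩ := h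
      exact Finset.mem_image.2 ⟨x, Finset.mem_union_left _ hx, e⟩

theorem IsMin.init {r : ℕ} {T : Finset ℕ} (hT : ∀ c ∈ T, c < r) {k : ℕ}
    {F : Finset (Finset ℕ)} (hF : IsMin r T k F) (hKK : ∀ c ∈ T, KK r (T.erase c)) :
    Init r T k F := by
  classical
  refine ⟨hF.1, ?_⟩
  by_contra! hcon
  obtain ⟨B1, hB1, A1, hA1, hlt1, hA1F⟩ := hcon
  have hk0 : k ≠ 0 := by
    rintro rfl
    rw [Finset.card_eq_zero.1 (hF.1 B1 hB1).1, Finset.card_eq_zero.1 hA1.1] at hlt1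
    exact lt_irrefl _ hlt1
  obtain ⟨j, rfl⟩ := Nat.exists_eq_succ_of_ne_zero hk0
  -- minimal non-member
  obtain ⟨A, hA, hAF, hAmin⟩ : ∃ A, PS r T (j + 1) A ∧ A ∉ F ∧
      ∀ S, PS r T (j + 1) S → S ∉ F → code A ≤ code S := by
    have hex : ∃ n, ∃ A, PS r T (j + 1) A ∧ A ∉ F ∧ code A = n := ⟨_, A1, hA1, hA1F, rfl⟩
    obtain ⟨A, h1, h2, h3⟩ := Nat.find_spec hex
    exact ⟨A, h1, h2, fun S hS hSF => h3 ▸ Nat.find_min' hex ⟨S, hS, hSF, rfl⟩⟩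
  -- maximal member
  obtain ⟨B, hB, hBmax⟩ := Finset.exists_max_image F code ⟨B1, hB1⟩
  have hlt : code A < code B := (hAmin A1 hA1 hA1F).trans_lt (hlt1.trans_le (hBmax B1 hB1))
  have hPB := hF.1 B hB
  have hbelow : ∀ S, PS r T (j + 1) S → code S < code A → S ∈ F := by
    intro S hS hSA
    by_contra h
    exact absurd (hAmin S hS h) (by omega)
  have comp := fun {A B : Finset ℕ} => hF.comp hT hKK (A := A) (B := B)
  have hnot : ∀ C, PS r T (j + 1) C → Sim r T C B → code C < code B → Sim r T A C →
      code A < code C → False := by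
    intro C hC h1 h2 h3 h4
    exact hAF (comp hA (comp hC hB h1 h2) h3 h4)
  have hnsim : ¬ Sim r T A B := fun h => hAF (comp hA hB h hlt)
  have hdisj : ∀ x ∈ A, x ∉ B := fun x hx hx' => hnsim (Or.inl ⟨x, hx, hx'⟩)
  have hcov : ∀ c ∈ T, (∀ x ∈ A, x % r ≠ c) → ∃ b ∈ B, b % r = c := by
    intro c hc h
    by_contra! h'
    exact hnsim (Or.inr ⟨c, hc, h, h'⟩)
  rcases Nat.eq_zero_or_pos j with rfl | hj
  · -- singletons
    refine absurd (hF.no_swap hA hAF hB hlt) (not_lt.2 ?_)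
    have h1 : (insert A (F.erase B)).shadow ⊆ {∅} := by
      intro S hS
      have := PS_shadow (r := r) (T := T) (k := 0) (I := insert A (F.erase B)) (by
        intro S hS
        rcases Finset.mem_insert.1 hS with rfl | hS
        · exact hA
        · exact hF.1 S (Finset.mem_of_mem_erase hS)) S hS
      simpa using this.1
    refine (Finset.card_le_card h1).trans ?_
    simp only [Finset.card_singleton]
    obtain ⟨b, hb⟩ := Finset.card_pos.1 (by rw [hPB.1]; norm_num : 0 < B.card)
    exact Finset.card_pos.2 ⟨_, Finset.erase_mem_shadow hB hb⟩
  have hBne : B.Nonempty := Finset.card_pos.1 (by rw [hPB.1]; omega)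
  obtain ⟨m, hm, hmax⟩ : ∃ m ∈ B, ∀ b ∈ B, b ≤ m :=
    ⟨B.max' hBne, B.max'_mem hBne, fun b hb => B.le_max' b hb⟩
  have hAm : ∀ x ∈ A, x < m := by
    intro x hx
    by_contra! h
    have hne : x ≠ m := fun e => hdisj x hx (e ▸ hm)
    have := code_lt hx (fun b hb => lt_of_le_of_lt (hmax b hb) (lt_of_le_of_ne h hne.symm))
    omega
  have hnot' : ∀ C, PS r T (j + 1) C → m ∈ C → code C < code B → Sim r T A C → False :=
    fun C hC hmC h2 h3 => hnot C hC (Or.inl ⟨m, hmC, hm⟩) h2 h3 (code_lt hmC hAm)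
  -- shadow facts
  have hshA : ∀ a ∈ A, ¬ Good r T A a → A.erase a ∈ (F.erase B).shadow := by
    intro a ha hng
    obtain ⟨y, hya, hyT, hyc⟩ : ∃ y, y < a ∧ y % r ∈ T ∧ ∀ x ∈ A, x ≠ a → x % r ≠ y % r := by
      by_cases har : a < r
      · have : ∃ c ∈ T, (∀ x ∈ A, x % r ≠ c) ∧ c ≤ a := by
          by_contra! h
          exact hng ⟨ha, har, fun c hc h' => h c hc h'⟩
        obtain ⟨c, hc, h1, h2⟩ := this
        have hcm : c % r = c := Nat.mod_eq_of_lt (hT c hc)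
        refine ⟨c, lt_of_le_of_ne h2 ?_, by rwa [hcm], fun x hx _ => by rw [hcm]; exact h1 x hx⟩
        rintro rfl
        exact h1 c ha hcm
      · have hr : 0 < r := (Nat.zero_le _).trans_lt (hT _ (hA.2.1 a ha))
        have hmr := Nat.mod_lt a hr
        refine ⟨a % r, by omega, by rw [Nat.mod_mod]; exact hA.2.1 a ha, fun x hx hxa e => ?_⟩
        rw [Nat.mod_mod] at e
        exact hxa (hA.2.2 x hx a ha e)
    have hyA : y ∉ A := fun h => hyc y h hya.ne rfl
    have hP := hA.swap ha hyT hyc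
    have hl := code_swap ha hyA hya
    refine Finset.mem_shadow_iff_insert_mem.2 ⟨y, by simp [hyA], Finset.mem_erase.2 ⟨?_, hbelow _ hP hl⟩⟩
    intro e
    rw [e] at hl
    omega
  have hshB : ∀ b, Good r T B b → B.erase b ∉ (F.erase B).shadow := by
    intro b hb h
    obtain ⟨y, hy, hyF⟩ := Finset.mem_shadow_iff_insert_mem.1 h
    obtain ⟨hyne, hyF⟩ := Finset.mem_erase.1 hyF
    have hyb : y ≠ b := by
      rintro rfl
      exact hyne (Finset.insert_erase hb.1)
    have hyB : y ∉ B := fun h => hy (Finset.mem_erase.2 ⟨hyb, h⟩)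
    have hPy := hF.1 _ hyF
    have hby : b < y := by
      by_cases hyc : ∀ x ∈ B, x % r ≠ y % r
      · exact (hb.2.2 _ (hPy.2.1 y (by simp)) hyc).trans_le (Nat.mod_le _ _)
      · push Not at hyc
        obtain ⟨x, hx, e⟩ := hyc
        have hxb : x = b := by
          by_contra hxb
          have := hPy.2.2 x (by simp [hx, hxb]) y (by simp) e
          exact hyB (this ▸ hx)
        rw [hxb, Nat.mod_eq_of_lt hb.2.1] at e
        have := Nat.mod_le y r
        omega
    have h1 := code_swap' hb.1 hyB hby
    have h2 := hBmax _ hyF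
    omega
  have hswap : ∀ a b, (∀ a', Good r T A a' → a' = a) → Good r T B b → False := by
    intro a b ha hb
    refine absurd (hF.no_swap hA hAF hB hlt) (not_lt.2 ?_)
    have hsub : (insert A (F.erase B)).shadow ⊆ insert (A.erase a) (F.shadow.erase (B.erase b)) := by
      intro S hS
      have : S = A.erase a ∨ S ∈ (F.erase B).shadow := by
        obtain ⟨C, hC, x, hx, rfl⟩ := Finset.mem_shadow_iff.1 hS
        rcases Finset.mem_insert.1 hC with rfl | hC
        · by_cases hg : Good r T C x
          · left; rw [ha x hg]
          · right; exact hshA x hx hg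
        · right; exact Finset.erase_mem_shadow hC hx
      rcases this with rfl | h
      · simp
      · refine Finset.mem_insert_of_mem (Finset.mem_erase.2 ⟨?_, Finset.shadow_mono (Finset.erase_subset _ _) h⟩)
        rintro rfl
        exact hshB b hb h
    refine (Finset.card_le_card hsub).trans ((Finset.card_insert_le _ _).trans ?_)
    rw [Finset.card_erase_add_one (Finset.erase_mem_shadow hB hb.1)]
  -- a good vertex of A exists
  obtain ⟨a, haG⟩ : ∃ a, Good r T A a := by
    by_contra! hno
    refine absurd (hF.no_swap hA hAF hB hlt) (not_lt.2 (Finset.card_le_card ?_))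
    intro S hS
    obtain ⟨C, hC, x, hx, rfl⟩ := Finset.mem_shadow_iff.1 hS
    rcases Finset.mem_insert.1 hC with rfl | hC
    · exact Finset.shadow_mono (Finset.erase_subset _ _) (hshA x hx (hno x))
    · exact Finset.erase_mem_shadow (Finset.mem_of_mem_erase hC) hx
  have hgood1 : ∀ a, Good r T A a → ∀ b ∈ B, b ≠ m → (∀ x ∈ B, x ≠ b → x % r ≠ a) → b < a := by
    intro a ha b hb hbm hx
    by_contra! h
    have ham : a % r = a := Nat.mod_eq_of_lt ha.2.1
    have haB := hdisj a ha.1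
    have hab : a < b := lt_of_le_of_ne h (fun e => haB (e ▸ hb))
    refine hnot' (insert a (B.erase b)) (hPB.swap hb (hA.2.1 a ha.1) (by rwa [ham])) ?_
      (code_swap hb haB hab) (Or.inl ⟨a, ha.1, by simp⟩)
    exact Finset.mem_insert_of_mem (Finset.mem_erase.2 ⟨Ne.symm hbm, hm⟩)
  have hgood2 : ∀ a, Good r T A a → ∀ b ∈ B, b % r = a → b = m := by
    intro a ha b hb hba
    by_contra hbm
    have := hgood1 a ha b hb hbm (fun x hx hxb e => hxb (hPB.2.2 x hx b hb (by rw [e, hba])))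
    have := Nat.mod_le b r
    omega
  have hgood3 : ∀ a, Good r T A a → m % r = a := by
    intro a ha
    by_contra hma
    have haB : ∀ x ∈ B, x % r ≠ a := by
      intro x hx e
      have := hgood2 a ha x hx e
      exact hma (this ▸ e)
    have hBlt : ∀ b ∈ B, b ≠ m → b < a := fun b hb hbm => hgood1 a ha b hb hbm (fun x hx _ => haB x hx)
    have haT : a ∈ T := by
      have := hA.2.1 a ha.1
      rwa [Nat.mod_eq_of_lt ha.2.1] at this
    -- every color missing from A is the color of m
    have hmissA : ∀ e ∈ T, (∀ x ∈ A, x % r ≠ e) → e = m % r := by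
      intro e he hmiss
      obtain ⟨b, hb, hbe⟩ := hcov e he hmiss
      by_cases hbm : b = m
      · rw [← hbe, hbm]
      · have h1 := hBlt b hb hbm
        have h2 := ha.2.2 e he hmiss
        have := Nat.mod_le b r
        omega
    have hcardT : j + 1 < T.card := by
      have hP := hPB.insert (x := a) (by rwa [Nat.mod_eq_of_lt ha.2.1])
        (by rw [Nat.mod_eq_of_lt ha.2.1]; exact haB)
      have := hP.card_le
      omega
    obtain ⟨e0, he0, hmiss0⟩ := hA.exists_missing hcardT
    have he0m := hmissA e0 he0 hmiss0
    -- |T| = j + 2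
    have hTle : T.card ≤ j + 2 := by
      have hsub : T ⊆ insert (m % r) (A.image fun x => x % r) := by
        intro c hc
        by_cases h : ∀ x ∈ A, x % r ≠ c
        · simp [hmissA c hc h]
        · push Not at h
          obtain ⟨x, hx, e⟩ := h
          exact Finset.mem_insert_of_mem (Finset.mem_image.2 ⟨x, hx, e⟩)
      have h1 := (Finset.card_le_card hsub).trans (Finset.card_insert_le _ _)
      have h2 : (A.image fun x => x % r).card ≤ A.card := Finset.card_image_le
      have := hA.1
      omega
    -- so B misses only a
    have hmissB : ∀ c ∈ T, (∀ x ∈ B, x % r ≠ c) → c = a := by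
      intro c hc hmiss
      by_contra hca
      have ham : a % r = a := Nat.mod_eq_of_lt ha.2.1
      have hcm : c % r = c := Nat.mod_eq_of_lt (hT c hc)
      have hP := (hPB.insert (x := a) (by rwa [ham]) (by rw [ham]; exact haB)).insert (x := c)
        (by rwa [hcm]) (by
          intro y hy
          rw [hcm]
          rcases Finset.mem_insert.1 hy with rfl | hy
          · rw [ham]; exact Ne.symm hca
          · exact hmiss y hy)
      have := hP.card_le
      omega
    obtain ⟨b, hb⟩ : (B.erase m).Nonempty :=
      Finset.card_pos.1 (by rw [Finset.card_erase_of_mem hm, hPB.1]; omega)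
    obtain ⟨hbm, hbB⟩ := Finset.mem_erase.1 hb
    have hba := hBlt b hbB hbm
    refine hswap a b ?_ ⟨hbB, hba.trans ha.2.1, fun c hc hmiss => by rw [hmissB c hc hmiss]; exact hba⟩
    intro a' ha'
    have ha'T : a' % r = a' := Nat.mod_eq_of_lt ha'.2.1
    refine hmissB a' (by have := hA.2.1 a' ha'.1; rwa [ha'T] at this) ?_
    intro x hx e
    have hxm := hgood2 a' ha' x hx e
    subst hxm
    exact hmiss0 a' ha'.1 (by rw [ha'T, he0m, e])
  have huniq : ∀ a', Good r T A a' → a' = a := fun a' ha' => by rw [← hgood3 a' ha', hgood3 a haG]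
  have hnoB : ∀ b, ¬ Good r T B b := fun b hb => hswap a b huniq hb
  have hma := hgood3 a haG
  have ham : a % r = a := Nat.mod_eq_of_lt haG.2.1
  have haT : a ∈ T := by
    have := hA.2.1 a haG.1
    rwa [ham] at this
  have hr : 0 < r := (Nat.zero_le _).trans_lt (hT a haT)
  rcases (hA.card_le).lt_or_eq with hcard | hcard
  · -- some colors are missing
    obtain ⟨e, he, hmissA⟩ := hA.exists_missing hcard
    obtain ⟨b, hb, hbe⟩ := hcov e he hmissA
    have hbm : b ≠ m := by
      rintro rfl
      exact hmissA a haG.1 (by rw [ham, ← hbe, hma])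
    have hle : ∀ e' ∈ T, (∀ x ∈ B, x % r ≠ e') → b ≤ e' := by
      intro e' he' hmissB
      by_contra! h
      have hem : e' % r = e' := Nat.mod_eq_of_lt (hT e' he')
      have heB : e' ∉ B := fun h => hmissB e' h hem
      refine hnot' (insert e' (B.erase b)) (hPB.swap hb (by rwa [hem])
        (fun y hy _ => by rw [hem]; exact hmissB y hy)) ?_ (code_swap hb heB h) (Or.inr ⟨e, he, hmissA, ?_⟩)
      · exact Finset.mem_insert_of_mem (Finset.mem_erase.2 ⟨Ne.symm hbm, hm⟩)
      · intro x hx hxe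
        rcases Finset.mem_insert.1 hx with rfl | hx
        · rw [hem] at hxe
          exact hmissB b hb (by rw [hbe, hxe])
        · exact Finset.ne_of_mem_erase hx (hPB.2.2 x (Finset.mem_of_mem_erase hx) b hb (by rw [hxe, hbe]))
    obtain ⟨e', he', hmissB⟩ := hPB.exists_missing hcard
    have hbr : b < r := (hle e' he' hmissB).trans_lt (hT e' he')
    refine hnoB b ⟨hb, hbr, fun c hc hmiss => lt_of_le_of_ne (hle c hc hmiss) ?_⟩
    rintro rfl
    exact hmiss b hb (Nat.mod_eq_of_lt hbr)
  · -- all colors are used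
    have hBr : ∀ b ∈ B, r ≤ b := by
      intro b hb
      by_contra! h
      refine hnoB b ⟨hb, h, fun c hc hmiss => ?_⟩
      obtain ⟨x, hx, e⟩ := hPB.exists_of_full hcard hc
      exact absurd e (hmiss x hx)
    have haA := haG.1
    have hcA : ∀ z ∈ A, z ≠ a → z % r ≠ a := fun z hz hza e =>
      hza (hA.2.2 z hz a haA (by rw [e, ham]))
    have hPm : PS r T 1 {m} := by
      refine ⟨by simp, fun x hx => ?_, fun x hx y hy _ => ?_⟩
      · rw [Finset.mem_singleton.1 hx]; exact hPB.2.1 m hm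
      · rw [Finset.mem_singleton.1 hx, Finset.mem_singleton.1 hy]
    have hz3 : ∀ z ∈ A, z ≠ a → ∀ b ∈ B, b ≠ m → b < z := by
      intro z hz hza b hb hbm
      by_contra! h
      have hzb : z < b := lt_of_le_of_ne h (fun e => hdisj z hz (e ▸ hb))
      have hPM : PS r T 2 (insert z {m}) := hPm.insert (hA.2.1 z hz) (fun y hy => by
        rw [Finset.mem_singleton.1 hy, hma]; exact Ne.symm (hcA z hz hza))
      have hPC := PS_fill hT hPM
      rw [← hcard] at hPC
      refine hnot' _ hPC (by simp) ?_ (Or.inl ⟨z, hz, by simp⟩)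
      rw [← code_erase hm, ← code_erase (S := _ ∪ _) (x := m) (by simp)]
      apply Nat.add_lt_add_left
      apply code_lt (m := b) (Finset.mem_erase.2 ⟨hbm, hb⟩)
      intro x hx
      obtain ⟨hxm, hx⟩ := Finset.mem_erase.1 hx
      rcases Finset.mem_union.1 hx with hx | hx
      · rcases Finset.mem_insert.1 hx with rfl | hx
        · exact hzb
        · exact absurd (Finset.mem_singleton.1 hx) hxm
      · exact (hT x (Finset.mem_filter.1 hx).1).trans_le (hBr b hb)
    obtain ⟨z1, hz1⟩ : (B.erase m).Nonempty :=
      Finset.card_pos.1 (by rw [Finset.card_erase_of_mem hm, hPB.1]; omega)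
    obtain ⟨hz1m, hz1B⟩ := Finset.mem_erase.1 hz1
    have hz1c : z1 % r ≠ a := fun e => hz1m (hPB.2.2 z1 hz1B m hm (by rw [e, hma]))
    obtain ⟨z', hz'A, hz'c⟩ := hA.exists_of_full hcard (hPB.2.1 z1 hz1B)
    have hz'a : z' ≠ a := by
      rintro rfl
      exact hz1c (by rw [← hz'c, ham])
    have hzz := hz3 z' hz'A hz'a z1 hz1B hz1m
    have hz'm := hAm z' hz'A
    have hdiv : z1 / r < m / r := by
      have h1 := Nat.div_add_mod z1 r
      have h2 := Nat.div_add_mod z' r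
      have h3 : z1 / r < z' / r := by
        by_contra! h
        have := Nat.mul_le_mul_left r h
        omega
      exact h3.trans_le (Nat.div_le_div_right hz'm.le)
    have hym : ∀ i ≤ z1 / r, a + r * i < m := by
      intro i hi
      have h1 := Nat.div_add_mod m r
      have := Nat.mul_lt_mul_of_pos_left (hi.trans_lt hdiv) hr
      omega
    set R : ℕ → Finset ℕ := fun i => insert (z1 % r + r * i) (B.erase z1) with hR
    set Y : ℕ → Finset ℕ := fun i => insert (a + r * i) (A.erase a) with hY
    have hmodw : ∀ i, (z1 % r + r * i) % r = z1 % r := fun i => by simp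
    have hmody : ∀ i, (a + r * i) % r = a := fun i => by simp [ham]
    have hwB : ∀ i, z1 % r + r * i ∉ B.erase z1 := by
      intro i h
      obtain ⟨h1, h2⟩ := Finset.mem_erase.1 h
      exact h1 (hPB.2.2 _ h2 z1 hz1B (hmodw i))
    have hyA : ∀ i, a + r * i ∉ A.erase a := by
      intro i h
      obtain ⟨h1, h2⟩ := Finset.mem_erase.1 h
      exact hcA _ h2 h1 (hmody i)
    have hRm : ∀ i, m ∈ R i := fun i =>
      Finset.mem_insert_of_mem (Finset.mem_erase.2 ⟨Ne.symm hz1m, hm⟩)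
    have hRP : ∀ i, PS r T (j + 1) (R i) := fun i =>
      (hPB.erase hz1B).insert (by rw [hmodw]; exact hPB.2.1 z1 hz1B) (fun y hy => by
        rw [hmodw]
        intro e
        exact Finset.ne_of_mem_erase hy (hPB.2.2 y (Finset.mem_of_mem_erase hy) z1 hz1B e))
    have hYP : ∀ i, PS r T (j + 1) (Y i) := fun i =>
      (hA.erase haA).insert (by rw [hmody]; exact haT) (fun y hy => by
        rw [hmody]
        exact hcA y (Finset.mem_of_mem_erase hy) (Finset.ne_of_mem_erase hy))
    have hRF : ∀ i ≤ z1 / r, R i ∈ F := by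
      intro i hi
      have hle : code (R i) ≤ code B := by
        have h1 := Nat.mod_add_div z1 r
        have h2 := Nat.mul_le_mul_left r hi
        rw [hR, code_insert (hwB i), ← code_erase hz1B]
        have := Nat.pow_le_pow_right (n := 2) (by norm_num) (show z1 % r + r * i ≤ z1 by omega)
        omega
      rcases hle.lt_or_eq with h | h
      · exact comp (hRP i) hB (Or.inl ⟨m, hRm i, hm⟩) h
      · rw [code_inj h]; exact hB
    obtain ⟨x0, hx0⟩ : (A.erase a).Nonempty :=
      Finset.card_pos.1 (by rw [Finset.card_erase_of_mem haA, hA.1]; omega)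
    have hYF : ∀ i, Y i ∉ F := by
      intro i h
      have hle : code A ≤ code (Y i) := by
        rw [hY, code_insert (hyA i), ← code_erase haA]
        have := Nat.pow_le_pow_right (n := 2) (by norm_num) (show a ≤ a + r * i by omega)
        omega
      rcases hle.lt_or_eq with h' | h'
      · exact hAF (comp hA h (Or.inl ⟨x0, Finset.mem_of_mem_erase hx0, Finset.mem_insert_of_mem hx0⟩) h')
      · exact hAF (code_inj h' ▸ h)
    have hYm : ∀ i ≤ z1 / r, ∀ x ∈ Y i, x < m := by
      intro i hi x hx
      rcases Finset.mem_insert.1 hx with rfl | hx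
      · exact hym i hi
      · exact hAm x (Finset.mem_of_mem_erase hx)
    have hRinj : Function.Injective R := by
      intro i i' e
      have h1 : z1 % r + r * i ∈ R i' := by rw [← e]; simp [hR]
      rcases Finset.mem_insert.1 h1 with h | h
      · exact Nat.eq_of_mul_eq_mul_left hr (by omega)
      · exact absurd h (hwB i)
    have hYinj : Function.Injective Y := by
      intro i i' e
      have h1 : a + r * i ∈ Y i' := by rw [← e]; simp [hY]
      rcases Finset.mem_insert.1 h1 with h | h
      · exact Nat.eq_of_mul_eq_mul_left hr (by omega)
      · exact absurd h (hyA i)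
    set n := z1 / r + 1 with hn
    set Rs := (Finset.range n).image R with hRs
    set Ys := (Finset.range n).image Y with hYs
    have hRsF : Rs ⊆ F := by
      intro S hS
      obtain ⟨i, hi, rfl⟩ := Finset.mem_image.1 hS
      exact hRF i (by have := Finset.mem_range.1 hi; omega)
    have hdisjY : Disjoint (F \ Rs) Ys := by
      rw [Finset.disjoint_left]
      intro S hS hS'
      obtain ⟨i, hi, rfl⟩ := Finset.mem_image.1 hS'
      exact hYF i (Finset.mem_sdiff.1 hS).1
    have hcR : Rs.card = n := by rw [hRs, Finset.card_image_of_injective _ hRinj, Finset.card_range]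
    have hcY : Ys.card = n := by rw [hYs, Finset.card_image_of_injective _ hYinj, Finset.card_range]
    have hwt : wt ((F \ Rs) ∪ Ys) < wt F := by
      unfold wt
      rw [Finset.sum_union hdisjY, ← Finset.sum_sdiff hRsF]
      apply Nat.add_lt_add_left
      rw [hYs, hRs, Finset.sum_image (fun x _ y _ e => hYinj e), Finset.sum_image (fun x _ y _ e => hRinj e)]
      apply Finset.sum_lt_sum_of_nonempty ⟨0, by simp [hn]⟩
      intro i hi
      exact code_lt (hRm i) (hYm i (by have := Finset.mem_range.1 hi; omega))
    have hSstar : B.erase z1 ∈ F.shadow := Finset.erase_mem_shadow hB hz1B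
    have hlost : B.erase z1 ∉ (F \ Rs).shadow := by
      intro h
      obtain ⟨w, hw, hwF⟩ := Finset.mem_shadow_iff_insert_mem.1 h
      obtain ⟨hwF, hwR⟩ := Finset.mem_sdiff.1 hwF
      have hPw := hF.1 _ hwF
      have hwc : w % r = z1 % r := by
        obtain ⟨u, hu, e⟩ := hPw.exists_of_full hcard (hPB.2.1 z1 hz1B)
        rcases Finset.mem_insert.1 hu with rfl | hu
        · exact e
        · exact absurd (hPB.2.2 u (Finset.mem_of_mem_erase hu) z1 hz1B e) (Finset.ne_of_mem_erase hu)
      have hwz : w ≤ z1 := by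
        by_contra! h
        have hwB' : w ∉ B := fun h' => hw (Finset.mem_erase.2 ⟨by omega, h'⟩)
        have h1 := code_swap' hz1B hwB' h
        have h2 := hBmax _ hwF
        omega
      apply hwR
      refine Finset.mem_image.2 ⟨w / r, Finset.mem_range.2 ?_, ?_⟩
      · have := Nat.div_le_div_right (c := r) hwz
        omega
      · simp only [hR]
        rw [← hwc, Nat.mod_add_div]
    -- a set in F through m and all low vertices
    have hCm := PS_fill hT hPm
    rw [← hcard] at hCm
    set C0 := ({m} : Finset ℕ) ∪ T.filter (fun c => ∀ x ∈ ({m} : Finset ℕ), x % r ≠ c) with hC0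
    have hmC : m ∈ C0 := by simp [hC0]
    have hC0F : C0 ∈ F := by
      refine comp hCm hB (Or.inl ⟨m, hmC, hm⟩) ?_
      rw [← code_erase hm, ← code_erase hmC]
      apply Nat.add_lt_add_left
      apply code_lt (m := z1) hz1
      intro x hx
      obtain ⟨hxm, hx⟩ := Finset.mem_erase.1 hx
      rcases Finset.mem_union.1 hx with hx | hx
      · exact absurd (Finset.mem_singleton.1 hx) hxm
      · exact (hT x (Finset.mem_filter.1 hx).1).trans_le (hBr z1 hz1B)
    have hYsh : ∀ i ≤ z1 / r, ∀ x ∈ A.erase a, (Y i).erase x ∈ F.shadow := by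
      intro i hi x hx
      have hxY : x ∈ Y i := Finset.mem_insert_of_mem hx
      have hxA := Finset.mem_of_mem_erase hx
      have hxT := hA.2.1 x hxA
      have hD := (hYP i).swap (x := x % r) hxY (by rwa [Nat.mod_mod]) (fun y hy hyx e => by
        rw [Nat.mod_mod] at e
        exact hyx ((hYP i).2.2 y hy x hxY e))
      have hxC : x % r ∈ C0 := by
        refine Finset.mem_union_right _ (Finset.mem_filter.2 ⟨hxT, fun y hy => ?_⟩)
        rw [Finset.mem_singleton.1 hy, hma]
        exact Ne.symm (hcA x hxA (Finset.ne_of_mem_erase hx))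
      have hDF : insert (x % r) ((Y i).erase x) ∈ F := by
        refine comp hD hC0F (Or.inl ⟨x % r, by simp, hxC⟩) (code_lt hmC ?_)
        intro y hy
        rcases Finset.mem_insert.1 hy with rfl | hy
        · exact (Nat.mod_le _ _).trans_lt (hAm x hxA)
        · exact hYm i hi y (Finset.mem_of_mem_erase hy)
      refine Finset.mem_shadow_iff_insert_mem.2 ⟨x % r, ?_, hDF⟩
      intro h
      obtain ⟨h1, h2⟩ := Finset.mem_erase.1 h
      exact h1 ((hYP i).2.2 _ h2 x hxY (Nat.mod_mod _ _))
    have hsub : ((F \ Rs) ∪ Ys).shadow ⊆ insert (A.erase a) (F.shadow.erase (B.erase z1)) := by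
      intro S hS
      obtain ⟨C, hC, x, hx, rfl⟩ := Finset.mem_shadow_iff.1 hS
      rcases Finset.mem_union.1 hC with hC | hC
      · have h := Finset.erase_mem_shadow hC hx
        refine Finset.mem_insert_of_mem (Finset.mem_erase.2 ⟨?_, Finset.shadow_mono Finset.sdiff_subset h⟩)
        intro e
        exact hlost (e ▸ h)
      · obtain ⟨i, hi, rfl⟩ := Finset.mem_image.1 hC
        have hi' : i ≤ z1 / r := by have := Finset.mem_range.1 hi; omega
        by_cases hxy : x = a + r * i
        · subst hxy
          simp only [hY]
          rw [Finset.erase_insert (hyA i)]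
          simp
        · have hxA : x ∈ A.erase a := by
            rcases Finset.mem_insert.1 hx with h | h
            · exact absurd h hxy
            · exact h
          refine Finset.mem_insert_of_mem (Finset.mem_erase.2 ⟨?_, hYsh i hi' x hxA⟩)
          intro e
          have : m ∈ (Y i).erase x := by rw [e]; exact Finset.mem_erase.2 ⟨Ne.symm hz1m, hm⟩
          exact lt_irrefl _ (hYm i hi' m (Finset.mem_of_mem_erase this))
    have hmin := hF.2 ((F \ Rs) ∪ Ys) (by
      intro S hS
      rcases Finset.mem_union.1 hS with hS | hS
      · exact hF.1 S (Finset.mem_sdiff.1 hS).1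
      · obtain ⟨i, hi, rfl⟩ := Finset.mem_image.1 hS
        exact hYP i) (by
      rw [Finset.card_union_of_disjoint hdisjY, hcY, ← hcR]
      exact Finset.card_sdiff_add_card_eq_card hRsF) (by
      refine (Finset.card_le_card hsub).trans ((Finset.card_insert_le _ _).trans ?_)
      rw [Finset.card_erase_add_one hSstar])
    omega

theorem kk_all {r : ℕ} : ∀ n, ∀ T : Finset ℕ, T.card = n → (∀ c ∈ T, c < r) → KK r T := by
  intro n
  induction n with
  | zero =>
    intro T hTn hT k F hF
    have hT0 : T = ∅ := Finset.card_eq_zero.1 hTn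
    subst hT0
    refine ⟨F, ⟨hF, fun B hB A hA hAB => ?_⟩, rfl, le_rfl⟩
    have hB0 := (hF B hB).card_le
    simp only [Finset.card_empty, Nat.le_zero] at hB0
    subst hB0
    exact (Init_zero hF).2 B hB A hA hAB
  | succ n ih =>
    intro T hTn hT k F hF
    have hKK : ∀ c ∈ T, KK r (T.erase c) := fun c hc =>
      ih (T.erase c) (by rw [Finset.card_erase_of_mem hc, hTn]; rfl)
        (fun d hd => hT d (Finset.mem_of_mem_erase hd))
    classical
    have hex : ∃ w, ∃ F' : Finset (Finset ℕ), (∀ S ∈ F', PS r T k S) ∧ F'.card = F.card ∧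
        F'.shadow.card ≤ F.shadow.card ∧ wt F' = w := ⟨_, F, hF, rfl, le_rfl, rfl⟩
    obtain ⟨F1, h1, h2, h3, h4⟩ := Nat.find_spec hex
    have hmin : IsMin r T k F1 := ⟨h1, fun F' g1 g2 g3 => by
      rw [h4]
      exact Nat.find_min' hex ⟨F', g1, g2.trans h2, g3.trans h3, rfl⟩⟩
    exact ⟨F1, hmin.init hT hKK, h2, h3⟩

/-- Number of `k`-cliques inside `W`. -/
def cl {V : Type*} [Fintype V] [DecidableEq V] (G : SimpleGraph V) [DecidableRel G.Adj]
    (W : Finset V) (k : ℕ) : ℕ := ((G.cliqueFinset k).filter fun s => s ⊆ W).card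

/-- Number of `k-1`-cliques inside `W` (zero if `k = 0`). -/
def clp {V : Type*} [Fintype V] [DecidableEq V] (G : SimpleGraph V) [DecidableRel G.Adj]
    (W : Finset V) : ℕ → ℕ
  | 0 => 0
  | k + 1 => cl G W k

theorem cl_zero {V : Type*} [Fintype V] [DecidableEq V] (G : SimpleGraph V) [DecidableRel G.Adj]
    (W : Finset V) : cl G W 0 = 1 := by
  unfold cl
  rw [Finset.card_eq_one]
  refine ⟨∅, ?_⟩
  ext s
  simp only [Finset.mem_filter, SimpleGraph.mem_cliqueFinset_iff, Finset.mem_singleton]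
  constructor
  · rintro ⟨h, _⟩
    exact Finset.card_eq_zero.1 h.card_eq
  · rintro rfl
    exact ⟨⟨by simp, rfl⟩, by simp⟩

theorem cl_mono {V : Type*} [Fintype V] [DecidableEq V] (G : SimpleGraph V) [DecidableRel G.Adj]
    {W W' : Finset V} (h : W ⊆ W') (k : ℕ) : cl G W k ≤ cl G W' k := by
  apply Finset.card_le_card
  intro s hs
  obtain ⟨h1, h2⟩ := Finset.mem_filter.1 hs
  exact Finset.mem_filter.2 ⟨h1, h2.trans h⟩

theorem cl_insert {V : Type*} [Fintype V] [DecidableEq V] (G : SimpleGraph V) [DecidableRel G.Adj]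
    {W : Finset V} {b : V} (hb : b ∉ W) (k : ℕ) :
    cl G (insert b W) k = cl G W k + clp G (W.filter fun x => G.Adj b x) k := by
  cases k with
  | zero => simp [cl_zero, clp]
  | succ k =>
    simp only [clp]
    unfold cl
    have himg : (((G.cliqueFinset k).filter fun s => s ⊆ W.filter fun x => G.Adj b x).image
        (insert b)).card = ((G.cliqueFinset k).filter fun s => s ⊆ W.filter fun x => G.Adj b x).card := by
      apply Finset.card_image_of_injOn
      intro s hs t ht e
      have hs' : b ∉ s := fun h => hb (Finset.mem_filter.1 ((Finset.mem_filter.1 hs).2 h)).1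
      have ht' : b ∉ t := fun h => hb (Finset.mem_filter.1 ((Finset.mem_filter.1 ht).2 h)).1
      have e' : insert b s = insert b t := e
      rw [← Finset.erase_insert hs', e', Finset.erase_insert ht']
    rw [← himg, ← Finset.card_union_of_disjoint]
    · congr 1
      ext s
      simp only [Finset.mem_filter, SimpleGraph.mem_cliqueFinset_iff, Finset.mem_union, Finset.mem_image]
      constructor
      · rintro ⟨hs, hsW⟩
        by_cases hbs : b ∈ s
        · right
          refine ⟨s.erase b, ⟨by simpa using hs.erase_of_mem hbs, ?_⟩, Finset.insert_erase hbs⟩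
          intro x hx
          obtain ⟨hxb, hx⟩ := Finset.mem_erase.1 hx
          refine Finset.mem_filter.2 ⟨?_, hs.isClique hbs hx (Ne.symm hxb)⟩
          rcases Finset.mem_insert.1 (hsW hx) with h | h
          · exact absurd h hxb
          · exact h
        · left
          exact ⟨hs, (Finset.subset_insert_iff_of_notMem hbs).1 hsW⟩
      · rintro (⟨hs, hsW⟩ | ⟨t, ⟨ht, htW⟩, rfl⟩)
        · exact ⟨hs, hsW.trans (Finset.subset_insert _ _)⟩
        · refine ⟨ht.insert fun x hx => (Finset.mem_filter.1 (htW hx)).2, ?_⟩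
          exact Finset.insert_subset_insert _ (htW.trans (Finset.filter_subset _ _))
    · rw [Finset.disjoint_left]
      intro s hs hs'
      obtain ⟨t, ht, rfl⟩ := Finset.mem_image.1 hs'
      exact hb ((Finset.mem_filter.1 hs).2 (by simp))

theorem graph_main {r : ℕ} {V : Type*} [Fintype V] [DecidableEq V] (G : SimpleGraph V)
    [DecidableRel G.Adj] : ∀ n, ∀ T : Finset ℕ, T.card = n → (∀ c ∈ T, c < r) →
    ∀ W : Finset V, cl G W (n + 1) = 0 → ∀ k, ∃ I, Init r T k I ∧ I.card = cl G W k ∧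
      I.shadow.card ≤ clp G W k := by
  intro n
  induction n with
  | zero =>
    intro T hTn hT W hW k
    have hW0 : W = ∅ := by
      by_contra hne
      obtain ⟨v, hv⟩ := Finset.nonempty_iff_ne_empty.2 hne
      refine absurd hW (Nat.pos_iff_ne_zero.1 (Finset.card_pos.2 ⟨{v}, Finset.mem_filter.2 ⟨?_, by simpa⟩⟩))
      rw [SimpleGraph.mem_cliqueFinset_iff]
      exact ⟨by simp, rfl⟩
    cases k with
    | zero =>
      have h0 : ∀ S ∈ ({∅} : Finset (Finset ℕ)), PS r T 0 S := by
        intro S hS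
        rw [Finset.mem_singleton.1 hS]
        exact ⟨rfl, by simp, by simp⟩
      refine ⟨{∅}, Init_zero h0, by simp [cl_zero], by rw [shadow_zero h0]; simp⟩
    | succ k =>
      refine ⟨∅, ⟨by simp, by simp⟩, ?_, by simp⟩
      subst hW0
      symm
      rw [Finset.card_empty]
      apply Finset.card_eq_zero.2
      apply Finset.eq_empty_of_forall_notMem
      intro s hs
      obtain ⟨h1, h2⟩ := Finset.mem_filter.1 hs
      rw [SimpleGraph.mem_cliqueFinset_iff] at h1
      have := h1.card_eq
      rw [Finset.subset_empty.1 h2] at this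
      simp at this
  | succ n ih =>
    intro T hTn hT W hW k
    cases k with
    | zero =>
      have h0 : ∀ S ∈ ({∅} : Finset (Finset ℕ)), PS r T 0 S := by
        intro S hS
        rw [Finset.mem_singleton.1 hS]
        exact ⟨rfl, by simp, by simp⟩
      refine ⟨{∅}, Init_zero h0, by simp [cl_zero], by rw [shadow_zero h0]; simp⟩
    | succ k =>
      rcases W.eq_empty_or_nonempty with rfl | hWne
      · refine ⟨∅, ⟨by simp, by simp⟩, ?_, by simp⟩
        symm
        rw [Finset.card_empty]
        apply Finset.card_eq_zero.2
        apply Finset.eq_empty_of_forall_notMem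
        intro s hs
        obtain ⟨h1, h2⟩ := Finset.mem_filter.1 hs
        rw [SimpleGraph.mem_cliqueFinset_iff] at h1
        have := h1.card_eq
        rw [Finset.subset_empty.1 h2] at this
        simp at this
      obtain ⟨c, hc⟩ : T.Nonempty := Finset.card_pos.1 (by omega)
      have hcr := hT c hc
      have hTe : (T.erase c).card = n := by rw [Finset.card_erase_of_mem hc, hTn]; rfl
      have hTe' : ∀ d ∈ T.erase c, d < r := fun d hd => hT d (Finset.mem_of_mem_erase hd)
      -- links have no large clique
      have hlink : ∀ b ∈ W, ∀ U ⊆ W, cl G (U.filter fun x => G.Adj b x) (n + 1) = 0 := by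
        intro b hb U hU
        have h1 : b ∉ U.erase b := by simp
        have h2 := cl_insert G h1 (n + 1 + 1)
        have h3 := cl_mono G (show insert b (U.erase b) ⊆ W from by
          intro x hx
          rcases Finset.mem_insert.1 hx with rfl | hx
          · exact hb
          · exact hU (Finset.mem_of_mem_erase hx)) (n + 1 + 1)
        have h4 : (U.erase b).filter (fun x => G.Adj b x) = U.filter fun x => G.Adj b x := by
          ext x
          simp only [Finset.mem_filter, Finset.mem_erase]
          constructor
          · rintro ⟨⟨_, h⟩, h'⟩; exact ⟨h, h'⟩
          · rintro ⟨h, h'⟩; exact ⟨⟨h'.ne', h⟩, h'⟩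
        rw [h4] at h2
        simp only [clp] at h2
        omega
      obtain ⟨v, hv, hvmax⟩ := Finset.exists_max_image W
        (fun b => cl G (W.filter fun x => G.Adj b x) k) hWne
      set N := W.filter fun x => G.Adj v x with hN
      have hNW : N ⊆ W := Finset.filter_subset _ _
      have hpeel : ∀ B' : Finset V, B' ⊆ W \ N → ∃ (X : Finset ℕ) (J : ℕ → Finset (Finset ℕ)),
          (∀ x ∈ X, x % r = c) ∧ (∀ x ∈ X, Init r (T.erase c) k (J x)) ∧
          (∀ x ∈ X, (J x).card ≤ cl G N k) ∧
          cl G (N ∪ B') (k + 1) = cl G N (k + 1) + ∑ x ∈ X, (J x).card ∧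
          cl G N k + ∑ x ∈ X, (J x).shadow.card ≤ cl G (N ∪ B') k := by
        intro B'
        induction B' using Finset.induction_on with
        | empty => intro _; exact ⟨∅, fun _ => ∅, by simp, by simp, by simp, by simp, by simp⟩
        | insert b B' hbB' ihB =>
          intro hsub
          obtain ⟨X, J, h1, h2, h3, h4, h5⟩ := ihB ((Finset.subset_insert _ _).trans hsub)
          have hbW := Finset.mem_sdiff.1 (hsub (Finset.mem_insert_self b B'))
          have hU : N ∪ B' ⊆ W := Finset.union_subset hNW fun x hx =>
            (Finset.mem_sdiff.1 (hsub (Finset.mem_insert_of_mem hx))).1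
          have hbU : b ∉ N ∪ B' := by
            simp only [Finset.mem_union, not_or]; exact ⟨hbW.2, hbB'⟩
          obtain ⟨I, hI, hIc, hIs⟩ := ih (T.erase c) hTe hTe'
            ((N ∪ B').filter fun x => G.Adj b x) (hlink b hbW.1 _ hU) k
          -- a fresh vertex of color c
          set y := c + r * (X.sup id + 1) with hy
          have hyX : y ∉ X := by
            intro h
            have h' : y ≤ X.sup id := Finset.le_sup (f := id) h
            have : X.sup id + 1 ≤ r * (X.sup id + 1) := Nat.le_mul_of_pos_left _ (by omega)
            omega
          have hne : ∀ x ∈ X, x ≠ y := fun x hx e => hyX (e ▸ hx)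
          have hupd : ∀ x ∈ X, Function.update J y I x = J x := fun x hx =>
            Function.update_of_ne (hne x hx) _ _
          have hself : Function.update J y I y = I := Function.update_self _ _ _
          have hs1 : ∑ x ∈ X, (Function.update J y I x).card = ∑ x ∈ X, (J x).card :=
            Finset.sum_congr rfl fun x hx => by rw [hupd x hx]
          have hs2 : ∑ x ∈ X, (Function.update J y I x).shadow.card = ∑ x ∈ X, (J x).shadow.card :=
            Finset.sum_congr rfl fun x hx => by rw [hupd x hx]
          refine ⟨insert y X, Function.update J y I, ?_, ?_, ?_, ?_, ?_⟩
          · intro x hx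
            rcases Finset.mem_insert.1 hx with rfl | hx
            · simp [hy, Nat.mod_eq_of_lt hcr]
            · exact h1 x hx
          · intro x hx
            rcases Finset.mem_insert.1 hx with rfl | hx
            · rw [hself]; exact hI
            · rw [hupd x hx]; exact h2 x hx
          · intro x hx
            rcases Finset.mem_insert.1 hx with rfl | hx
            · rw [hself, hIc]
              exact (cl_mono G (Finset.filter_subset_filter _ hU) k).trans (hvmax b hbW.1)
            · rw [hupd x hx]; exact h3 x hx
          · rw [Finset.union_insert, cl_insert G hbU, h4, Finset.sum_insert hyX, hself,
              hs1, hIc]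
            simp only [clp]
            omega
          · rw [Finset.union_insert, cl_insert G hbU, Finset.sum_insert hyX, hself,
              hs2]
            omega
      obtain ⟨X, J, h1, h2, h3, h4, h5⟩ := hpeel (W \ N) subset_rfl
      rw [Finset.union_sdiff_of_subset hNW] at h4 h5
      obtain ⟨J0, hJ0, hJ0c, hJ0s⟩ := ih (T.erase c) hTe hTe' N (hlink v hv W subset_rfl) (k + 1)
      simp only [clp] at hJ0s
      obtain ⟨I, hI, hIc, hIs⟩ := kk_all (r := r) _ T rfl hT (k + 1) (asm X J0 J)
        (PS_asm hc h1 hJ0.1 fun x hx => (h2 x hx).1)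
      refine ⟨I, hI, ?_, ?_⟩
      · rw [hIc, card_asm h1 (fun S hS => (hJ0.1 S hS).ne_color)
          (fun x hx S hS => ((h2 x hx).1 S hS).ne_color), hJ0c, h4]
      · exact hIs.trans ((shadow_asm hT h1 hJ0 h2 hJ0s h3).trans h5)

end FFK

theorem exists_colorable_complex_two_face_numbers
    {V : Type*} [Fintype V] [DecidableEq V] (G : SimpleGraph V) [DecidableRel G.Adj]
    (r k : ℕ) (hG : G.CliqueFree (r + 1)) :
    ∃ (n : ℕ) (C : Finset (Finset (Fin n))),
      IsSimplicialComplex C ∧ ComplexColorable C r ∧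
        faceCount C k = (G.cliqueFinset k).card ∧
        faceCount C (k + 1) = (G.cliqueFinset (k + 1)).card := by
  classical
  have hcl : ∀ i, FFK.cl G Finset.univ i = (G.cliqueFinset i).card := by
    intro i; unfold FFK.cl; congr 1; ext s; simp
  have hT : ∀ c ∈ Finset.range r, c < r := fun c hc => Finset.mem_range.1 hc
  have hfree : FFK.cl G Finset.univ (r + 1) = 0 := by
    rw [hcl, (SimpleGraph.cliqueFinset_eq_empty_iff).2 hG]; rfl
  have hm := FFK.graph_main (r := r) G r (Finset.range r) (by simp) hT Finset.univ hfree
  obtain ⟨I, hI, hIc, hIs⟩ := hm (k + 1)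
  obtain ⟨I', hI', hIc', -⟩ := hm k
  rw [hcl] at hIc hIc'
  simp only [FFK.clp, hcl] at hIs
  have hsub : I.shadow ⊆ I' := (hI.shadow hT).subset_of_card hI' (by omega)
  -- the complex on ℕ
  set K : Finset (Finset ℕ) := insert ∅ ((I ∪ I').biUnion Finset.powerset) with hK
  have hKmem : ∀ s, s ∈ K ↔ s = ∅ ∨ ∃ t, (t ∈ I ∨ t ∈ I') ∧ s ⊆ t := by
    intro s; simp [hK]
  have hKdown : ∀ s ∈ K, ∀ t ⊆ s, t ∈ K := by
    intro s hs t ht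
    rw [hKmem] at hs ⊢
    rcases hs with rfl | ⟨u, hu, hsu⟩
    · left; exact Finset.subset_empty.1 ht
    · right; exact ⟨u, hu, ht.trans hsu⟩
  have hKcol : ∀ s ∈ K, (∀ x ∈ s, x % r ∈ Finset.range r) ∧ ∀ x ∈ s, ∀ y ∈ s, x % r = y % r → x = y := by
    intro s hs
    rw [hKmem] at hs
    rcases hs with rfl | ⟨u, hu, hsu⟩
    · simp
    · have hu' : (∀ x ∈ u, x % r ∈ Finset.range r) ∧ ∀ x ∈ u, ∀ y ∈ u, x % r = y % r → x = y := by
        rcases hu with hu | hu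
        · exact (hI.1 u hu).2
        · exact (hI'.1 u hu).2
      exact ⟨fun x hx => hu'.1 x (hsu hx), fun x hx y hy => hu'.2 x (hsu hx) y (hsu hy)⟩
  have hK1 : K.filter (fun s => s.card = k + 1) = I := by
    ext s
    rw [Finset.mem_filter, hKmem]
    constructor
    · rintro ⟨rfl | ⟨u, hu | hu, hsu⟩, hc⟩
      · simp at hc
      · rwa [Finset.eq_of_subset_of_card_le hsu (by rw [(hI.1 u hu).1, hc])]
      · have := Finset.card_le_card hsu
        rw [(hI'.1 u hu).1] at this
        omega
    · intro hs
      exact ⟨Or.inr ⟨s, Or.inl hs, subset_rfl⟩, (hI.1 s hs).1⟩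
  have hK0 : K.filter (fun s => s.card = k) = I' := by
    ext s
    rw [Finset.mem_filter, hKmem]
    constructor
    · rintro ⟨rfl | ⟨u, hu | hu, hsu⟩, hc⟩
      · simp only [Finset.card_empty] at hc
        subst hc
        obtain ⟨s, hs⟩ : I'.Nonempty := by
          rw [← Finset.card_pos, hIc', ← hcl, FFK.cl_zero]; norm_num
        have := Finset.card_eq_zero.1 (hI'.1 s hs).1
        rwa [this] at hs
      · apply hsub
        exact Finset.mem_shadow_iff_exists_mem_card_add_one.2 ⟨u, hu, hsu, by rw [(hI.1 u hu).1, hc]⟩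
      · rwa [Finset.eq_of_subset_of_card_le hsu (by rw [(hI'.1 u hu).1, hc])]
    · intro hs
      exact ⟨Or.inr ⟨s, Or.inr hs, subset_rfl⟩, (hI'.1 s hs).1⟩
  -- transfer to Fin n
  set U : Finset ℕ := K.biUnion id with hU
  have hUmem : ∀ x, x ∈ U ↔ ∃ s ∈ K, x ∈ s := by intro x; simp [hU]
  set emb : Fin U.card ↪ ℕ := (U.orderEmbOfFin rfl).toEmbedding with hemb
  have hembU : ∀ v, emb v ∈ U := fun v => U.orderEmbOfFin_mem rfl v
  have hsurj : ∀ x ∈ U, ∃ v, emb v = x := by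
    intro x hx
    have : x ∈ Set.range (U.orderEmbOfFin rfl) := by rw [Finset.range_orderEmbOfFin]; exact hx
    exact this
  have hcount : ∀ i, faceCount (Finset.univ.filter fun s : Finset (Fin U.card) => s.map emb ∈ K) i =
      (K.filter fun s => s.card = i).card := by
    intro i
    unfold faceCount
    apply Finset.card_bij (fun s _ => s.map emb)
    · intro s hs
      simp only [Finset.mem_filter, Finset.mem_univ, true_and] at hs
      simpa using hs
    · intro s _ t _ e
      exact Finset.map_injective emb e
    · intro s hs
      obtain ⟨h1, h2⟩ := Finset.mem_filter.1 hs
      have hmap : (Finset.univ.filter fun v => emb v ∈ s).map emb = s := by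
        ext x
        simp only [Finset.mem_map, Finset.mem_filter, Finset.mem_univ, true_and]
        constructor
        · rintro ⟨v, hv, rfl⟩; exact hv
        · intro hx
          obtain ⟨v, rfl⟩ := hsurj x ((hUmem x).2 ⟨s, h1, hx⟩)
          exact ⟨v, hx, rfl⟩
      refine ⟨Finset.univ.filter fun v => emb v ∈ s, ?_, hmap⟩
      simp only [Finset.mem_filter, Finset.mem_univ, true_and]
      refine ⟨by rw [hmap]; exact h1, ?_⟩
      rw [← h2, ← Finset.card_map emb, hmap]
  refine ⟨U.card, Finset.univ.filter fun s => s.map emb ∈ K, ⟨?_, ?_, ?_⟩, ?_, ?_, ?_⟩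
  · simp [hK]
  · intro v
    simp only [Finset.mem_filter, Finset.mem_univ, true_and, Finset.map_singleton]
    obtain ⟨s, hs, hv⟩ := (hUmem _).1 (hembU v)
    exact hKdown s hs _ (by simpa using hv)
  · intro s hs t ht
    simp only [Finset.mem_filter, Finset.mem_univ, true_and] at hs ⊢
    exact hKdown _ hs _ (Finset.map_subset_map.2 ht)
  · refine ⟨fun v => ⟨emb v % r, ?_⟩, ?_⟩
    · obtain ⟨s, hs, hv⟩ := (hUmem _).1 (hembU v)
      exact Finset.mem_range.1 ((hKcol s hs).1 _ hv)
    · intro s hs u hu v hv e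
      simp only [Finset.mem_filter, Finset.mem_univ, true_and] at hs
      simp only [Fin.mk.injEq] at e
      exact emb.injective ((hKcol _ hs).2 _ (Finset.mem_map_of_mem _ hu) _ (Finset.mem_map_of_mem _ hv) e)
  · rw [hcount, hK0, hIc']
  · rw [hcount, hK1, hIc]
end
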